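/- Let G be a finite insoluble group all of whose proper subgroups are soluble. If G is para-Nil-Hamiltonian, then G is isomorphic to A₅ or to SL(2,5). -/

import Mathlib

/-- A group is *minimal non-nilpotent* if it is not nilpotent but every proper
subgroup of it is nilpotent. -/
def MinimalNonNilpotent (G : Type*) [Group G] : Prop :=
  ¬ Group.IsNilpotent G ∧ ∀ H : Subgroup G, H ≠ ⊤ → Group.IsNilpotent H

/-- A group is *biminimal non-nilpotent* if it is neither nilpotent nor minimal
non-nilpotent, but every proper subgroup of it is nilpotent or minimal non-nilpotent. -/
def BiminimalNonNilpotent (G : Type*) [Group G] : Prop :=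
  ¬ Group.IsNilpotent G ∧ ¬ MinimalNonNilpotent G ∧
    ∀ H : Subgroup G, H ≠ ⊤ → (Group.IsNilpotent H ∨ MinimalNonNilpotent H)

/-- A group is *para-Nil-Hamiltonian* if it is not nilpotent and every non-normal
subgroup of it is either nilpotent or minimal non-nilpotent. -/
def ParaNilHamiltonian (G : Type*) [Group G] : Prop :=
  ¬ Group.IsNilpotent G ∧
    ∀ H : Subgroup G, ¬ H.Normal → (Group.IsNilpotent H ∨ MinimalNonNilpotent H)

/-- A group is *meta-Nil-Hamiltonian* if every non-nilpotent subgroup of it is normal. -/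
def MetaNilHamiltonian (G : Type*) [Group G] : Prop :=
  ∀ H : Subgroup G, ¬ Group.IsNilpotent H → H.Normal

/-- A group is *locally graded* if every non-trivial finitely generated subgroup of it
contains a proper subgroup of finite index. -/
def LocallyGraded (G : Type*) [Group G] : Prop :=
  ∀ H : Subgroup G, H ≠ ⊥ → Group.FG H → ∃ K : Subgroup H, K ≠ ⊤ ∧ K.FiniteIndex

/-- A group is abelian if its multiplication commutes. -/
def Abelian (G : Type*) [Group G] : Prop := ∀ a b : G, a * b = b * a

/-- A group is *minimal non-abelian* if it is not abelian but every proper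
subgroup of it is abelian. -/
def MinimalNonAbelian (G : Type*) [Group G] : Prop :=
  ¬ Abelian G ∧ ∀ H : Subgroup G, H ≠ ⊤ → Abelian H

/-- A group is *biminimal non-abelian* if it is neither abelian nor minimal non-abelian,
but every proper subgroup of it is abelian or minimal non-abelian. -/
def BiminimalNonAbelian (G : Type*) [Group G] : Prop :=
  ¬ Abelian G ∧ ¬ MinimalNonAbelian G ∧
    ∀ H : Subgroup G, H ≠ ⊤ → (Abelian H ∨ MinimalNonAbelian H)

/-- A group is *parahamiltonian* if it is not abelian and every non-normal subgroup
of it is either abelian or minimal non-abelian. -/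
def Parahamiltonian (G : Type*) [Group G] : Prop :=
  ¬ Abelian G ∧ ∀ H : Subgroup G, ¬ H.Normal → (Abelian H ∨ MinimalNonAbelian H)

/-- A group is *locally nilpotent* if every finitely generated subgroup of it is nilpotent. -/
def LocallyNilpotent (G : Type*) [Group G] : Prop :=
  ∀ H : Subgroup G, Group.FG H → Group.IsNilpotent H

section

open Subgroup
open scoped Pointwise commutatorElement

section SchmidtGroups

variable {M : Type*} [Group M]

theorem commute_of_isNilpotent_of_isPGroup [Finite M] [Group.IsNilpotent M] {p q : ℕ}
    [Fact p.Prime] [Fact q.Prime] (hpq : p ≠ q) {A B : Subgroup M} (hA : IsPGroup p A)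
    (hB : IsPGroup q B) {a b : M} (ha : a ∈ A) (hb : b ∈ B) : Commute a b := by
  obtain ⟨P, hP⟩ := hA.exists_le_sylow
  obtain ⟨Q, hQ⟩ := hB.exists_le_sylow
  exact commute_of_normal_of_disjoint P Q inferInstance inferInstance
    (IsPGroup.disjoint_of_ne p q hpq _ _ P.2 Q.2) a b (hP ha) (hQ hb)

theorem isNilpotent_of_le {H K : Subgroup M} (h : H ≤ K) (hK : Group.IsNilpotent K) :
    Group.IsNilpotent H :=
  have := hK
  Group.nilpotent_of_mulEquiv (subgroupOfEquivOfLe h)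

theorem le_centralizer_of_isNilpotent_sup [Finite M] {p q : ℕ}
    [Fact p.Prime] [Fact q.Prime] (hpq : p ≠ q) {A B : Subgroup M} (hA : IsPGroup p A)
    (hB : IsPGroup q B) (h : Group.IsNilpotent (A ⊔ B : Subgroup M)) :
    A ≤ centralizer (B : Set M) := by
  intro a ha
  rw [mem_centralizer_iff]
  intro b hb
  have key := commute_of_isNilpotent_of_isPGroup (M := (A ⊔ B : Subgroup M)) hpq
    (A := A.subgroupOf (A ⊔ B)) (B := B.subgroupOf (A ⊔ B))
    (hA.of_equiv (subgroupOfEquivOfLe le_sup_left).symm)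
    (hB.of_equiv (subgroupOfEquivOfLe le_sup_right).symm)
    (a := ⟨a, mem_sup_left ha⟩) (b := ⟨b, mem_sup_right hb⟩) ha hb
  exact congrArg Subtype.val key.eq.symm

theorem sylow_normal_of_le_isNilpotent_normal [Finite M] {p : ℕ} [Fact p.Prime]
    {K : Subgroup M} [K.Normal] (hK : Group.IsNilpotent K) (P : Sylow p M)
    (h : (P : Subgroup M) ≤ K) : (P : Subgroup M).Normal := by
  have h1 : ((P.subtype h : Sylow p K) : Subgroup K).Characteristic :=
    Sylow.characteristic_of_normal _ inferInstance
  have h2 : (((P.subtype h : Sylow p K) : Subgroup K).map K.subtype).Normal := inferInstance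
  rwa [Sylow.coe_subtype, map_subgroupOf_eq_of_le h] at h2

theorem exists_normal_prime_index [Finite M] [Nontrivial M] [Group.IsSolvable M] :
    ∃ K : Subgroup M, K.Normal ∧ K.index.Prime := by
  have h := Group.IsSolvable.commutator_lt_top_of_nontrivial M
  obtain ⟨K, hK, hle⟩ := (eq_top_or_exists_le_coatom (commutator M)).resolve_left h.ne
  have hn : K.Normal := Normal.of_commutator_le M hle
  have : IsSimpleGroup (M ⧸ K) := by
    refine { exists_pair_ne := ?_, eq_bot_or_eq_top_of_normal := ?_ }
    · have : Nontrivial (M ⧸ K) := by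
        rw [QuotientGroup.nontrivial_iff]; exact hK.1
      exact exists_pair_ne _
    · intro H _
      have h1 : K ≤ H.comap (QuotientGroup.mk' K) := by
        conv_lhs => rw [← QuotientGroup.ker_mk' K]
        exact Subgroup.ker_le_comap _ _
      rcases hK.le_iff.mp h1 with h2 | h2
      · right
        rw [← Subgroup.map_comap_eq_self_of_surjective (QuotientGroup.mk'_surjective K) H, h2]
        exact Subgroup.map_top_of_surjective _ (QuotientGroup.mk'_surjective K)
      · left
        rw [← Subgroup.map_comap_eq_self_of_surjective (QuotientGroup.mk'_surjective K) H, h2]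
        simp
  have hc : ∀ a b : M ⧸ K, a * b = b * a := IsSimpleGroup.comm_iff_isSolvable.mpr inferInstance
  let : CommGroup (M ⧸ K) := { (inferInstance : Group (M ⧸ K)) with mul_comm := hc }
  refine ⟨K, hn, ?_⟩
  rw [Subgroup.index]
  exact IsSimpleGroup.prime_card

end SchmidtGroups

/-- `SchmidtPair p q H P Q` records the structure of a soluble minimal non-nilpotent subgroup `H`
with normal Sylow `p`-subgroup `P` and a non-normal cyclic Sylow `q`-subgroup `Q`. -/
structure SchmidtPair {G : Type*} [Group G] (p q : ℕ) (H P Q : Subgroup G) : Prop where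
  p_prime : p.Prime
  q_prime : q.Prime
  ne : p ≠ q
  isPGroup_left : IsPGroup p P
  isPGroup_right : IsPGroup q Q
  sup_eq : P ⊔ Q = H
  card_eq : Nat.card H = Nat.card P * Nat.card Q
  normal_left : H ≤ normalizer (P : Set G)
  not_normal_right : ¬ H ≤ normalizer (Q : Set G)
  central_of_normal : ∀ N ≤ P, N ≠ P → H ≤ normalizer (N : Set G) → N ≤ centralizer (H : Set G)
  central_of_lt : ∀ R < Q, R ≤ centralizer (H : Set G)
  isCyclic_right : IsCyclic Q
  inf_centralizer_le : P ⊓ centralizer (Q : Set G) ≤ centralizer (H : Set G)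

section SchmidtGroups

variable {M : Type*} [Group M]

theorem le_normalizer_of_forall_conj_mem {H X : Subgroup M}
    (h : ∀ y ∈ H, ∀ x ∈ X, y * x * y⁻¹ ∈ X) : H ≤ normalizer (X : Set M) := by
  intro y hy
  rw [mem_normalizer_iff]
  refine fun x => ⟨h y hy x, fun hx => ?_⟩
  have h1 := h y⁻¹ (inv_mem hy) _ hx
  rwa [show y⁻¹ * (y * x * y⁻¹) * y⁻¹⁻¹ = x by group] at h1

theorem eq_top_of_forall_sylow_le [Finite M] (H : Subgroup M)
    (h : ∀ r : ℕ, r.Prime → ∃ P : Sylow r M, (P : Subgroup M) ≤ H) : H = ⊤ := by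
  rw [← Subgroup.index_eq_one]
  by_contra hne
  obtain ⟨r, hr, hdvd⟩ := Nat.exists_prime_and_dvd hne
  have := Fact.mk hr
  obtain ⟨P, hP⟩ := h r hr
  exact P.not_dvd_index (hdvd.trans (Subgroup.index_dvd_of_le hP))

theorem card_sup_eq_of_normal_of_disjoint [Finite M] (A B : Subgroup M) [A.Normal]
    (h : Disjoint A B) : Nat.card (A ⊔ B : Subgroup M) = Nat.card A * Nat.card B := by
  have h1 : ((A ⊔ B : Subgroup M) : Set M) = (A : Set M) * (B : Set M) := normal_mul A B
  have h2 : Nat.card (A × B) = Nat.card ((A ⊔ B : Subgroup M) : Set M) := by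
    refine Nat.card_congr (Equiv.ofBijective
      (fun x => ⟨x.1 * x.2, by rw [h1]; exact Set.mul_mem_mul x.1.2 x.2.2⟩) ⟨?_, ?_⟩)
    · intro x y hxy
      exact mul_injective_of_disjoint h (congrArg Subtype.val hxy)
    · rintro ⟨z, hz⟩
      rw [h1] at hz
      obtain ⟨a, ha, b, hb, rfl⟩ := hz
      exact ⟨(⟨a, ha⟩, ⟨b, hb⟩), rfl⟩
  rw [Nat.card_prod] at h2
  exact h2.symm

theorem isCoprime_le_of_index_prime {K : Subgroup M} [K.Normal] {q : ℕ} (hq : q.Prime)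
    (hi : K.index = q) {p : ℕ} (hp : p.Prime) (hpq : p ≠ q) {P : Subgroup M}
    (hP : IsPGroup p P) : P ≤ K := by
  intro x hx
  obtain ⟨n, hn⟩ := hP ⟨x, hx⟩
  have hn' : x ^ p ^ n = 1 := congrArg Subtype.val hn
  have h1 : ((x : M) : M ⧸ K) ^ p ^ n = 1 := by
    rw [← QuotientGroup.mk_pow, hn']; rfl
  have h2 : ((x : M) : M ⧸ K) ^ q = 1 := by
    rw [← QuotientGroup.mk_pow, QuotientGroup.eq_one_iff, ← hi]
    exact Subgroup.pow_index_mem _ _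
  have hc : (p ^ n).Coprime q := Nat.Coprime.pow_left n ((Nat.coprime_primes hp hq).2 hpq)
  have h3 := Nat.dvd_gcd (orderOf_dvd_of_pow_eq_one h1) (orderOf_dvd_of_pow_eq_one h2)
  rw [Nat.Coprime] at hc
  rw [hc, Nat.dvd_one, orderOf_eq_one_iff] at h3
  exact (QuotientGroup.eq_one_iff x).1 h3

theorem commutator_self_ne_of_isPGroup [Finite M] {p : ℕ} (hp : p.Prime) {P : Subgroup M}
    (hP : IsPGroup p P) (hne : P ≠ ⊥) : ⁅P, P⁆ ≠ P := by
  have := Fact.mk hp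
  have := hP.isNilpotent
  have : Nontrivial P := (Subgroup.nontrivial_iff_ne_bot P).2 hne
  have h1 := Group.IsSolvable.commutator_lt_top_of_nontrivial P
  intro h
  apply h1.ne
  apply Subgroup.map_injective P.subtype_injective
  rw [_root_.commutator, Subgroup.map_commutator, ← MonoidHom.range_eq_map, P.range_subtype, h]

theorem MinimalNonNilpotent.exists_schmidtPair_top [Finite M] [Group.IsSolvable M]
    (hM : MinimalNonNilpotent M) :
    ∃ (p q : ℕ) (P Q : Subgroup M), SchmidtPair p q ⊤ P Q := by
  obtain ⟨hn, hsub⟩ := hM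
  have : Nontrivial M := by
    by_contra h
    rw [not_nontrivial_iff_subsingleton] at h
    exact hn inferInstance
  obtain ⟨K, hKn, hKp⟩ := exists_normal_prime_index (M := M)
  have hKtop : K ≠ ⊤ := by
    rintro rfl
    simp [Nat.not_prime_one] at hKp
  have hKnil := hsub K hKtop
  obtain ⟨q, hq⟩ : ∃ q, K.index = q := ⟨_, rfl⟩
  rw [hq] at hKp
  have hqf := Fact.mk hKp
  have hnormal : ∀ r : ℕ, r.Prime → r ≠ q → ∀ P : Sylow r M, (P : Subgroup M).Normal := by
    intro r hr hrq P
    have := Fact.mk hr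
    exact sylow_normal_of_le_isNilpotent_normal hKnil P
      (isCoprime_le_of_index_prime hKp hq hr hrq P.2)
  obtain ⟨Q, hQ⟩ : ∃ Q : Sylow q M, ¬ (Q : Subgroup M).Normal := by
    by_contra! hall
    apply hn
    refine (Group.isNilpotent_of_finite_tfae.out 0 3 rfl rfl).mpr fun r hr P => ?_
    by_cases hrq : r = q
    · subst hrq
      exact hall P
    · exact hnormal r hr.out hrq P
  obtain ⟨p, hp, hpq, P, hPQ⟩ : ∃ p : ℕ, p.Prime ∧ p ≠ q ∧ ∃ P : Sylow p M,
      ¬ (P : Subgroup M) ≤ centralizer ((Q : Subgroup M) : Set M) := by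
    by_contra! hall
    apply hQ
    rw [← normalizer_eq_top_iff]
    apply eq_top_of_forall_sylow_le
    intro r hr
    have := Fact.mk hr
    by_cases hrq : r = q
    · subst hrq
      exact ⟨Q, le_normalizer⟩
    · exact ⟨default, (hall r hr hrq default).trans (centralizer_le_normalizer _)⟩
  have hpf := Fact.mk hp
  have hPn : (P : Subgroup M).Normal := hnormal p hp hpq P
  have hsup : (P : Subgroup M) ⊔ Q = ⊤ := by
    by_contra h
    exact hPQ (le_centralizer_of_isNilpotent_sup hpq P.2 Q.2 (hsub _ h))
  have hdisj : Disjoint (P : Subgroup M) Q := IsPGroup.disjoint_of_ne p q hpq _ _ P.2 Q.2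
  have hcard : Nat.card M = Nat.card P * Nat.card Q := by
    have := card_sup_eq_of_normal_of_disjoint (P : Subgroup M) Q hdisj
    rwa [hsup, Subgroup.card_top] at this
  have hleft : ∀ N ≤ (P : Subgroup M), N ≠ P → N.Normal → N ≤ center M := by
    intro N hN hne hNn
    have hlt : Nat.card N < Nat.card P := by
      refine lt_of_le_of_ne (Subgroup.card_le_of_le hN) fun h => hne ?_
      exact Subgroup.eq_of_le_of_card_ge hN h.ge
    have h1 : N ⊔ Q ≠ ⊤ := by
      intro h
      have := card_sup_eq_of_normal_of_disjoint N Q (hdisj.mono_left hN)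
      rw [h, Subgroup.card_top, hcard] at this
      exact hlt.ne' (Nat.eq_of_mul_eq_mul_right Nat.card_pos this)
    have h2 : N ≤ centralizer ((Q : Subgroup M) : Set M) :=
      le_centralizer_of_isNilpotent_sup hpq (P.2.to_le hN) Q.2 (hsub _ h1)
    rw [le_centralizer_iff] at h2
    by_contra hc
    have h3 : centralizer (N : Set M) ≠ ⊤ := by
      rw [Ne, centralizer_eq_top_iff_subset]
      exact hc
    exact hQ (sylow_normal_of_le_isNilpotent_normal (hsub _ h3) Q h2)
  have hright : ∀ R < (Q : Subgroup M), (P : Subgroup M) ≤ centralizer (R : Set M) := by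
    intro R hR
    have hlt : Nat.card R < Nat.card Q := by
      refine lt_of_le_of_ne (Subgroup.card_le_of_le hR.le) fun h => hR.ne ?_
      exact Subgroup.eq_of_le_of_card_ge hR.le h.ge
    have h1 : (P : Subgroup M) ⊔ R ≠ ⊤ := by
      intro h
      have := card_sup_eq_of_normal_of_disjoint (P : Subgroup M) R (hdisj.mono_right hR.le)
      rw [h, Subgroup.card_top, hcard] at this
      exact hlt.ne' (Nat.eq_of_mul_eq_mul_left Nat.card_pos this)
    exact le_centralizer_of_isNilpotent_sup hpq P.2 (Q.2.to_le hR.le) (hsub _ h1)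
  have hcyc : IsCyclic (Q : Subgroup M) := by
    by_contra hnc
    apply hPQ
    intro x hx
    rw [mem_centralizer_iff]
    intro y hy
    have hlt : zpowers y < (Q : Subgroup M) := by
      refine lt_of_le_of_ne (zpowers_le.2 hy) fun h => hnc ?_
      rw [← h]
      infer_instance
    exact mem_centralizer_iff.1 (hright _ hlt hx) y (mem_zpowers y)
  have hcentralQ : ∀ R < (Q : Subgroup M), R ≤ center M := by
    intro R hR
    refine SetLike.coe_subset_coe.1 ?_
    rw [← centralizer_eq_top_iff_subset, ← top_le_iff, ← hsup]
    refine sup_le (hright R hR) fun x hx => ?_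
    rw [mem_centralizer_iff]
    intro y hy
    have := IsCyclic.isMulCommutative (α := (Q : Subgroup M))
    exact congrArg Subtype.val (this.is_comm.comm ⟨y, hR.le hy⟩ ⟨x, hx⟩)
  have htop : ∀ X : Subgroup M, X ≤ center M → X ≤ centralizer ((⊤ : Subgroup M) : Set M) := by
    intro X hX
    rwa [coe_top, centralizer_univ]
  have hPbot : (P : Subgroup M) ≠ ⊥ := by
    intro h
    apply hPQ
    rw [h]
    exact bot_le
  have hcomm : ⁅(P : Subgroup M), (P : Subgroup M)⁆ ≤ center M :=
    hleft _ (commutator_le_left _ _) (commutator_self_ne_of_isPGroup hp P.2 hPbot) inferInstance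
  refine ⟨p, q, P, Q, hp, hKp, hpq, P.2, Q.2, hsup, ?_, ?_, ?_, ?_, ?_, hcyc, ?_⟩
  · rw [Subgroup.card_top, hcard]
  · rw [normalizer_eq_top_iff.2 hPn]
  · rw [top_le_iff, normalizer_eq_top_iff]
    exact hQ
  · intro N hN hne hNn
    rw [top_le_iff, normalizer_eq_top_iff] at hNn
    exact htop _ (hleft N hN hne hNn)
  · exact fun R hR => htop _ (hcentralQ R hR)
  · apply htop
    apply hleft _ inf_le_left
    · intro h
      exact hPQ (h ▸ inf_le_right)
    · rw [← normalizer_eq_top_iff, ← top_le_iff, ← hsup]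
      refine sup_le (le_normalizer_of_forall_conj_mem fun g hg x hx => ?_)
        (le_normalizer_of_forall_conj_mem fun g hg x hx => ?_)
      · have h1 : g * x * g⁻¹ = ⁅g, x⁆ * x := by
          rw [commutatorElement_def]; group
        rw [h1]
        have h2 : ⁅g, x⁆ ∈ ⁅(P : Subgroup M), (P : Subgroup M)⁆ :=
          commutator_mem_commutator hg hx.1
        exact mul_mem ⟨commutator_le_left (P : Subgroup M) P h2,
          center_le_centralizer _ (hcomm h2)⟩ hx
      · rwa [mem_centralizer_iff.1 hx.2 g hg, mul_inv_cancel_right]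

theorem MinimalNonNilpotent.exists_schmidtPair {G : Type*} [Group G] [Finite G]
    {H : Subgroup G} (hs : Group.IsSolvable H) (hH : MinimalNonNilpotent H) :
    ∃ (p q : ℕ) (P Q : Subgroup G), SchmidtPair p q H P Q := by
  obtain ⟨p, q, P, Q, h⟩ := hH.exists_schmidtPair_top
  have hcent : ∀ X : Subgroup H, X ≤ centralizer ((⊤ : Subgroup H) : Set H) →
      X.map H.subtype ≤ centralizer (H : Set G) := by
    rintro X hX _ ⟨x, hx, rfl⟩
    rw [mem_centralizer_iff]
    intro y hy
    exact congrArg Subtype.val (mem_centralizer_iff.1 (hX hx) ⟨y, hy⟩ (mem_top _))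
  have hnorm : ∀ X : Subgroup H, H ≤ normalizer (X.map H.subtype : Set G) ↔
      ⊤ ≤ normalizer (X : Set H) := by
    intro X
    constructor
    · intro hX
      refine le_normalizer_of_forall_conj_mem fun y _ x hx => ?_
      obtain ⟨z, hz, hz'⟩ := (mem_normalizer_iff.1 (hX y.2) x).1 ⟨x, hx, rfl⟩
      have h1 : z = y * x * y⁻¹ := Subtype.ext hz'
      exact h1 ▸ hz
    · intro hX
      refine le_normalizer_of_forall_conj_mem ?_
      rintro y hy _ ⟨z, hz, rfl⟩
      exact ⟨_, (mem_normalizer_iff.1 (hX (mem_top ⟨y, hy⟩)) z).1 hz, rfl⟩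
  have hsubg : ∀ (X : Subgroup H) (N : Subgroup G), N ≤ X.map H.subtype →
      N.subgroupOf H ≤ X ∧ (N.subgroupOf H).map H.subtype = N := by
    intro X N hN
    refine ⟨?_, map_subgroupOf_eq_of_le (hN.trans (map_subtype_le X))⟩
    intro x hx
    obtain ⟨z, hz, hz'⟩ := hN hx
    have h1 : z = x := Subtype.ext hz'
    exact h1 ▸ hz
  have hcd : ∀ X : Subgroup H, Nat.card (X.map H.subtype) = Nat.card X := fun X =>
    Subgroup.card_map_of_injective H.subtype_injective
  refine ⟨p, q, P.map H.subtype, Q.map H.subtype, h.p_prime, h.q_prime, h.ne,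
    h.isPGroup_left.map _, h.isPGroup_right.map _, ?_, ?_, (hnorm P).2 h.normal_left,
    fun h1 => h.not_normal_right ((hnorm Q).1 h1), ?_, ?_, ?_, ?_⟩
  · rw [← Subgroup.map_sup, h.sup_eq, ← MonoidHom.range_eq_map, H.range_subtype]
  · rw [hcd, hcd, ← h.card_eq, Subgroup.card_top]
  · intro N hN hne hNn
    obtain ⟨h1, h2⟩ := hsubg P N hN
    rw [← h2] at hNn hne ⊢
    exact hcent _ (h.central_of_normal _ h1 (fun h3 => hne (by rw [h3])) ((hnorm _).1 hNn))
  · intro R hR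
    obtain ⟨h1, h2⟩ := hsubg Q R hR.le
    rw [← h2] at hR ⊢
    exact hcent _ (h.central_of_lt _ (lt_of_le_of_ne h1 (fun h3 => hR.ne (by rw [h3]))))
  · have := h.isCyclic_right
    exact isCyclic_of_surjective (Q.equivMapOfInjective _ H.subtype_injective)
      (Q.equivMapOfInjective _ H.subtype_injective).surjective
  · rintro _ ⟨⟨x, hx, rfl⟩, hx2⟩
    refine hcent _ h.inf_centralizer_le ⟨x, ⟨hx, ?_⟩, rfl⟩
    change x ∈ centralizer (Q : Set H)
    rw [mem_centralizer_iff]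
    intro y hy
    exact Subtype.ext (mem_centralizer_iff.1 hx2 y ⟨y, hy, rfl⟩)

end SchmidtGroups

/-- Soluble proper subgroups, each nilpotent or minimal non-nilpotent, in a simple insoluble
group. -/
structure IsSmallSimple (S : Type*) [Group S] : Prop where
  simple : IsSimpleGroup S
  not_solvable : ¬ Group.IsSolvable S
  solvable : ∀ H : Subgroup S, H ≠ ⊤ → Group.IsSolvable H
  nilpotent_or : ∀ H : Subgroup S, H ≠ ⊤ → Group.IsNilpotent H ∨ MinimalNonNilpotent H

namespace SchmidtPair

variable {G : Type*} [Group G] {p q : ℕ} {H P Q : Subgroup G}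

theorem left_le (h : SchmidtPair p q H P Q) : P ≤ H := h.sup_eq ▸ le_sup_left

theorem right_le (h : SchmidtPair p q H P Q) : Q ≤ H := h.sup_eq ▸ le_sup_right

theorem right_ne_bot (h : SchmidtPair p q H P Q) : Q ≠ ⊥ := by
  rintro rfl
  apply h.not_normal_right
  rw [normalizer_eq_top_iff.2 inferInstance]
  exact le_top

variable [Finite G]

theorem le_left (h : SchmidtPair p q H P Q) {X : Subgroup G} (hXH : X ≤ H)
    (hX : IsPGroup p X) : X ≤ P := by
  have := Fact.mk h.p_prime
  have := Fact.mk h.q_prime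
  have h1 : IsPGroup p (X ⊔ P : Subgroup G) :=
    hX.to_sup_of_normal_right' h.isPGroup_left (hXH.trans h.normal_left)
  have h2 : Nat.card (X ⊔ P : Subgroup G) ∣ Nat.card P * Nat.card Q := by
    rw [← h.card_eq]
    exact card_dvd_of_le (sup_le hXH h.left_le)
  have h3 : (Nat.card (X ⊔ P : Subgroup G)).Coprime (Nat.card Q) :=
    IsPGroup.coprime_card_of_ne p q h.ne _ _ h1 h.isPGroup_right
  have h4 := Subgroup.eq_of_le_of_card_ge (H := P) (K := X ⊔ P) le_sup_right
    (Nat.le_of_dvd Nat.card_pos (h3.dvd_of_dvd_mul_right h2))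
  rw [h4]
  exact le_sup_left

theorem card_dvd_right (h : SchmidtPair p q H P Q) {X : Subgroup G} (hXH : X ≤ H)
    (hX : IsPGroup q X) : Nat.card X ∣ Nat.card Q := by
  have := Fact.mk h.p_prime
  have := Fact.mk h.q_prime
  have h2 : Nat.card X ∣ Nat.card P * Nat.card Q := by
    rw [← h.card_eq]
    exact card_dvd_of_le hXH
  exact (IsPGroup.coprime_card_of_ne q p h.ne.symm _ _ hX h.isPGroup_left).dvd_of_dvd_mul_left h2

theorem eq_or_eq_of_isPGroup (h : SchmidtPair p q H P Q) {r : ℕ} (hr : r.Prime) {X : Subgroup G}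
    (hXH : X ≤ H) (hX : IsPGroup r X) (hne : X ≠ ⊥) : r = p ∨ r = q := by
  have := Fact.mk h.p_prime
  have := Fact.mk h.q_prime
  have := Fact.mk hr
  by_contra! hc
  have h2 : Nat.card X ∣ Nat.card P * Nat.card Q := by
    rw [← h.card_eq]
    exact card_dvd_of_le hXH
  have h3 := (IsPGroup.coprime_card_of_ne r p hc.1 _ _ hX h.isPGroup_left).dvd_of_dvd_mul_left h2
  have h4 := Nat.Coprime.eq_one_of_dvd
    (IsPGroup.coprime_card_of_ne r q hc.2 _ _ hX h.isPGroup_right) h3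
  exact hne (Subgroup.card_eq_one.1 h4)

theorem exists_conj (h : SchmidtPair p q H P Q) {X : Subgroup G} (hXH : X ≤ H)
    (hX : IsPGroup q X) : ∃ g ∈ H, X ≤ MulAut.conj g • Q := by
  have := Fact.mk h.p_prime
  have := Fact.mk h.q_prime
  have hQ : IsPGroup q (Q.subgroupOf H) :=
    h.isPGroup_right.of_equiv (subgroupOfEquivOfLe h.right_le).symm
  obtain ⟨R, hR⟩ := hQ.exists_le_sylow
  have hX' : IsPGroup q (X.subgroupOf H) := hX.of_equiv (subgroupOfEquivOfLe hXH).symm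
  obtain ⟨T, hT⟩ := hX'.exists_le_sylow
  obtain ⟨g, hg⟩ := MulAction.exists_smul_eq H R T
  have hRQ : (R : Subgroup H) = Q.subgroupOf H := by
    refine (Subgroup.eq_of_le_of_card_ge hR ?_).symm
    rw [Nat.card_congr (subgroupOfEquivOfLe h.right_le).toEquiv]
    have h1 := h.card_dvd_right (X := (R : Subgroup H).map H.subtype) (map_subtype_le _)
      (R.2.map _)
    rw [Subgroup.card_map_of_injective H.subtype_injective] at h1
    exact Nat.le_of_dvd Nat.card_pos h1
  refine ⟨g, g.2, fun x hx => ?_⟩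
  have h2 : (⟨x, hXH hx⟩ : H) ∈ (T : Subgroup H) := hT hx
  rw [← hg, Sylow.coe_subgroup_smul, hRQ, mem_pointwise_smul_iff_inv_smul_mem] at h2
  rw [mem_pointwise_smul_iff_inv_smul_mem]
  simpa [mem_subgroupOf, MulAut.smul_def, ← map_inv] using h2

theorem isCyclic_of_isPGroup (h : SchmidtPair p q H P Q) {X : Subgroup G} (hXH : X ≤ H)
    (hX : IsPGroup q X) : IsCyclic X := by
  obtain ⟨g, -, hg⟩ := h.exists_conj hXH hX
  have := h.isCyclic_right
  have h1 : IsCyclic (MulAut.conj g • Q : Subgroup G) :=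
    isCyclic_of_surjective (equivSMul (MulAut.conj g) Q) (equivSMul (MulAut.conj g) Q).surjective
  exact isCyclic_of_injective (inclusion hg) (inclusion_injective hg)

theorem inf_centralizer_le_of_card_eq (h : SchmidtPair p q H P Q) {X : Subgroup G} (hXH : X ≤ H)
    (hX : IsPGroup q X) (hc : Nat.card X = Nat.card Q) :
    P ⊓ centralizer (X : Set G) ≤ centralizer (H : Set G) := by
  obtain ⟨g, hgH, hg⟩ := h.exists_conj hXH hX
  have hXQ : X = MulAut.conj g • Q := by
    refine Subgroup.eq_of_le_of_card_ge hg ?_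
    rw [hc, Nat.card_congr (equivSMul (MulAut.conj g) Q).toEquiv]
  rintro x ⟨hxP, hxX⟩
  have h1 : g⁻¹ * x * g ∈ centralizer (H : Set G) := by
    refine h.inf_centralizer_le ⟨?_, ?_⟩
    · have := (mem_normalizer_iff.1 (h.normal_left (inv_mem hgH)) x).1 hxP
      simpa using this
    · change _ ∈ centralizer (Q : Set G)
      rw [mem_centralizer_iff]
      intro y hy
      have h2 : g * y * g⁻¹ ∈ X := by
        rw [hXQ, mem_pointwise_smul_iff_inv_smul_mem]
        simpa [MulAut.smul_def, ← map_inv, mul_assoc] using hy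
      have h3 := mem_centralizer_iff.1 hxX _ h2
      calc y * (g⁻¹ * x * g) = g⁻¹ * (g * y * g⁻¹ * x) * g := by group
        _ = g⁻¹ * (x * (g * y * g⁻¹)) * g := by rw [h3]
        _ = _ := by group
  rw [mem_centralizer_iff]
  intro y hy
  have h4 := mem_centralizer_iff.1 h1 (g⁻¹ * y * g) (mul_mem (mul_mem (inv_mem hgH) hy) hgH)
  have h5 : g * (g⁻¹ * y * g * (g⁻¹ * x * g)) * g⁻¹ = g * (g⁻¹ * x * g * (g⁻¹ * y * g)) * g⁻¹ := by
    rw [h4]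
  simpa [mul_assoc] using h5

end SchmidtPair

section Auxiliary

variable {G : Type*} [Group G]

theorem normalizer_le_normalizer_of_isCyclic {D W : Subgroup G} (hDW : D ≤ W)
    (hW : IsCyclic W) : normalizer (W : Set G) ≤ normalizer (D : Set G) := by
  refine le_normalizer_of_forall_conj_mem fun g hg x hx => ?_
  obtain ⟨⟨w, hw⟩, hgen⟩ := hW.exists_generator
  obtain ⟨k, hk⟩ := hgen ⟨g * w * g⁻¹, (mem_normalizer_iff.1 hg w).1 hw⟩
  obtain ⟨m, hm⟩ := hgen ⟨x, hDW hx⟩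
  have hk' : w ^ k = g * w * g⁻¹ := congrArg Subtype.val hk
  have hm' : w ^ m = x := congrArg Subtype.val hm
  have h1 : g * x * g⁻¹ = x ^ k := by
    rw [← hm', ← conj_zpow, ← hk', ← zpow_mul, ← zpow_mul, mul_comm]
  rw [h1]
  exact zpow_mem hx k

theorem eq_of_inf_normalizer_le [Finite G] {p : ℕ} [Fact p.Prime] {P W : Subgroup G}
    (hP : IsPGroup p P) (hWP : W ≤ P) (h : P ⊓ normalizer (W : Set G) ≤ W) : W = P := by
  by_contra hne
  have := hP.isNilpotent
  have h1 : W.subgroupOf P < ⊤ := by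
    rw [lt_top_iff_ne_top, Ne, subgroupOf_eq_top]
    exact fun h2 => hne (le_antisymm hWP h2)
  have h2 := Group.normalizerCondition_of_isNilpotent (G := P) _ h1
  obtain ⟨x, hx, hx'⟩ := SetLike.exists_of_lt h2
  rw [← subgroupOf_normalizer_eq hWP] at hx
  exact hx' (h ⟨x.2, hx⟩)

theorem Sylow.le_of_le_normalizer {p : ℕ} {X : Subgroup G} (hX : IsPGroup p X)
    (P : Sylow p G) (h : X ≤ normalizer ((P : Subgroup G) : Set G)) : X ≤ P := by
  have h1 : X ⊓ normalizer ((P : Subgroup G) : Set G) = X ⊓ P := hX.inf_normalizer_sylow P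
  rw [inf_eq_left.2 h] at h1
  exact inf_eq_left.1 h1.symm

theorem not_isNilpotent_normalizer_of_fusion [Finite G] (hperf : commutator G = ⊤) {p : ℕ}
    [Fact p.Prime] (P : Sylow p G) (hP : (P : Subgroup G) ≠ ⊥)
    (hfus : ∀ x ∈ (P : Subgroup G), ∀ g : G, g * x * g⁻¹ ∈ (P : Subgroup G) →
      ∃ n ∈ normalizer ((P : Subgroup G) : Set G), n * x * n⁻¹ = g * x * g⁻¹) :
    ¬ Group.IsNilpotent (normalizer ((P : Subgroup G) : Set G)) := by
  intro hn
  set N := normalizer ((P : Subgroup G) : Set G) with hN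
  have h1 : (P : Subgroup G) ≤ ⁅(P : Subgroup G), N⁆ := by
    have h2 := Subgroup.commutator_inf_eq_focalSubgroup P
    rw [hperf, top_inf_eq] at h2
    conv_lhs => rw [h2]
    rw [focalSubgroup_def, closure_le]
    rintro _ ⟨hg, x, hx, u, rfl⟩
    have h3 : u * x⁻¹ * u⁻¹ = x⁻¹ * ⁅x, u⁆ := by rw [commutatorElement_def]; group
    obtain ⟨n, hnN, hn⟩ := hfus x⁻¹ (inv_mem hx) u (h3 ▸ mul_mem (inv_mem hx) hg)
    have h4 : ⁅x, u⁆ = ⁅x, n⁆ := by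
      have : ⁅x, u⁆ = x * (u * x⁻¹ * u⁻¹) := by rw [commutatorElement_def]; group
      rw [this, ← hn, commutatorElement_def]; group
    rw [h4]
    exact commutator_mem_commutator hx hnN
  obtain ⟨n, hn⟩ := (isNilpotent_iff_lowerCentralSeries (S := N)).1 hn
  have h2 : ∀ k, (P : Subgroup G) ≤ N.lowerCentralSeries k := by
    intro k
    induction k with
    | zero => exact le_normalizer
    | succ k ih =>
      rw [Subgroup.lowerCentralSeries_succ]
      exact h1.trans (commutator_mono ih le_rfl)
  exact hP (le_bot_iff.1 (hn ▸ h2 n))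

end Auxiliary

namespace IsSmallSimple

variable {S : Type*} [Group S]

theorem commutator_eq_top (hS : IsSmallSimple S) : commutator S = ⊤ := by
  have := hS.simple
  rcases IsSimpleGroup.eq_bot_or_eq_top_of_normal (commutator S) inferInstance with h | h
  · exact absurd (IsSimpleGroup.comm_iff_isSolvable.1 (fun a b => by
      have h1 : ⁅a, b⁆ ∈ commutator S := commutator_mem_commutator (mem_top a) (mem_top b)
      rw [h, mem_bot] at h1
      exact commutatorElement_eq_one_iff_mul_comm.1 h1)) hS.not_solvable
  · exact h

theorem not_isNilpotent (hS : IsSmallSimple S) : ¬ Group.IsNilpotent S :=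
  fun _ => hS.not_solvable inferInstance

theorem ne_top_of_isPGroup [Finite S] (hS : IsSmallSimple S) {p : ℕ} [Fact p.Prime]
    {X : Subgroup S} (hX : IsPGroup p X) : X ≠ ⊤ := by
  rintro rfl
  have h1 := hX.isNilpotent
  exact hS.not_isNilpotent (Group.isNilpotent_top.1 h1)

theorem normalizer_ne_top (hS : IsSmallSimple S) {H : Subgroup S} (h1 : H ≠ ⊥) (h2 : H ≠ ⊤) :
    normalizer (H : Set S) ≠ ⊤ := by
  have := hS.simple
  intro h
  rw [normalizer_eq_top_iff] at h
  exact (IsSimpleGroup.eq_bot_or_eq_top_of_normal H h).elim h1 h2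

theorem eq_of_le_of_not_isNilpotent (hS : IsSmallSimple S) {M K : Subgroup S} (hMK : M ≤ K)
    (hK : K ≠ ⊤) (hM : ¬ Group.IsNilpotent M) : K = M := by
  by_contra hne
  rcases hS.nilpotent_or K hK with h | h
  · exact hM (isNilpotent_of_le hMK h)
  · have h1 := h.2 (M.subgroupOf K) (fun h2 => hne (le_antisymm (subgroupOf_eq_top.1 h2) hMK))
    exact hM (Group.nilpotent_of_mulEquiv (subgroupOfEquivOfLe hMK))

variable [Finite S]

theorem exists_schmidtPair (hS : IsSmallSimple S) {H : Subgroup S} (h1 : H ≠ ⊤)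
    (h2 : ¬ Group.IsNilpotent H) : ∃ (p q : ℕ) (P Q : Subgroup S), SchmidtPair p q H P Q :=
  ((hS.nilpotent_or H h1).resolve_left h2).exists_schmidtPair (hS.solvable H h1)

theorem disjoint_sylow (hS : IsSmallSimple S) {p : ℕ} [Fact p.Prime] (P₁ P₂ : Sylow p S)
    (hne : P₁ ≠ P₂) : (P₁ : Subgroup S) ⊓ P₂ = ⊥ := by
  by_contra hbot
  obtain ⟨⟨R₁, R₂⟩, ⟨hRne, hRbot⟩, hmax⟩ := Set.exists_max_image
    {x : Sylow p S × Sylow p S | x.1 ≠ x.2 ∧ (x.1 : Subgroup S) ⊓ x.2 ≠ ⊥}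
    (fun x => Nat.card ((x.1 : Subgroup S) ⊓ x.2 : Subgroup S)) (Set.toFinite _)
    ⟨(P₁, P₂), hne, hbot⟩
  clear hbot hne P₁ P₂
  simp only at hRne hRbot hmax
  set D : Subgroup S := (R₁ : Subgroup S) ⊓ R₂ with hD
  have hDp : IsPGroup p D := R₁.2.to_le inf_le_left
  have hNtop : normalizer (D : Set S) ≠ ⊤ :=
    hS.normalizer_ne_top hRbot (hS.ne_top_of_isPGroup hDp)
  have heq : ∀ P Q : Sylow p S, (P : Subgroup S) ≤ Q → P = Q := fun P Q h =>
    Sylow.ext (P.3 Q.2 h).symm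
  -- a Sylow subgroup containing `D` meets its normalizer in something larger
  have hgrow : ∀ P : Sylow p S, D ≤ P → D ≠ P → ¬ (P : Subgroup S) ⊓ normalizer (D : Set S) ≤ D :=
    fun P hDP hne h => hne (eq_of_inf_normalizer_le P.2 hDP h)
  have hD1 : D ≠ R₁ := fun h => hRne (heq _ _ (h ▸ inf_le_right))
  have hD2 : D ≠ R₂ := fun h => hRne (heq R₂ R₁ (h ▸ inf_le_left)).symm
  have hbig : ∀ (P Q : Sylow p S), D ≤ (P : Subgroup S) ⊓ Q →
      ¬ (P : Subgroup S) ⊓ Q ≤ D → P = Q := by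
    intro P Q h1 h2
    by_contra hPQ
    have h3 : (P : Subgroup S) ⊓ Q ≠ ⊥ := fun h => hRbot (le_bot_iff.1 (h ▸ h1))
    have h4 := hmax (P, Q) ⟨hPQ, h3⟩
    exact h2 (Subgroup.eq_of_le_of_card_ge h1 h4).ge
  have hnosyl : ∀ X : Subgroup S, IsPGroup p X →
      (R₁ : Subgroup S) ⊓ normalizer (D : Set S) ≤ X →
      ¬ (R₂ : Subgroup S) ⊓ normalizer (D : Set S) ≤ X := by
    intro X hX h1 h2
    obtain ⟨T, hT⟩ := hX.exists_le_sylow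
    have hDX : D ≤ T := (le_inf inf_le_left le_normalizer).trans (h1.trans hT)
    have e1 : R₁ = T := hbig R₁ T (le_inf inf_le_left hDX) fun h =>
      hgrow R₁ inf_le_left hD1 ((le_inf inf_le_left (h1.trans hT)).trans h)
    have e2 : R₂ = T := hbig R₂ T (le_inf inf_le_right hDX) fun h =>
      hgrow R₂ inf_le_right hD2 ((le_inf inf_le_left (h2.trans hT)).trans h)
    exact hRne (e1.trans e2.symm)
  have hpair : ∃ (r : ℕ) (A B : Subgroup S), SchmidtPair r p (normalizer (D : Set S)) A B := by
    have hnn : ¬ Group.IsNilpotent (normalizer (D : Set S)) := by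
      intro hn
      let T : Sylow p (normalizer (D : Set S)) := default
      have hTle : ∀ Y : Subgroup S, IsPGroup p Y → Y ≤ normalizer (D : Set S) →
          Y ≤ (T : Subgroup (normalizer (D : Set S))).map (Subgroup.subtype _) := by
        intro Y hY hYN y hy
        have h1 : IsPGroup p (Y.subgroupOf (normalizer (D : Set S))) :=
          hY.of_equiv (subgroupOfEquivOfLe hYN).symm
        obtain ⟨T', hT'⟩ := h1.exists_le_sylow
        have h2 : T' = T := by
          have := T.unique_of_normal inferInstance
          exact Subsingleton.elim _ _
        exact ⟨⟨y, hYN hy⟩, h2 ▸ hT' hy, rfl⟩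
      exact hnosyl _ (T.2.map _) (hTle _ (R₁.2.to_le inf_le_left) inf_le_right)
        (hTle _ (R₂.2.to_le inf_le_left) inf_le_right)
    obtain ⟨r, q, A, B, h⟩ := hS.exists_schmidtPair hNtop hnn
    rcases h.eq_or_eq_of_isPGroup (Fact.out : p.Prime) le_normalizer hDp hRbot with e | e
    · subst e
      exact absurd (h.le_left inf_le_right (R₂.2.to_le inf_le_left))
        (hnosyl A h.isPGroup_left (h.le_left inf_le_right (R₁.2.to_le inf_le_left)))
    · subst e
      exact ⟨r, A, B, h⟩
  obtain ⟨r, A, B, h⟩ := hpair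
  set W : Subgroup S := (R₁ : Subgroup S) ⊓ normalizer (D : Set S) with hW
  have hDW : D ≤ W := le_inf inf_le_left le_normalizer
  have hWc : IsCyclic W := h.isCyclic_of_isPGroup inf_le_right (R₁.2.to_le inf_le_left)
  have hWR : W = R₁ := eq_of_inf_normalizer_le R₁.2 inf_le_left
    (inf_le_inf_left _ (normalizer_le_normalizer_of_isCyclic hDW hWc))
  rw [hWR] at hDW hWc
  have hcomm : IsMulCommutative (R₁ : Subgroup S) := IsCyclic.isMulCommutative
  have hRne' : (R₁ : Subgroup S) ≠ ⊥ := fun h => hRbot (le_bot_iff.1 (h ▸ hDW))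
  have hnn := not_isNilpotent_normalizer_of_fusion hS.commutator_eq_top R₁ hRne' (by
    intro x hx g hg
    obtain ⟨n, hn, hn'⟩ := Sylow.conj_eq_normalizer_conj_of_mem R₁ x g⁻¹ hx (by
      rw [inv_inv]
      exact hg)
    exact ⟨n⁻¹, inv_mem hn, by simpa using hn'.symm⟩)
  have hNN := hS.eq_of_le_of_not_isNilpotent
    (normalizer_le_normalizer_of_isCyclic hDW hWc) hNtop hnn
  refine hnosyl R₁ R₁.2 inf_le_left (Sylow.le_of_le_normalizer (R₂.2.to_le inf_le_left) R₁ ?_)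
  rw [← hNN]
  exact inf_le_right

theorem mem_normalizer_of_conj_mem (hS : IsSmallSimple S) {p : ℕ} [Fact p.Prime] (P : Sylow p S)
    {x g : S} (hx : x ∈ (P : Subgroup S)) (hx1 : x ≠ 1) (hg : g * x * g⁻¹ ∈ (P : Subgroup S)) :
    g ∈ normalizer ((P : Subgroup S) : Set S) := by
  by_contra hc
  have h1 : g • P ≠ P := fun h => hc (Sylow.smul_eq_iff_mem_normalizer.1 h)
  have h2 := hS.disjoint_sylow _ _ h1
  have h3 : g * x * g⁻¹ ∈ ((g • P : Sylow p S) : Subgroup S) ⊓ P := by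
    refine ⟨?_, hg⟩
    exact Subgroup.smul_mem_pointwise_smul x (MulAut.conj g) (P : Subgroup S) hx
  rw [h2, mem_bot, mul_inv_eq_one] at h3
  exact hx1 (by simpa using h3)

theorem centralizer_le_normalizer_sylow (hS : IsSmallSimple S) {p : ℕ} [Fact p.Prime]
    (P : Sylow p S) {x : S} (hx : x ∈ (P : Subgroup S)) (hx1 : x ≠ 1) :
    centralizer {x} ≤ normalizer ((P : Subgroup S) : Set S) := by
  intro g hg
  refine hS.mem_normalizer_of_conj_mem P hx hx1 ?_
  have h1 : g * x * g⁻¹ = x := by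
    rw [mem_centralizer_singleton_iff.1 hg, mul_inv_cancel_right]
  rwa [h1]

theorem exists_schmidtPair_normalizer (hS : IsSmallSimple S) {p : ℕ} [Fact p.Prime]
    (P : Sylow p S) (hP : (P : Subgroup S) ≠ ⊥) : ∃ (q : ℕ) (Q : Subgroup S),
      SchmidtPair p q (normalizer ((P : Subgroup S) : Set S)) P Q := by
  have hnn := not_isNilpotent_normalizer_of_fusion hS.commutator_eq_top P hP (by
    intro x hx g hg
    by_cases hx1 : x = 1
    · exact ⟨1, one_mem _, by simp [hx1]⟩
    · exact ⟨g, hS.mem_normalizer_of_conj_mem P hx hx1 hg, rfl⟩)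
  have hNtop := hS.normalizer_ne_top hP (hS.ne_top_of_isPGroup P.2)
  obtain ⟨r, q, A, B, h⟩ := hS.exists_schmidtPair hNtop hnn
  rcases h.eq_or_eq_of_isPGroup (Fact.out : p.Prime) le_normalizer P.2 hP with e | e
  · subst e
    have h1 : A = P := le_antisymm (Sylow.le_of_le_normalizer h.isPGroup_left P h.left_le)
      (h.le_left le_normalizer P.2)
    exact ⟨q, B, h1 ▸ h⟩
  · subst e
    exfalso
    have h1 : B ≤ P := Sylow.le_of_le_normalizer h.isPGroup_right P h.right_le
    have h2 : B = P := Subgroup.eq_of_le_of_card_ge h1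
      (Nat.le_of_dvd Nat.card_pos (h.card_dvd_right le_normalizer P.2))
    exact h.not_normal_right (h2 ▸ le_rfl)

theorem exists_schmidtPair_normalizer_card (hS : IsSmallSimple S) {p : ℕ} [Fact p.Prime]
    (P : Sylow p S) (hP : (P : Subgroup S) ≠ ⊥) : ∃ (q : ℕ) (Q : Subgroup S),
      SchmidtPair p q (normalizer ((P : Subgroup S) : Set S)) P Q ∧ Nat.card Q = q := by
  obtain ⟨q, Q, h⟩ := hS.exists_schmidtPair_normalizer P hP
  refine ⟨q, Q, h, ?_⟩
  by_contra hcard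
  have := Fact.mk h.q_prime
  have hdvd : q ∣ Nat.card Q := by
    obtain ⟨n, hn⟩ := h.isPGroup_right.exists_card_eq
    rcases n with _ | n
    · rw [pow_zero, Subgroup.card_eq_one] at hn
      exact absurd hn h.right_ne_bot
    · exact hn ▸ dvd_pow_self q n.succ_ne_zero
  obtain ⟨⟨z, hzQ⟩, hz⟩ := exists_prime_orderOf_dvd_card' q hdvd
  rw [Subgroup.orderOf_mk] at hz
  have hzcard : Nat.card (zpowers z) = q := by rw [Nat.card_zpowers, hz]
  have hzlt : zpowers z < Q := by
    refine lt_of_le_of_ne (zpowers_le.2 hzQ) fun he => hcard ?_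
    rw [← he, hzcard]
  have hz1 : z ≠ 1 := by
    rintro rfl
    rw [orderOf_one] at hz
    exact h.q_prime.one_lt.ne hz
  have hcent := h.central_of_lt _ hzlt (mem_zpowers z)
  obtain ⟨R, hR⟩ := h.isPGroup_right.exists_le_sylow
  have hNR : normalizer ((P : Subgroup S) : Set S) ≤ normalizer ((R : Subgroup S) : Set S) := by
    refine le_trans ?_ (hS.centralizer_le_normalizer_sylow R (hR hzQ) hz1)
    intro g hg
    rw [mem_centralizer_singleton_iff]
    exact mem_centralizer_iff.1 hcent g hg
  have hRbot : (R : Subgroup S) ≠ ⊥ := fun he => h.right_ne_bot (le_bot_iff.1 (he ▸ hR))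
  have hnn : ¬ Group.IsNilpotent (normalizer ((P : Subgroup S) : Set S)) := by
    intro hn
    have := Fact.mk h.p_prime
    have h1 := le_centralizer_of_isNilpotent_sup (A := Q) (B := P)
      h.ne.symm h.isPGroup_right h.isPGroup_left
      (by rw [sup_comm, h.sup_eq]; exact hn)
    apply h.not_normal_right
    rw [← h.sup_eq]
    exact sup_le ((le_centralizer_iff.1 h1).trans (centralizer_le_normalizer _)) le_normalizer
  have hNe := hS.eq_of_le_of_not_isNilpotent hNR
    (hS.normalizer_ne_top hRbot (hS.ne_top_of_isPGroup R.2)) hnn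
  have hRN : (R : Subgroup S) ≤ normalizer ((P : Subgroup S) : Set S) := hNe ▸ le_normalizer
  have hQR : Q = R := Subgroup.eq_of_le_of_card_ge hR
    (Nat.le_of_dvd Nat.card_pos (h.card_dvd_right hRN R.2))
  apply h.not_normal_right
  rw [hQR]
  exact hNR

end IsSmallSimple

section ConjClosure

variable {G : Type*} [Group G] [Fintype G]

open scoped Classical in
/-- The finset of all conjugates of elements of `X`. -/
noncomputable def conjClosure (X : Finset G) : Finset G :=
  Finset.univ.filter fun y => ∃ g : G, ∃ x ∈ X, g * x * g⁻¹ = y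

theorem mem_conjClosure {X : Finset G} {y : G} :
    y ∈ conjClosure X ↔ ∃ g : G, ∃ x ∈ X, g * x * g⁻¹ = y := by
  simp [conjClosure]

theorem card_nsmul_sum_conjClosure {A : Type*} [AddCommMonoid A] (X : Finset G) (N : Subgroup G)
    (hN : ∀ g ∈ N, ∀ x ∈ X, g * x * g⁻¹ ∈ X) (hTI : ∀ g : G, ∀ x ∈ X, g * x * g⁻¹ ∈ X → g ∈ N)
    (f : G → A) (hf : ∀ g x : G, f (g * x * g⁻¹) = f x) :
    Nat.card N • ∑ y ∈ conjClosure X, f y = Nat.card G • ∑ x ∈ X, f x := by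
  classical
  have h1 : ∑ z ∈ (Finset.univ : Finset G) ×ˢ X, f (z.1 * z.2 * z.1⁻¹) =
      Nat.card G • ∑ x ∈ X, f x := by
    rw [Finset.sum_product]
    simp_rw [hf]
    rw [Finset.sum_const, Finset.card_univ, Nat.card_eq_fintype_card]
  rw [← h1, ← Finset.sum_fiberwise_of_maps_to (s := (Finset.univ : Finset G) ×ˢ X)
    (t := conjClosure X) (g := fun z => z.1 * z.2 * z.1⁻¹)]
  · rw [Finset.smul_sum]
    refine Finset.sum_congr rfl fun y hy => ?_
    obtain ⟨h, x₀, hx₀, rfl⟩ := mem_conjClosure.1 hy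
    have h2 : ∀ z ∈ ((Finset.univ : Finset G) ×ˢ X).filter
        (fun z => z.1 * z.2 * z.1⁻¹ = h * x₀ * h⁻¹), f (z.1 * z.2 * z.1⁻¹) = f (h * x₀ * h⁻¹) := by
      intro z hz
      rw [(Finset.mem_filter.1 hz).2]
    rw [Finset.sum_congr rfl h2, Finset.sum_const]
    congr 1
    rw [Nat.card_eq_fintype_card, ← Finset.card_univ]
    refine Finset.card_bij (fun n _ => (h * n, (n : G)⁻¹ * x₀ * n)) ?_ ?_ ?_
    · rintro ⟨n, hn⟩ -
      rw [Finset.mem_filter, Finset.mem_product]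
      refine ⟨⟨Finset.mem_univ _, ?_⟩, ?_⟩
      · simpa using hN n⁻¹ (inv_mem hn) x₀ hx₀
      · simp only
        group
    · rintro n - m - hnm
      simpa using congrArg Prod.fst hnm
    · rintro ⟨g, x⟩ hz
      rw [Finset.mem_filter, Finset.mem_product] at hz
      obtain ⟨⟨-, hx⟩, he⟩ := hz
      simp only at hx he
      have h3 : (h⁻¹ * g) * x * (h⁻¹ * g)⁻¹ = x₀ := by
        rw [show (h⁻¹ * g) * x * (h⁻¹ * g)⁻¹ = h⁻¹ * (g * x * g⁻¹) * h by group, he]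
        group
      refine ⟨⟨h⁻¹ * g, hTI _ x hx (by rwa [h3])⟩, Finset.mem_univ _, ?_⟩
      ext
      · simp
      · simp only
        rw [← h3]
        group
  · rintro ⟨g, x⟩ hz
    exact mem_conjClosure.2 ⟨g, x, (Finset.mem_product.1 hz).2, rfl⟩

end ConjClosure

section Sharp

variable {G : Type*} [Group G] [Fintype G]

open scoped Classical in
/-- The finset of nontrivial elements of a subgroup. -/
noncomputable def Subgroup.sharp (P : Subgroup G) : Finset G :=
  Finset.univ.filter fun x => x ∈ P ∧ x ≠ 1

theorem Subgroup.mem_sharp {P : Subgroup G} {x : G} : x ∈ P.sharp ↔ x ∈ P ∧ x ≠ 1 := by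
  simp [sharp]

theorem Subgroup.sum_sharp_add {A : Type*} [AddCommMonoid A] (P : Subgroup G) [Fintype P]
    (f : G → A) : f 1 + ∑ x ∈ P.sharp, f x = ∑ x : P, f x := by
  classical
  rw [← Finset.sum_insert (f := f) (s := P.sharp) (a := 1) (by simp [mem_sharp])]
  symm
  refine Finset.sum_bij (fun x _ => (x : G)) ?_ ?_ ?_ ?_
  · intro x _
    by_cases h : (x : G) = 1
    · simp [h]
    · exact Finset.mem_insert_of_mem (mem_sharp.2 ⟨x.2, h⟩)
  · intro x _ y _ h
    exact Subtype.ext h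
  · intro x hx
    rcases Finset.mem_insert.1 hx with rfl | h
    · exact ⟨1, Finset.mem_univ _, rfl⟩
    · exact ⟨⟨x, (mem_sharp.1 h).1⟩, Finset.mem_univ _, rfl⟩
  · intros
    rfl

theorem Subgroup.card_sharp (P : Subgroup G) : P.sharp.card + 1 = Nat.card P := by
  classical
  have h : 1 + ∑ x ∈ P.sharp, 1 = ∑ x : P, 1 := P.sum_sharp_add (A := ℕ) (fun _ => 1)
  rw [← Finset.card_eq_sum_ones] at h
  rw [add_comm, h]
  simp

end Sharp

namespace IsSmallSimple

variable {S : Type*} [Group S] [Fintype S]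

theorem card_nsmul_sum_conjClosure_sharp (hS : IsSmallSimple S) {p : ℕ} [Fact p.Prime]
    (P : Sylow p S) {A : Type*} [AddCommMonoid A] (f : S → A)
    (hf : ∀ g x : S, f (g * x * g⁻¹) = f x) :
    Nat.card (normalizer ((P : Subgroup S) : Set S)) •
      ∑ y ∈ conjClosure (P : Subgroup S).sharp, f y =
    Nat.card S • ∑ x ∈ (P : Subgroup S).sharp, f x := by
  refine card_nsmul_sum_conjClosure _ _ ?_ ?_ f hf
  · intro g hg x hx
    rw [mem_sharp] at hx ⊢
    exact ⟨(mem_normalizer_iff.1 hg x).1 hx.1, by simpa using hx.2⟩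
  · intro g x hx hgx
    rw [mem_sharp] at hx hgx
    exact hS.mem_normalizer_of_conj_mem P hx.1 hx.2 hgx.1

theorem exists_card_inf_centralizer_eq (hS : IsSmallSimple S) {p q : ℕ} [Fact p.Prime]
    [Fact q.Prime] (P : Sylow p S) (hP : (P : Subgroup S) ≠ ⊥) {Q : Subgroup S}
    (h : SchmidtPair p q (normalizer ((P : Subgroup S) : Set S)) P Q)
    (R : Sylow q S) (hQR : Q ≤ R) {T : Subgroup S} {r : ℕ}
    (hR : SchmidtPair q r (normalizer ((R : Subgroup S) : Set S)) R T) (hT : Nat.card T = r)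
    (hZ : (P : Subgroup S) ⊓ centralizer (normalizer ((P : Subgroup S) : Set S) : Set S) ≠ ⊥) :
    r = p ∧ Nat.card ((P : Subgroup S) ⊓
        centralizer (normalizer ((P : Subgroup S) : Set S) : Set S) : Subgroup S) = p ∧
      Q ≤ (R : Subgroup S) ⊓ centralizer (normalizer ((R : Subgroup S) : Set S) : Set S) ∧
      (P : Subgroup S) ⊓ centralizer (normalizer ((P : Subgroup S) : Set S) : Set S) ≤
        normalizer ((R : Subgroup S) : Set S) := by
  set Z := (P : Subgroup S) ⊓ centralizer (normalizer ((P : Subgroup S) : Set S) : Set S) with hZdef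
  obtain ⟨y, hy, hy1⟩ := Q.bot_or_exists_ne_one.resolve_left h.right_ne_bot
  have hZQ : Z ≤ centralizer (Q : Set S) :=
    inf_le_right.trans (centralizer_le h.right_le)
  have hZN : Z ≤ normalizer ((R : Subgroup S) : Set S) := by
    refine le_trans ?_ (hS.centralizer_le_normalizer_sylow R (hQR hy) hy1)
    intro z hz
    rw [mem_centralizer_singleton_iff]
    exact (mem_centralizer_iff.1 (hZQ hz) y hy).symm
  have hZp : IsPGroup p Z := P.2.to_le inf_le_left
  have hrp : r = p := by
    rcases hR.eq_or_eq_of_isPGroup (Fact.out : p.Prime) hZN hZp hZ with e | e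
    · exact absurd e h.ne
    · exact e.symm
  subst hrp
  have hc : Nat.card Z = r := by
    have h1 := hR.card_dvd_right hZN hZp
    rw [hT] at h1
    refine ((Nat.dvd_prime Fact.out).1 h1).resolve_left fun h2 => hZ (Subgroup.card_eq_one.1 h2)
  refine ⟨rfl, hc, ?_, hZN⟩
  exact (le_inf hQR (le_centralizer_iff.1 hZQ)).trans
    (le_inf inf_le_left (hR.inf_centralizer_le_of_card_eq hZN hZp (hc.trans hT.symm)))

end IsSmallSimple

theorem IsPGroup.card_eq_prime_or_sq_le {G : Type*} [Group G] [Finite G] {p : ℕ} [Fact p.Prime]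
    {P Z : Subgroup G} (hP : IsPGroup p P) (hZP : Z ≤ P) (hne : Z ≠ P) (hZ : Nat.card Z = p) :
    p ^ 2 ≤ Nat.card P := by
  obtain ⟨n, hn⟩ := hP.exists_card_eq
  rw [hn]
  refine Nat.pow_le_pow_right (Fact.out : p.Prime).pos ?_
  by_contra! hlt
  have h1 : Nat.card P ∣ Nat.card Z := by
    rw [hn, hZ]
    calc p ^ n ∣ p ^ 1 := pow_dvd_pow p (by omega)
      _ = p := pow_one p
  exact hne (eq_of_le_of_card_ge hZP (Nat.le_of_dvd Nat.card_pos h1))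

theorem SchmidtPair.left_not_le_centralizer {G : Type*} [Group G] {p q : ℕ} {H P Q : Subgroup G}
    (h : SchmidtPair p q H P Q) : ¬ P ≤ centralizer (H : Set G) := by
  intro hc
  apply h.not_normal_right
  nth_rewrite 1 [← h.sup_eq]
  refine sup_le ?_ le_normalizer
  exact (hc.trans (centralizer_le h.right_le)).trans (centralizer_le_normalizer _)

theorem Nat.dvd_mul_of_dvd_mul_of_coprime {m a b p q : ℕ} (hab : a.Coprime b)
    (h1 : m ∣ a * q) (h2 : m ∣ b * p) : m ∣ p * q := by
  obtain ⟨m₁, m₂, hm₁, hm₂, rfl⟩ := (Nat.dvd_mul).1 h1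
  refine Nat.mul_dvd_mul ?_ hm₂
  exact (hab.coprime_dvd_left hm₁).dvd_of_dvd_mul_left ((Nat.dvd_mul_right m₁ m₂).trans h2)

theorem pow_ne_one_of_coprime {G : Type*} [Group G] {x : G} {m n : ℕ} (hm : x ^ m = 1)
    (hmn : m.Coprime n) (hx : x ≠ 1) : x ^ n ≠ 1 := by
  intro hn
  apply hx
  have := Nat.dvd_gcd (orderOf_dvd_of_pow_eq_one hm) (orderOf_dvd_of_pow_eq_one hn)
  rw [hmn.gcd_eq_one] at this
  exact orderOf_eq_one_iff.1 (Nat.dvd_one.1 this)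

theorem Subgroup.pow_card_eq_one_of_mem {G : Type*} [Group G] {H : Subgroup G} {x : G}
    (hx : x ∈ H) : x ^ Nat.card H = 1 :=
  congrArg Subtype.val (pow_card_eq_one' (x := (⟨x, hx⟩ : H)))

theorem one_le_of_sq_le {p q a b : ℚ} (hp : 2 ≤ p) (hq : 2 ≤ q) (ha : p ^ 2 ≤ a) (hb : q ^ 2 ≤ b) :
    1 ≤ (a - 1) / (a * q) + (b - 1) / (b * p) + (p - 1) * (q - 1) / (p * q) := by
  have ha0 : 0 < a := by nlinarith
  have hb0 : 0 < b := by nlinarith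
  have e1 : (a - 1) / (a * q) = 1 / q - 1 / a * (1 / q) := by field_simp
  have e2 : (b - 1) / (b * p) = 1 / p - 1 / b * (1 / p) := by field_simp
  have e3 : (p - 1) * (q - 1) / (p * q) = 1 - 1 / p - 1 / q + 1 / p * (1 / q) := by
    field_simp
    ring
  have h1 : 1 / a ≤ (1 / p) ^ 2 := by
    rw [div_pow, one_pow]
    exact one_div_le_one_div_of_le (by positivity) ha
  have h2 : 1 / b ≤ (1 / q) ^ 2 := by
    rw [div_pow, one_pow]
    exact one_div_le_one_div_of_le (by positivity) hb
  have h3 : 1 / p ≤ 1 / 2 := one_div_le_one_div_of_le (by norm_num) hp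
  have h4 : 1 / q ≤ 1 / 2 := one_div_le_one_div_of_le (by norm_num) hq
  have h5 : 0 < 1 / p := by positivity
  have h6 : 0 < 1 / q := by positivity
  rw [e1, e2, e3]
  nlinarith [mul_le_mul_of_nonneg_right h1 h6.le, mul_le_mul_of_nonneg_right h2 h5.le,
    mul_pos h5 h6]

theorem not_add_one_le_of_mul_eq {n a b a' b' p q c₁ c₂ c₃ N : ℕ} (hn : 0 < n) (hp : 2 ≤ p)
    (hq : 2 ≤ q) (ha : p ^ 2 ≤ a) (hb : q ^ 2 ≤ b) (ha' : a' + 1 = a) (hb' : b' + 1 = b)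
    (h₁ : a * q * c₁ = n * a') (h₂ : b * p * c₂ = n * b') (h₃ : N * c₃ = n * ((p - 1) * (q - 1)))
    (hN : N ≤ p * q) : ¬ c₁ + c₂ + c₃ + 1 ≤ n := by
  intro h
  have key := one_le_of_sq_le (p := p) (q := q) (a := a) (b := b) (by exact_mod_cast hp)
    (by exact_mod_cast hq) (by exact_mod_cast ha) (by exact_mod_cast hb)
  have hp0 : (0 : ℚ) < p := by exact_mod_cast (by omega : 0 < p)
  have hq0 : (0 : ℚ) < q := by exact_mod_cast (by omega : 0 < q)
  have ha0 : (0 : ℚ) < a := by exact_mod_cast (by omega : 0 < a)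
  have hb0 : (0 : ℚ) < b := by exact_mod_cast (by omega : 0 < b)
  have h₃' : n * ((p - 1) * (q - 1)) ≤ p * q * c₃ := h₃ ▸ Nat.mul_le_mul_right _ hN
  have e₁ : (c₁ : ℚ) = n * ((a - 1) / (a * q)) := by
    have : (a : ℚ) * q * c₁ = n * a' := by exact_mod_cast h₁
    rw [← ha']
    push_cast
    rw [← ha'] at this
    push_cast at this
    field_simp
    linarith
  have e₂ : (c₂ : ℚ) = n * ((b - 1) / (b * p)) := by
    have : (b : ℚ) * p * c₂ = n * b' := by exact_mod_cast h₂
    rw [← hb']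
    push_cast
    rw [← hb'] at this
    push_cast at this
    field_simp
    linarith
  have e₃ : (n : ℚ) * ((p - 1) * (q - 1) / (p * q)) ≤ c₃ := by
    have : (n : ℚ) * (((p - 1 : ℕ) : ℚ) * ((q - 1 : ℕ) : ℚ)) ≤ p * q * c₃ := by exact_mod_cast h₃'
    rw [Nat.cast_sub (by omega), Nat.cast_sub (by omega), Nat.cast_one] at this
    rw [← mul_div_assoc, div_le_iff₀ (by positivity)]
    linarith
  have hn0 : (0 : ℚ) < n := by exact_mod_cast hn
  have h' : (c₁ : ℚ) + c₂ + c₃ + 1 ≤ n := by exact_mod_cast h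
  have := mul_le_mul_of_nonneg_left key hn0.le
  rw [mul_add, mul_add, ← e₁, ← e₂] at this
  linarith

namespace IsSmallSimple

variable {S : Type*} [Group S]

theorem inf_centralizer_normalizer_eq_bot [Finite S] (hS : IsSmallSimple S) {p : ℕ} [Fact p.Prime]
    (P : Sylow p S) :
    (P : Subgroup S) ⊓ centralizer (normalizer ((P : Subgroup S) : Set S) : Set S) = ⊥ := by
  classical
  by_contra hZ
  have hP : (P : Subgroup S) ≠ ⊥ := fun h => hZ (by rw [h, bot_inf_eq])
  have := Fintype.ofFinite S
  obtain ⟨q, Q, h, hQ⟩ := hS.exists_schmidtPair_normalizer_card P hP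
  have := Fact.mk h.q_prime
  obtain ⟨R, hQR⟩ := h.isPGroup_right.exists_le_sylow
  have hR : (R : Subgroup S) ≠ ⊥ := fun hb => h.right_ne_bot (le_bot_iff.1 (hb ▸ hQR))
  obtain ⟨r, T, h', hT⟩ := hS.exists_schmidtPair_normalizer_card R hR
  have := Fact.mk h'.q_prime
  obtain ⟨rfl, hZc, hQZ, hZN⟩ := hS.exists_card_inf_centralizer_eq P hP h R hQR h' hT hZ
  set Z := (P : Subgroup S) ⊓ centralizer (normalizer ((P : Subgroup S) : Set S) : Set S) with hZdef
  have hZR : (R : Subgroup S) ⊓ centralizer (normalizer ((R : Subgroup S) : Set S) : Set S) ≠ ⊥ :=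
    fun hb => h.right_ne_bot (le_bot_iff.1 (hb ▸ hQZ))
  obtain ⟨P', hTP'⟩ := h'.isPGroup_right.exists_le_sylow
  have hP' : (P' : Subgroup S) ≠ ⊥ := fun hb => h'.right_ne_bot (le_bot_iff.1 (hb ▸ hTP'))
  obtain ⟨r', T', h'', hT'⟩ := hS.exists_schmidtPair_normalizer_card P' hP'
  have := Fact.mk h''.q_prime
  obtain ⟨-, hYc, -, -⟩ := hS.exists_card_inf_centralizer_eq R hR h' P' hTP' h'' hT' hZR
  set Y := (R : Subgroup S) ⊓ centralizer (normalizer ((R : Subgroup S) : Set S) : Set S) with hYdef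
  have hQY : Q = Y := eq_of_le_of_card_ge hQZ (by rw [hYc, hQ])
  have hcop : (Nat.card P).Coprime (Nat.card R) :=
    IsPGroup.coprime_card_of_ne r q h.ne _ _ P.2 R.2
  have hsqP : r ^ 2 ≤ Nat.card P := P.2.card_eq_prime_or_sq_le inf_le_left
    (fun he => h.left_not_le_centralizer (inf_eq_left.1 he)) hZc
  have hsqR : q ^ 2 ≤ Nat.card R := R.2.card_eq_prime_or_sq_le inf_le_left
    (fun he => h'.left_not_le_centralizer (inf_eq_left.1 he)) hYc
  have hcomm : ∀ z ∈ Z, ∀ y ∈ Y, Commute z y := fun z hz y hy =>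
    (mem_centralizer_iff.1 hz.2 y (h.right_le (hQY ▸ hy))).symm
  have hpowZ : ∀ z ∈ Z, z ^ Nat.card P = 1 := fun z hz => pow_card_eq_one_of_mem hz.1
  have hpowY : ∀ y ∈ Y, y ^ Nat.card R = 1 := fun y hy => pow_card_eq_one_of_mem hy.1
  let X : Finset S := (Z.sharp ×ˢ Y.sharp).image fun t => t.1 * t.2
  have hX : ∀ x, x ∈ X ↔ ∃ z ∈ Z, ∃ y ∈ Y, z ≠ 1 ∧ y ≠ 1 ∧ z * y = x := by
    intro x
    simp only [X, Finset.mem_image, Finset.mem_product, mem_sharp, Prod.exists]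
    constructor
    · rintro ⟨z, y, ⟨⟨h1, h2⟩, h3, h4⟩, h5⟩
      exact ⟨z, h1, y, h3, h2, h4, h5⟩
    · rintro ⟨z, h1, y, h3, h2, h4, h5⟩
      exact ⟨z, y, ⟨⟨h1, h2⟩, h3, h4⟩, h5⟩
  have hXc : X.card = (r - 1) * (q - 1) := by
    rw [Finset.card_image_of_injOn, Finset.card_product]
    · have h1 := Z.card_sharp
      have h2 := Y.card_sharp
      rw [← hZc, ← hYc, ← h1, ← h2]
      simp
    · rintro ⟨z, y⟩ hzy ⟨z', y'⟩ hzy' he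
      simp only [Finset.coe_product, Set.mem_prod, Finset.mem_coe, mem_sharp] at hzy hzy' he
      have h1 : z'⁻¹ * z = y' * y⁻¹ := by
        rw [eq_mul_inv_iff_mul_eq, mul_assoc, he]
        group
      have h2 : z'⁻¹ * z ∈ (P : Subgroup S) ⊓ R :=
        mem_inf.2 ⟨mul_mem (inv_mem (mem_inf.1 hzy'.1.1).1) (mem_inf.1 hzy.1.1).1,
          h1 ▸ mul_mem (mem_inf.1 hzy'.2.1).1 (inv_mem (mem_inf.1 hzy.2.1).1)⟩
      rw [(disjoint_iff.1 (disjoint_of_coprime_natCard hcop)), mem_bot] at h2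
      rw [h2] at h1
      rw [inv_mul_eq_one] at h2
      rw [eq_comm, mul_inv_eq_one] at h1
      rw [h1, h2]
  have hpow1 : ∀ z ∈ Z, ∀ y ∈ Y, (z * y) ^ Nat.card P = y ^ Nat.card P := fun z hz y hy => by
    rw [(hcomm z hz y hy).mul_pow, hpowZ z hz, one_mul]
  have hpow2 : ∀ z ∈ Z, ∀ y ∈ Y, (z * y) ^ Nat.card R = z ^ Nat.card R := fun z hz y hy => by
    rw [(hcomm z hz y hy).mul_pow, hpowY y hy, mul_one]
  have hne1 : ∀ y ∈ Y, y ≠ 1 → y ^ Nat.card P ≠ 1 := fun y hy hy1 =>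
    pow_ne_one_of_coprime (hpowY y hy) hcop.symm hy1
  have hne2 : ∀ z ∈ Z, z ≠ 1 → z ^ Nat.card R ≠ 1 := fun z hz hz1 =>
    pow_ne_one_of_coprime (hpowZ z hz) hcop hz1
  have hc1 := hS.card_nsmul_sum_conjClosure_sharp P (fun _ => (1 : ℕ)) (fun _ _ => rfl)
  have hc2 := hS.card_nsmul_sum_conjClosure_sharp R (fun _ => (1 : ℕ)) (fun _ _ => rfl)
  have hc3 := card_nsmul_sum_conjClosure X
    (normalizer ((P : Subgroup S) : Set S) ⊓ normalizer ((R : Subgroup S) : Set S)) (by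
      rintro g ⟨hg1, hg2⟩ x hx
      obtain ⟨z, hz, y, hy, -, -, rfl⟩ := (hX x).1 hx
      have e1 : g * z = z * g := mem_centralizer_iff.1 hz.2 g hg1
      have e2 : g * y = y * g := mem_centralizer_iff.1 hy.2 g hg2
      have e3 : g * (z * y) * g⁻¹ = z * y := by
        rw [← mul_assoc, e1, mul_assoc z, e2, ← mul_assoc, mul_inv_cancel_right]
      rwa [e3]) (by
      intro g x hx hgx
      obtain ⟨z, hz, y, hy, hz1, hy1, rfl⟩ := (hX x).1 hx
      obtain ⟨z', hz', y', hy', -, -, he⟩ := (hX _).1 hgx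
      have e1 : g * y ^ Nat.card P * g⁻¹ = y' ^ Nat.card P := by
        rw [← hpow1 z hz y hy, ← hpow1 z' hz' y' hy', he, conj_pow]
      have e2 : g * z ^ Nat.card R * g⁻¹ = z' ^ Nat.card R := by
        rw [← hpow2 z hz y hy, ← hpow2 z' hz' y' hy', he, conj_pow]
      exact ⟨hS.mem_normalizer_of_conj_mem P (pow_mem hz.1 _) (hne2 z hz hz1)
          (e2 ▸ pow_mem hz'.1 _),
        hS.mem_normalizer_of_conj_mem R (pow_mem hy.1 _) (hne1 y hy hy1)
          (e1 ▸ pow_mem hy'.1 _)⟩) (fun _ => (1 : ℕ)) (fun _ _ => rfl)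
  have hN : Nat.card (normalizer ((P : Subgroup S) : Set S) ⊓
      normalizer ((R : Subgroup S) : Set S) : Subgroup S) ≤ r * q := by
    refine Nat.le_of_dvd (Nat.mul_pos h.p_prime.pos h.q_prime.pos)
      (Nat.dvd_mul_of_dvd_mul_of_coprime hcop ?_ ?_)
    · refine Dvd.dvd.trans ?_ (h.card_eq.trans (congrArg _ hQ)).dvd
      exact card_dvd_of_le inf_le_left
    · refine Dvd.dvd.trans ?_ (h'.card_eq.trans (congrArg _ hT)).dvd
      exact card_dvd_of_le inf_le_right
  have hmem : ∀ {H : Subgroup S} {x : S}, x ∈ conjClosure H.sharp → x ≠ 1 ∧ x ^ Nat.card H = 1 := by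
    intro H x hx
    obtain ⟨g, y, hy, rfl⟩ := mem_conjClosure.1 hx
    rw [mem_sharp] at hy
    exact ⟨by simpa using hy.2, by rw [conj_pow, pow_card_eq_one_of_mem hy.1]; simp⟩
  have hmemX : ∀ {x : S}, x ∈ conjClosure X → x ^ Nat.card P ≠ 1 ∧ x ^ Nat.card R ≠ 1 := by
    intro x hx
    obtain ⟨g, y, hy, rfl⟩ := mem_conjClosure.1 hx
    obtain ⟨z, hz, w, hw, hz1, hw1, rfl⟩ := (hX _).1 hy
    rw [conj_pow, conj_pow, hpow1 z hz w hw, hpow2 z hz w hw, Ne, conj_eq_one_iff, Ne,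
      conj_eq_one_iff]
    exact ⟨hne1 w hw hw1, hne2 z hz hz1⟩
  have hd1 : Disjoint (conjClosure (P : Subgroup S).sharp) (conjClosure (R : Subgroup S).sharp) := by
    rw [Finset.disjoint_left]
    exact fun x hx hx' => pow_ne_one_of_coprime (hmem hx).2 hcop (hmem hx).1 (hmem hx').2
  have hd2 : Disjoint (conjClosure (P : Subgroup S).sharp ∪ conjClosure (R : Subgroup S).sharp)
      (conjClosure X) := by
    rw [Finset.disjoint_left]
    intro x hx hx'
    rcases Finset.mem_union.1 hx with hx | hx
    · exact (hmemX hx').1 (hmem hx).2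
    · exact (hmemX hx').2 (hmem hx).2
  have hd3 : (1 : S) ∉ conjClosure (P : Subgroup S).sharp ∪ conjClosure (R : Subgroup S).sharp ∪
      conjClosure X := by
    intro hx
    rcases Finset.mem_union.1 hx with hx | hx
    · rcases Finset.mem_union.1 hx with hx | hx
      · exact (hmem hx).1 rfl
      · exact (hmem hx).1 rfl
    · exact (hmemX hx).1 (one_pow _)
  have htot := Finset.card_le_univ (insert 1 (conjClosure (P : Subgroup S).sharp ∪
    conjClosure (R : Subgroup S).sharp ∪ conjClosure X))
  rw [Finset.card_insert_of_notMem hd3, Finset.card_union_of_disjoint hd2,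
    Finset.card_union_of_disjoint hd1, ← Nat.card_eq_fintype_card] at htot
  simp only [← Finset.card_eq_sum_ones, smul_eq_mul] at hc1 hc2 hc3
  rw [h.card_eq, hQ] at hc1
  rw [h'.card_eq, hT] at hc2
  rw [hXc] at hc3
  have hs1 := (P : Subgroup S).card_sharp
  have hs2 := (R : Subgroup S).card_sharp
  exact not_add_one_le_of_mul_eq Nat.card_pos h.p_prime.two_le h.q_prime.two_le hsqP hsqR hs1 hs2
    hc1 hc2 hc3 hN (by omega)

end IsSmallSimple

namespace IsSmallSimple

variable {S : Type*} [Group S] [Finite S]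

theorem eq_bot_of_normal (hS : IsSmallSimple S) {p : ℕ} [Fact p.Prime] (P : Sylow p S)
    {N : Subgroup S} (hN : N ≤ P) (hne : N ≠ P)
    (h : normalizer ((P : Subgroup S) : Set S) ≤ normalizer (N : Set S)) : N = ⊥ := by
  by_cases hP : (P : Subgroup S) = ⊥
  · exact le_bot_iff.1 (hP ▸ hN)
  obtain ⟨q, Q, hs⟩ := hS.exists_schmidtPair_normalizer P hP
  rw [← le_bot_iff, ← hS.inf_centralizer_normalizer_eq_bot P]
  exact le_inf hN (hs.central_of_normal N hN hne h)

theorem le_centralizer_sylow (hS : IsSmallSimple S) {p : ℕ} [hp : Fact p.Prime] (P : Sylow p S) :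
    (P : Subgroup S) ≤ centralizer (P : Subgroup S) := by
  by_cases hP : (P : Subgroup S) = ⊥
  · rw [hP]
    exact bot_le
  rw [← commutator_eq_bot_iff_le_centralizer]
  refine hS.eq_bot_of_normal P (commutator_le_self _)
    (commutator_self_ne_of_isPGroup hp.out P.2 hP) ?_
  refine le_normalizer_of_forall_conj_mem fun g hg x hx => ?_
  have h1 : MulAut.conj g • (⁅(P : Subgroup S), (P : Subgroup S)⁆ : Subgroup S) =
      ⁅(P : Subgroup S), (P : Subgroup S)⁆ := by
    have h2 : (P : Subgroup S).map (MulAut.conj g).toMonoidHom = P :=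
      Subgroup.mem_normalizer_iff_map_conj_eq.1 hg
    change map (MulAut.conj g).toMonoidHom _ = _
    rw [map_commutator, h2]
  rw [← h1]
  exact smul_mem_pointwise_smul x (MulAut.conj g) _ hx

theorem exists_card_normalizer_eq (hS : IsSmallSimple S) {p : ℕ} [Fact p.Prime]
    (P : Sylow p S) (hP : (P : Subgroup S) ≠ ⊥) : ∃ q : ℕ, q.Prime ∧
      Nat.card (normalizer ((P : Subgroup S) : Set S)) = Nat.card P * q := by
  obtain ⟨q, Q, hs, hQ⟩ := hS.exists_schmidtPair_normalizer_card P hP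
  exact ⟨q, hs.q_prime, hQ ▸ hs.card_eq⟩

theorem centralizer_singleton_eq (hS : IsSmallSimple S) {p : ℕ} [Fact p.Prime] (P : Sylow p S)
    {x : S} (hx : x ∈ (P : Subgroup S)) (hx1 : x ≠ 1) : centralizer {x} = (P : Subgroup S) := by
  have hP : (P : Subgroup S) ≠ ⊥ := fun h => hx1 (mem_bot.1 (h ▸ hx))
  obtain ⟨q, hq, hc⟩ := hS.exists_card_normalizer_eq P hP
  have hle := hS.centralizer_le_normalizer_sylow P hx hx1
  have hPle : (P : Subgroup S) ≤ centralizer {x} := fun y hy =>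
    mem_centralizer_singleton_iff.2 (mem_centralizer_iff.1 (hS.le_centralizer_sylow P hx) y hy)
  obtain ⟨k, hk⟩ := card_dvd_of_le hPle
  have hkq : k ∣ q := by
    have h1 := card_dvd_of_le hle
    rw [hk, hc] at h1
    exact Nat.dvd_of_mul_dvd_mul_left Nat.card_pos h1
  rcases (Nat.dvd_prime hq).1 hkq with rfl | rfl
  · exact (eq_of_le_of_card_ge hPle (by rw [hk, mul_one])).symm
  · exfalso
    have h1 : centralizer {x} = normalizer ((P : Subgroup S) : Set S) :=
      eq_of_le_of_card_ge hle (by rw [hk, hc])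
    apply hx1
    rw [← mem_bot, ← hS.inf_centralizer_normalizer_eq_bot P]
    refine ⟨hx, mem_centralizer_iff.2 fun g hg => ?_⟩
    rw [SetLike.mem_coe, ← h1] at hg
    exact mem_centralizer_singleton_iff.1 hg

theorem exists_mem_sylow (hS : IsSmallSimple S) {g : S} (hg : g ≠ 1) :
    ∃ p : ℕ, ∃ _ : Fact p.Prime, ∃ P : Sylow p S, g ∈ (P : Subgroup S) := by
  have h1 : orderOf g ≠ 1 := fun h => hg (orderOf_eq_one_iff.1 h)
  obtain ⟨p, hp, m, hm⟩ := Nat.exists_prime_and_dvd h1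
  have := Fact.mk hp
  have hm0 : m ≠ 0 := by
    rintro rfl
    exact (orderOf_pos g).ne' (by rw [hm, mul_zero])
  have hx : (g ^ m) ^ p = 1 := by rw [← pow_mul, mul_comm, ← hm, pow_orderOf_eq_one]
  have hx1 : g ^ m ≠ 1 := by
    refine pow_ne_one_of_lt_orderOf hm0 ?_
    rw [hm]
    exact lt_mul_of_one_lt_left (Nat.pos_of_ne_zero hm0) hp.one_lt
  have hpg : IsPGroup p (zpowers (g ^ m)) := by
    refine IsPGroup.of_card (n := 1) ?_
    rw [Nat.card_zpowers, orderOf_eq_prime hx hx1, pow_one]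
  obtain ⟨P, hP⟩ := hpg.exists_le_sylow
  refine ⟨p, this, P, ?_⟩
  rw [← hS.centralizer_singleton_eq P (hP (mem_zpowers _)) hx1, mem_centralizer_singleton_iff]
  exact (Commute.self_pow g m)

end IsSmallSimple

/-- The primes dividing the order of a group. -/
abbrev PrimeIndex (S : Type*) : Type := {p : ℕ // p ∈ (Nat.card S).primeFactors}

namespace PrimeIndex

variable {S : Type*}

instance (k : PrimeIndex S) : Fact (k : ℕ).Prime := ⟨Nat.prime_of_mem_primeFactors k.2⟩

theorem dvd (k : PrimeIndex S) : (k : ℕ) ∣ Nat.card S := Nat.dvd_of_mem_primeFactors k.2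

variable [Group S]

/-- A chosen Sylow subgroup. -/
noncomputable def sylow (k : PrimeIndex S) : Sylow k S := Classical.arbitrary _

/-- The index of a Sylow subgroup in its normalizer. -/
noncomputable def weight (k : PrimeIndex S) : ℕ :=
  (k.sylow : Subgroup S).relIndex (normalizer ((k.sylow : Subgroup S) : Set S))

theorem card_normalizer (k : PrimeIndex S) :
    Nat.card (normalizer ((k.sylow : Subgroup S) : Set S)) = Nat.card k.sylow * k.weight := by
  rw [weight, relIndex, mul_comm, ← Subgroup.index_mul_card (k.sylow.subgroupOf _)]
  congr 1
  exact (Nat.card_congr (subgroupOfEquivOfLe (H := (k.sylow : Subgroup S)) le_normalizer).toEquiv)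

variable [Finite S]

theorem sylow_ne_bot (k : PrimeIndex S) : (k.sylow : Subgroup S) ≠ ⊥ :=
  k.sylow.ne_bot_of_dvd_card k.dvd

theorem exists_card_sylow (k : PrimeIndex S) : ∃ n ≠ 0, Nat.card k.sylow = (k : ℕ) ^ n := by
  obtain ⟨n, hn⟩ := k.sylow.2.exists_card_eq
  refine ⟨n, ?_, hn⟩
  rintro rfl
  rw [pow_zero, Subgroup.card_eq_one] at hn
  exact k.sylow_ne_bot hn

theorem dvd_card_sylow (k : PrimeIndex S) : (k : ℕ) ∣ Nat.card k.sylow := by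
  obtain ⟨n, hn, h⟩ := k.exists_card_sylow
  rw [h]
  exact dvd_pow_self _ hn

theorem one_lt_card_sylow (k : PrimeIndex S) : 1 < Nat.card k.sylow := by
  obtain ⟨n, hn, h⟩ := k.exists_card_sylow
  rw [h]
  exact Nat.one_lt_pow hn (Fact.out : (k : ℕ).Prime).one_lt

theorem coprime_card_sylow {k l : PrimeIndex S} (h : k ≠ l) :
    (Nat.card k.sylow).Coprime (Nat.card l.sylow) :=
  IsPGroup.coprime_card_of_ne (k : ℕ) (l : ℕ) (fun h' => h (Subtype.ext h')) _ _ k.sylow.2 l.sylow.2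

theorem card_sylow_injective : Function.Injective fun k : PrimeIndex S => Nat.card k.sylow := by
  intro k l h
  by_contra hne
  have h1 := coprime_card_sylow hne
  simp only at h
  rw [h, Nat.coprime_self] at h1
  exact l.one_lt_card_sylow.ne' h1

end PrimeIndex

namespace IsSmallSimple

variable {S : Type*} [Group S] [Fintype S]

theorem weight_prime (hS : IsSmallSimple S) (k : PrimeIndex S) : k.weight.Prime := by
  obtain ⟨q, hq, hc⟩ := hS.exists_card_normalizer_eq k.sylow k.sylow_ne_bot
  rw [k.card_normalizer] at hc
  rwa [Nat.eq_of_mul_eq_mul_left Nat.card_pos hc]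

theorem exists_conj_mem_sylow (hS : IsSmallSimple S) {x : S} (hx : x ≠ 1) :
    ∃ k : PrimeIndex S, x ∈ conjClosure (k.sylow : Subgroup S).sharp := by
  obtain ⟨p, hp, P, hP⟩ := hS.exists_mem_sylow hx
  have hdvd : p ∣ Nat.card S := by
    have h1 : (P : Subgroup S) ≠ ⊥ := fun h => hx (mem_bot.1 (h ▸ hP))
    obtain ⟨n, hn⟩ := P.2.exists_card_eq
    rcases n with _ | n
    · rw [pow_zero, Subgroup.card_eq_one] at hn
      exact absurd hn h1
    · exact (dvd_pow_self p n.succ_ne_zero).trans (hn ▸ card_subgroup_dvd_card _)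
  let k : PrimeIndex S := ⟨p, Nat.mem_primeFactors.2 ⟨hp.out, hdvd, Nat.card_pos.ne'⟩⟩
  refine ⟨k, mem_conjClosure.2 ?_⟩
  obtain ⟨g, hg⟩ := MulAction.exists_smul_eq S P (k.sylow)
  refine ⟨g⁻¹, g * x * g⁻¹, mem_sharp.2 ⟨?_, by simpa using hx⟩, by group⟩
  rw [← hg]
  exact smul_mem_pointwise_smul x (MulAut.conj g) _ hP

theorem sum_eq_add_sum_conjClosure (hS : IsSmallSimple S) {A : Type*} [AddCommMonoid A]
    (f : S → A) : ∑ x, f x =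
      f 1 + ∑ k : PrimeIndex S, ∑ x ∈ conjClosure (k.sylow : Subgroup S).sharp, f x := by
  classical
  have hmem : ∀ {k : PrimeIndex S} {x : S}, x ∈ conjClosure (k.sylow : Subgroup S).sharp →
      x ≠ 1 ∧ x ^ Nat.card k.sylow = 1 := by
    intro H x hx
    obtain ⟨g, y, hy, rfl⟩ := mem_conjClosure.1 hx
    rw [mem_sharp] at hy
    exact ⟨by simpa using hy.2, by rw [conj_pow, pow_card_eq_one_of_mem hy.1]; simp⟩
  have hU : (Finset.univ : Finset S) = insert 1
      (Finset.univ.biUnion fun k : PrimeIndex S => conjClosure (k.sylow : Subgroup S).sharp) := by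
    symm
    refine Finset.eq_univ_iff_forall.2 fun x => ?_
    by_cases hx : x = 1
    · exact hx ▸ Finset.mem_insert_self _ _
    · obtain ⟨k, hk⟩ := hS.exists_conj_mem_sylow hx
      exact Finset.mem_insert_of_mem (Finset.mem_biUnion.2 ⟨k, Finset.mem_univ _, hk⟩)
  rw [hU, Finset.sum_insert, Finset.sum_biUnion]
  · intro k _ l _ hkl
    rw [Function.onFun, Finset.disjoint_left]
    intro x hx hx'
    exact pow_ne_one_of_coprime (hmem hx).2 (PrimeIndex.coprime_card_sylow hkl) (hmem hx).1
      (hmem hx').2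
  · rw [Finset.mem_biUnion]
    rintro ⟨k, -, hk⟩
    exact (hmem hk).1 rfl

theorem sum_eq (hS : IsSmallSimple S) {F : Type*} [Field F] [CharZero F]
    (f : S → F) (hf : ∀ g x : S, f (g * x * g⁻¹) = f x) :
    ∑ x, f x = f 1 + ∑ k : PrimeIndex S,
      (Nat.card S / (Nat.card k.sylow * k.weight) : F) *
        ∑ x ∈ (k.sylow : Subgroup S).sharp, f x := by
  rw [hS.sum_eq_add_sum_conjClosure]
  congr 1
  refine Finset.sum_congr rfl fun k _ => ?_
  have h := hS.card_nsmul_sum_conjClosure_sharp k.sylow f hf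
  rw [k.card_normalizer, nsmul_eq_mul, nsmul_eq_mul, Nat.cast_mul] at h
  have h1 : (Nat.card k.sylow : F) ≠ 0 := Nat.cast_ne_zero.2 Nat.card_pos.ne'
  have h2 : (k.weight : F) ≠ 0 := Nat.cast_ne_zero.2 (hS.weight_prime k).ne_zero
  rw [div_mul_eq_mul_div, ← h, mul_div_cancel_left₀ _ (mul_ne_zero h1 h2)]

theorem class_equation (hS : IsSmallSimple S) :
    (1 : ℚ) = 1 / Nat.card S + ∑ k : PrimeIndex S,
      ((Nat.card k.sylow : ℚ) - 1) / (Nat.card k.sylow * k.weight) := by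
  have h := hS.sum_eq (fun _ => (1 : ℚ)) (fun _ _ => rfl)
  have hn : (Nat.card S : ℚ) ≠ 0 := Nat.cast_ne_zero.2 Nat.card_pos.ne'
  rw [Finset.sum_const, Finset.card_univ, ← Nat.card_eq_fintype_card, nsmul_one] at h
  have h' := congrArg (· / (Nat.card S : ℚ)) h
  rw [div_self hn, add_div, Finset.sum_div] at h'
  refine h'.trans ?_
  rw [add_right_inj]
  refine Finset.sum_congr rfl fun k _ => ?_
  have hs : ((k.sylow : Subgroup S).sharp.card : ℚ) = Nat.card k.sylow - 1 := by
    rw [← (k.sylow : Subgroup S).card_sharp]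
    simp
  rw [Finset.sum_const, nsmul_one, hs]
  field_simp

end IsSmallSimple

theorem IsSimpleGroup.nonempty_mulEquiv_alternatingGroup {S : Type*} [Group S] [Finite S]
    [IsSimpleGroup S] (hc : Nat.card S = 60) {H : Subgroup S} (hH : H.index = 5) :
    Nonempty (S ≃* alternatingGroup (Fin 5)) := by
  have hcore : H.normalCore = ⊥ := by
    refine (IsSimpleGroup.eq_bot_or_eq_top_of_normal H.normalCore inferInstance).resolve_right ?_
    intro h
    have h1 := top_le_iff.1 (h ▸ H.normalCore_le)
    rw [h1, index_top] at hH
    omega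
  have hcard : Nat.card (S ⧸ H) = Nat.card (Fin 5) := by rw [Nat.card_fin]; exact hH
  have : Finite (S ⧸ H) := Nat.finite_of_card_ne_zero (by rw [hcard]; simp)
  let e : (S ⧸ H) ≃ Fin 5 := Finite.equivFinOfCardEq (hcard.trans (Nat.card_fin 5))
  let φ : S →* Equiv.Perm (Fin 5) := e.permCongrHom.toMonoidHom.comp (MulAction.toPermHom S (S ⧸ H))
  have hφ : Function.Injective φ := by
    refine e.permCongrHom.injective.comp ?_
    rw [← MonoidHom.ker_eq_bot_iff, ← Subgroup.normalCore_eq_ker, hcore]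
  have hr : Nat.card φ.range = 60 := by
    rw [← hc]
    exact (Nat.card_congr (MonoidHom.ofInjective hφ).toEquiv).symm
  have hi : φ.range.index = 2 := by
    have h1 := φ.range.index_mul_card
    rw [hr, Nat.card_perm, Nat.card_fin] at h1
    have : Nat.factorial 5 = 120 := by decide
    omega
  rw [Equiv.Perm.eq_alternatingGroup_of_index_eq_two hi] at hr
  exact ⟨(MonoidHom.ofInjective hφ).trans
    (MulEquiv.subgroupCongr (Equiv.Perm.eq_alternatingGroup_of_index_eq_two hi))⟩

theorem exists_conj_eq_of_odd_orderOf_mul {G : Type*} [Group G] {s t : G} (hs : s ^ 2 = 1)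
    (ht : t ^ 2 = 1) (h : Odd (orderOf (s * t))) : ∃ g : G, g * s * g⁻¹ = t := by
  obtain ⟨k, hk⟩ := h
  have hs' : s⁻¹ = s := by rw [inv_eq_iff_mul_eq_one, ← sq, hs]
  have ht' : t⁻¹ = t := by rw [inv_eq_iff_mul_eq_one, ← sq, ht]
  refine ⟨(s * t) ^ k, ?_⟩
  have h1 : s * ((s * t) ^ k)⁻¹ * s⁻¹ = (s * t) ^ k := by
    rw [← inv_pow, ← conj_pow, mul_inv_rev, hs', ht']
    congr 1
    rw [mul_assoc, mul_assoc, ← sq, hs, mul_one]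
  have h2 : s * ((s * t) ^ k)⁻¹ = (s * t) ^ k * s := by
    rw [← h1, inv_mul_cancel_right]
    rw [h1]
  rw [mul_assoc, h2, ← mul_assoc, ← pow_add, ← two_mul]
  have h3 : (s * t) ^ (2 * k) * (s * t) = 1 := by rw [← pow_succ, ← hk, pow_orderOf_eq_one]
  rw [← mul_assoc, mul_eq_one_iff_eq_inv, ht'] at h3
  exact h3

namespace IsSmallSimple

variable {S : Type*} [Group S]

theorem exists_mem_sylow_two {s : S} (hs : s ^ 2 = 1) : ∃ P : Sylow 2 S, s ∈ (P : Subgroup S) := by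
  have hp : IsPGroup 2 (zpowers s) := by
    by_cases h1 : s = 1
    · rw [h1, zpowers_one_eq_bot]
      exact IsPGroup.of_bot
    · refine IsPGroup.of_card (n := 1) ?_
      rw [Nat.card_zpowers, orderOf_eq_prime hs h1, pow_one]
  obtain ⟨P, hP⟩ := hp.exists_le_sylow
  exact ⟨P, hP (mem_zpowers s)⟩

variable [Finite S]

theorem sq_eq_one_of_mem_sylow_two (hS : IsSmallSimple S) (P : Sylow 2 S)
    {x : S} (hx : x ∈ (P : Subgroup S)) : x ^ 2 = 1 := by
  have hcomm : ∀ a ∈ (P : Subgroup S), ∀ b ∈ (P : Subgroup S), Commute a b := fun a ha b hb =>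
    (mem_centralizer_iff.1 (hS.le_centralizer_sylow P ha) b hb).symm
  let Ω : Subgroup S :=
    { carrier := {y | y ∈ (P : Subgroup S) ∧ y ^ 2 = 1}
      one_mem' := ⟨one_mem _, one_pow 2⟩
      mul_mem' := fun {a b} ha hb => ⟨mul_mem ha.1 hb.1, by
        rw [(hcomm a ha.1 b hb.1).mul_pow, ha.2, hb.2, one_mul]⟩
      inv_mem' := fun {a} ha => ⟨inv_mem ha.1, by rw [inv_pow, ha.2, inv_one]⟩ }
  by_cases hΩ : Ω = (P : Subgroup S)
  · rw [← hΩ] at hx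
    exact hx.2
  have hbot := hS.eq_bot_of_normal P (N := Ω) (fun y hy => hy.1) hΩ
    (le_normalizer_of_forall_conj_mem fun g hg y hy =>
      ⟨(mem_normalizer_iff.1 hg y).1 hy.1, by rw [conj_pow, hy.2]; simp⟩)
  by_cases hP : (P : Subgroup S) = ⊥
  · rw [hP, mem_bot] at hx
    rw [hx, one_pow]
  exfalso
  obtain ⟨n, hn⟩ := P.2.exists_card_eq
  have h2 : 2 ∣ Nat.card P := by
    rw [hn]
    refine dvd_pow_self 2 ?_
    rintro rfl
    rw [pow_zero, Subgroup.card_eq_one] at hn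
    exact hP hn
  obtain ⟨⟨y, hy⟩, hy2⟩ := exists_prime_orderOf_dvd_card' 2 h2
  rw [Subgroup.orderOf_mk] at hy2
  have : y ∈ Ω := ⟨hy, by rw [← hy2, pow_orderOf_eq_one]⟩
  rw [hbot, mem_bot] at this
  rw [this, orderOf_one] at hy2
  omega

theorem commute_or_isConj (hS : IsSmallSimple S) {s t : S} (hs : s ^ 2 = 1) (ht : t ^ 2 = 1) :
    Commute s t ∨ ∃ g : S, g * s * g⁻¹ = t := by
  rcases Nat.even_or_odd (orderOf (s * t)) with h | h
  · left
    have hs' : s⁻¹ = s := by rw [inv_eq_iff_mul_eq_one, ← sq, hs]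
    have ht' : t⁻¹ = t := by rw [inv_eq_iff_mul_eq_one, ← sq, ht]
    obtain ⟨m, hm⟩ := h
    have hm0 : 0 < m := by
      have := orderOf_pos (s * t)
      omega
    set z := (s * t) ^ m with hz
    have hz1 : z ≠ 1 := pow_ne_one_of_lt_orderOf hm0.ne' (by omega)
    have hz2 : z ^ 2 = 1 := by rw [hz, ← pow_mul, mul_two, ← hm, pow_orderOf_eq_one]
    have hz' : z⁻¹ = z := by rw [inv_eq_iff_mul_eq_one, ← sq, hz2]
    have h1 : s * z * s⁻¹ = z := by
      nth_rewrite 2 [← hz']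
      rw [hz, ← conj_pow, ← inv_pow, mul_inv_rev, hs', ht']
      congr 1
      simp [← sq, ← mul_assoc s s, hs]
    have h2 : t * z * t⁻¹ = z := by
      nth_rewrite 2 [← hz']
      rw [hz, ← conj_pow, ← inv_pow, mul_inv_rev, hs', ht']
      congr 1
      simp [mul_assoc, ← sq, ht]
    obtain ⟨P, hP⟩ := exists_mem_sylow_two hz2
    have hC := hS.centralizer_singleton_eq P hP hz1
    have hsP : s ∈ (P : Subgroup S) := by
      rw [← hC, mem_centralizer_singleton_iff]
      exact mul_inv_eq_iff_eq_mul.1 h1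
    have htP : t ∈ (P : Subgroup S) := by
      rw [← hC, mem_centralizer_singleton_iff]
      exact mul_inv_eq_iff_eq_mul.1 h2
    exact (mem_centralizer_iff.1 (hS.le_centralizer_sylow P hsP) t htP).symm
  · exact Or.inr (exists_conj_eq_of_odd_orderOf_mul hs ht h)

theorem isConj_of_sq_eq_one (hS : IsSmallSimple S) {s t : S} (hs : s ^ 2 = 1) (ht : t ^ 2 = 1)
    (hs1 : s ≠ 1) (ht1 : t ≠ 1) : ∃ g : S, g * s * g⁻¹ = t := by
  by_contra hc
  have hall : ∀ h : S, Commute s (h * t * h⁻¹) := by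
    intro h
    refine (hS.commute_or_isConj hs (by rw [conj_pow, ht]; simp)).resolve_right ?_
    rintro ⟨g, hg⟩
    refine hc ⟨h⁻¹ * g, ?_⟩
    rw [show h⁻¹ * g * s * (h⁻¹ * g)⁻¹ = h⁻¹ * (g * s * g⁻¹) * h by group, hg]
    group
  have := hS.simple
  obtain ⟨P, hP⟩ := exists_mem_sylow_two hs
  have hle : normalClosure {t} ≤ (P : Subgroup S) := by
    rw [normalClosure, closure_le]
    intro y hy
    rw [Group.mem_conjugatesOfSet_iff] at hy
    obtain ⟨_, rfl, hy⟩ := hy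
    obtain ⟨h, rfl⟩ := isConj_iff.1 hy
    rw [SetLike.mem_coe, ← hS.centralizer_singleton_eq P hP hs1, mem_centralizer_singleton_iff]
    exact (hall h).eq.symm
  rcases IsSimpleGroup.eq_bot_or_eq_top_of_normal (normalClosure {t}) inferInstance with h | h
  · exact ht1 (mem_bot.1 (h ▸ subset_normalClosure rfl))
  · exact hS.ne_top_of_isPGroup P.2 (top_le_iff.1 (h ▸ hle))

end IsSmallSimple

open scoped Classical in
/-- The finset of involutions. -/
noncomputable def involutions (G : Type*) [Group G] [Fintype G] : Finset G :=
  Finset.univ.filter fun s => s ^ 2 = 1 ∧ s ≠ 1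

theorem mem_involutions {G : Type*} [Group G] [Fintype G] {s : G} :
    s ∈ involutions G ↔ s ^ 2 = 1 ∧ s ≠ 1 := by
  simp [involutions]

theorem inv_eq_of_mem_involutions {G : Type*} [Group G] [Fintype G] {s : G}
    (hs : s ∈ involutions G) : s⁻¹ = s := by
  rw [inv_eq_iff_mul_eq_one, ← sq, (mem_involutions.1 hs).1]

theorem conj_mem_involutions {G : Type*} [Group G] [Fintype G] {s : G} (g : G)
    (hs : s ∈ involutions G) : g * s * g⁻¹ ∈ involutions G := by
  rw [mem_involutions] at hs ⊢
  exact ⟨by rw [conj_pow, hs.1]; simp, by simpa using hs.2⟩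

open scoped Classical in
/-- The number of involutions `s` such that `s * x` is an involution. -/
noncomputable def involutionPairs {G : Type*} [Group G] [Fintype G] (x : G) : ℕ :=
  ((involutions G).filter fun s => s * x ∈ involutions G).card

theorem involutionPairs_conj {G : Type*} [Group G] [Fintype G] (g x : G) :
    involutionPairs (g * x * g⁻¹) = involutionPairs x := by
  classical
  refine (Finset.card_bij (fun s _ => g * s * g⁻¹) ?_ ?_ ?_).symm
  · intro s hs
    rw [Finset.mem_filter] at hs ⊢
    refine ⟨conj_mem_involutions g hs.1, ?_⟩
    rw [show g * s * g⁻¹ * (g * x * g⁻¹) = g * (s * x) * g⁻¹ by group]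
    exact conj_mem_involutions g hs.2
  · intro a _ b _ h
    simpa using h
  · intro t ht
    rw [Finset.mem_filter] at ht
    have h1 : g⁻¹ * t * g ∈ involutions G := by
      simpa using conj_mem_involutions g⁻¹ ht.1
    refine ⟨g⁻¹ * t * g, Finset.mem_filter.2 ⟨h1, ?_⟩, by group⟩
    have := conj_mem_involutions g⁻¹ ht.2
    rwa [show g⁻¹ * (t * (g * x * g⁻¹)) * g⁻¹⁻¹ = g⁻¹ * t * g * x by group] at this

theorem involutionPairs_one {G : Type*} [Group G] [Fintype G] :
    involutionPairs (1 : G) = (involutions G).card := by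
  classical
  rw [involutionPairs, Finset.filter_true_of_mem]
  intro s hs
  rwa [mul_one]

theorem sum_involutionPairs (G : Type*) [Group G] [Fintype G] :
    ∑ x : G, involutionPairs x = (involutions G).card ^ 2 := by
  classical
  simp_rw [involutionPairs, Finset.card_filter]
  rw [Finset.sum_comm, sq, ← smul_eq_mul, ← Finset.sum_const]
  refine Finset.sum_congr rfl fun s _ => ?_
  rw [← Finset.card_filter]
  refine Finset.card_bij (fun x _ => s * x) ?_ ?_ ?_
  · intro x hx
    exact (Finset.mem_filter.1 hx).2
  · intro a _ b _ h
    exact mul_left_cancel h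
  · intro t ht
    exact ⟨s⁻¹ * t, Finset.mem_filter.2 ⟨Finset.mem_univ _, by simpa using ht⟩, by group⟩

namespace IsSmallSimple

variable {S : Type*} [Group S] [Fintype S]

theorem involutions_eq (hS : IsSmallSimple S) (P : Sylow 2 S) :
    involutions S = conjClosure (P : Subgroup S).sharp := by
  ext x
  rw [mem_involutions, mem_conjClosure]
  constructor
  · rintro ⟨hx, hx1⟩
    obtain ⟨P', hP'⟩ := exists_mem_sylow_two hx
    obtain ⟨g, hg⟩ := MulAction.exists_smul_eq S P' P
    refine ⟨g⁻¹, g * x * g⁻¹, mem_sharp.2 ⟨?_, by simpa using hx1⟩, by group⟩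
    rw [← hg]
    exact smul_mem_pointwise_smul x (MulAut.conj g) _ hP'
  · rintro ⟨g, y, hy, rfl⟩
    rw [mem_sharp] at hy
    exact ⟨by rw [conj_pow, hS.sq_eq_one_of_mem_sylow_two P hy.1]; simp, by simpa using hy.2⟩

theorem card_mul_card_involutions (hS : IsSmallSimple S) (P : Sylow 2 S)
    (hP : (P : Subgroup S) ≠ ⊥) : Nat.card P * (involutions S).card = Nat.card S := by
  obtain ⟨x, hx, hx1⟩ := (P : Subgroup S).bot_or_exists_ne_one.resolve_left hP
  have hxi : x ^ 2 = 1 := hS.sq_eq_one_of_mem_sylow_two P hx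
  have he : involutions S = conjClosure {x} := by
    ext y
    rw [mem_involutions, mem_conjClosure]
    simp only [Finset.mem_singleton, exists_eq_left]
    constructor
    · rintro ⟨hy, hy1⟩
      exact hS.isConj_of_sq_eq_one hxi hy hx1 hy1
    · rintro ⟨g, rfl⟩
      exact ⟨by rw [conj_pow, hxi]; simp, by simpa using hx1⟩
  have h := card_nsmul_sum_conjClosure {x} (centralizer {x}) (by
    intro g hg y hy
    rw [Finset.mem_singleton] at hy ⊢
    rw [hy, mem_centralizer_singleton_iff.1 hg, mul_inv_cancel_right]) (by
    intro g y hy hgy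
    rw [Finset.mem_singleton] at hy hgy
    rw [hy, mul_inv_eq_iff_eq_mul] at hgy
    exact mem_centralizer_singleton_iff.2 hgy) (fun _ => (1 : ℕ)) (fun _ _ => rfl)
  rw [← Finset.card_eq_sum_ones, ← Finset.card_eq_sum_ones, ← he,
    hS.centralizer_singleton_eq P hx hx1] at h
  simpa using h

theorem weight_add_one_of_eq_two (hS : IsSmallSimple S) {k : PrimeIndex S} (hk : (k : ℕ) = 2) :
    k.weight + 1 = Nat.card k.sylow := by
  obtain ⟨_, h2⟩ := k
  subst hk
  set k : PrimeIndex S := ⟨2, h2⟩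
  have h := hS.card_nsmul_sum_conjClosure_sharp k.sylow (fun _ => (1 : ℕ)) (fun _ _ => rfl)
  rw [← hS.involutions_eq, k.card_normalizer, ← Finset.card_eq_sum_ones,
    ← Finset.card_eq_sum_ones, smul_eq_mul, smul_eq_mul, mul_right_comm,
    hS.card_mul_card_involutions k.sylow k.sylow_ne_bot] at h
  rw [Nat.eq_of_mul_eq_mul_left Nat.card_pos h, card_sharp]

theorem involutionPairs_of_mem_sylow_two (hS : IsSmallSimple S) (P : Sylow 2 S) {x : S}
    (hx : x ∈ (P : Subgroup S)) (hx1 : x ≠ 1) : involutionPairs x + 2 = Nat.card P := by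
  classical
  have hx2 : x ^ 2 = 1 := hS.sq_eq_one_of_mem_sylow_two P hx
  have hxi : x⁻¹ = x := by rw [inv_eq_iff_mul_eq_one, ← sq, hx2]
  have he : ((involutions S).filter fun s => s * x ∈ involutions S) =
      (P : Subgroup S).sharp.erase x := by
    ext s
    rw [Finset.mem_filter, Finset.mem_erase, mem_sharp]
    constructor
    · rintro ⟨hs, hsx⟩
      have h1 : s * x = x * s := by
        have := inv_eq_of_mem_involutions hsx
        rw [mul_inv_rev, hxi, inv_eq_of_mem_involutions hs] at this
        exact this.symm
      refine ⟨?_, ?_, (mem_involutions.1 hs).2⟩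
      · rintro rfl
        exact (mem_involutions.1 hsx).2 (by rw [← sq, hx2])
      · rw [← hS.centralizer_singleton_eq P hx hx1, mem_centralizer_singleton_iff]
        exact h1
    · rintro ⟨hsx, hsP, hs1⟩
      refine ⟨mem_involutions.2 ⟨hS.sq_eq_one_of_mem_sylow_two P hsP, hs1⟩,
        mem_involutions.2 ⟨hS.sq_eq_one_of_mem_sylow_two P (mul_mem hsP hx), fun h => hsx ?_⟩⟩
      rw [mul_eq_one_iff_eq_inv, hxi] at h
      exact h
  have hc := (P : Subgroup S).card_sharp
  rw [involutionPairs, he, Finset.card_erase_of_mem (mem_sharp.2 ⟨hx, hx1⟩), ← hc]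
  have : 0 < (P : Subgroup S).sharp.card := Finset.card_pos.2 ⟨x, mem_sharp.2 ⟨hx, hx1⟩⟩
  omega

theorem exists_mem_involutions_normalizer {p : ℕ} (P : Sylow p S)
    (hw : Nat.card (normalizer ((P : Subgroup S) : Set S)) = Nat.card P * 2) :
    ∃ s ∈ involutions S, s ∈ normalizer ((P : Subgroup S) : Set S) := by
  obtain ⟨⟨s, hsN⟩, hs⟩ := exists_prime_orderOf_dvd_card' 2 (hw ▸ dvd_mul_left 2 _)
  rw [Subgroup.orderOf_mk] at hs
  refine ⟨s, mem_involutions.2 ⟨by rw [← hs, pow_orderOf_eq_one], ?_⟩, hsN⟩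
  rintro rfl
  rw [orderOf_one] at hs
  omega

section OddSylow

variable {p : ℕ} [hp : Fact p.Prime]

theorem not_mem_sylow_of_mem_involutions (h2 : p ≠ 2) (P : Sylow p S) {s : S}
    (hs : s ∈ involutions S) : s ∉ (P : Subgroup S) := by
  intro hsP
  have h1 : orderOf s = 2 := orderOf_eq_prime (mem_involutions.1 hs).1 (mem_involutions.1 hs).2
  obtain ⟨n, hn⟩ := P.2.exists_card_eq
  have h3 := (P : Subgroup S).orderOf_dvd_natCard hsP
  rw [h1, hn] at h3
  exact h2 (((Nat.prime_dvd_prime_iff_eq Nat.prime_two hp.out).1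
    (Nat.prime_two.dvd_of_dvd_pow h3)).symm)

theorem conj_eq_inv_of_mem_involutions (hS : IsSmallSimple S) (h2 : p ≠ 2) (P : Sylow p S) {s : S}
    (hs : s ∈ involutions S) (hsN : s ∈ normalizer ((P : Subgroup S) : Set S)) {y : S}
    (hy : y ∈ (P : Subgroup S)) : s * y * s⁻¹ = y⁻¹ := by
  have hsi := inv_eq_of_mem_involutions hs
  have hss : s * s = 1 := by rw [← sq, (mem_involutions.1 hs).1]
  have hy' : s * y * s⁻¹ ∈ (P : Subgroup S) := (mem_normalizer_iff.1 hsN y).1 hy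
  have hcomm : y * (s * y * s⁻¹) = (s * y * s⁻¹) * y :=
    (mem_centralizer_iff.1 (hS.le_centralizer_sylow P hy) _ hy').symm
  by_contra hne
  have hw1 : y * (s * y * s⁻¹) ≠ 1 := fun h => hne (eq_inv_of_mul_eq_one_right h)
  have hw : s * (y * (s * y * s⁻¹)) = y * (s * y * s⁻¹) * s := by
    nth_rewrite 1 [hcomm]
    rw [hsi]
    simp only [mul_assoc, hss, mul_one]
    rw [← mul_assoc s s, hss, one_mul]
  have : s ∈ (P : Subgroup S) := by
    rw [← hS.centralizer_singleton_eq P (mul_mem hy hy') hw1, mem_centralizer_singleton_iff]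
    exact hw
  exact not_mem_sylow_of_mem_involutions h2 P hs this

theorem card_normalizer_eq_two_mul (hS : IsSmallSimple S) (h2 : p ≠ 2) (P : Sylow p S) {s : S}
    (hs : s ∈ involutions S) (hsN : s ∈ normalizer ((P : Subgroup S) : Set S))
    (hP : (P : Subgroup S) ≠ ⊥) :
    Nat.card (normalizer ((P : Subgroup S) : Set S)) = Nat.card P * 2 := by
  obtain ⟨q, hq, hc⟩ := hS.exists_card_normalizer_eq P hP
  have h1 : orderOf s = 2 := orderOf_eq_prime (mem_involutions.1 hs).1 (mem_involutions.1 hs).2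
  have h3 := Subgroup.orderOf_dvd_natCard _ hsN
  rw [h1, hc, Nat.prime_two.dvd_mul] at h3
  rcases h3 with h3 | h3
  · obtain ⟨n, hn⟩ := P.2.exists_card_eq
    rw [hn] at h3
    exact absurd (((Nat.prime_dvd_prime_iff_eq Nat.prime_two hp.out).1
      (Nat.prime_two.dvd_of_dvd_pow h3)).symm) h2
  · rw [hc, (Nat.prime_dvd_prime_iff_eq Nat.prime_two hq).1 h3]

theorem card_sylow_eq_of_mem_involutions (hS : IsSmallSimple S) (h2 : p ≠ 2) (P : Sylow p S) {s : S}
    (hs : s ∈ involutions S) (hsN : s ∈ normalizer ((P : Subgroup S) : Set S))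
    (hP : (P : Subgroup S) ≠ ⊥) : Nat.card P = p := by
  obtain ⟨n, hn⟩ := P.2.exists_card_eq
  have hn0 : n ≠ 0 := by
    rintro rfl
    rw [pow_zero, Subgroup.card_eq_one] at hn
    exact hP hn
  obtain ⟨⟨y, hy⟩, hyo⟩ := exists_prime_orderOf_dvd_card' p (hn ▸ dvd_pow_self p hn0)
  rw [Subgroup.orderOf_mk] at hyo
  have hy1 : y ≠ 1 := by
    rintro rfl
    rw [orderOf_one] at hyo
    exact hp.out.one_lt.ne hyo
  have hle : zpowers y ≤ (P : Subgroup S) := by rwa [zpowers_le]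
  by_contra hne
  have hne' : zpowers y ≠ (P : Subgroup S) := by
    intro h
    apply hne
    rw [← h, Nat.card_zpowers, hyo]
  have hPN : (P : Subgroup S) ≤ normalizer (zpowers y : Set S) :=
    ((hS.le_centralizer_sylow P).trans (centralizer_le hle)).trans (centralizer_le_normalizer _)
  have hsy : s ∈ normalizer (zpowers y : Set S) := by
    have hc : ∀ x ∈ zpowers y, s * x * s⁻¹ ∈ zpowers y := fun x hx => by
      rw [hS.conj_eq_inv_of_mem_involutions h2 P hs hsN (hle hx)]
      exact inv_mem hx
    rw [mem_normalizer_iff]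
    refine fun x => ⟨hc x, fun hx => ?_⟩
    have := hc _ hx
    rwa [inv_eq_of_mem_involutions hs, show s * (s * x * s) * s = s ^ 2 * x * s ^ 2 by
      simp only [sq, mul_assoc], (mem_involutions.1 hs).1, one_mul, mul_one] at this
  have hN : normalizer ((P : Subgroup S) : Set S) ≤ normalizer (zpowers y : Set S) := by
    have h1 : (P : Subgroup S) ≤ normalizer ((P : Subgroup S) : Set S) ⊓
      normalizer (zpowers y : Set S) := le_inf le_normalizer hPN
    obtain ⟨a, ha⟩ := card_dvd_of_le h1
    obtain ⟨b, hb⟩ := card_dvd_of_le (inf_le_left : normalizer ((P : Subgroup S) : Set S) ⊓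
      normalizer (zpowers y : Set S) ≤ _)
    rw [hS.card_normalizer_eq_two_mul h2 P hs hsN hP, ha, mul_assoc] at hb
    have hab : a ∣ 2 := ⟨b, Nat.eq_of_mul_eq_mul_left Nat.card_pos hb⟩
    rcases (Nat.dvd_prime Nat.prime_two).1 hab with rfl | rfl
    · rw [mul_one] at ha
      have h3 := eq_of_le_of_card_ge h1 ha.le
      exact absurd (h3 ▸ mem_inf.2 ⟨hsN, hsy⟩ : s ∈ (P : Subgroup S))
        (not_mem_sylow_of_mem_involutions h2 P hs)
    · refine inf_eq_left.1 (eq_of_le_of_card_ge inf_le_left ?_)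
      rw [ha, hS.card_normalizer_eq_two_mul h2 P hs hsN hP]
  have := hS.eq_bot_of_normal P hle hne' hN
  exact hy1 (zpowers_eq_bot.1 this)

theorem mem_normalizer_of_mul_mem_involutions (hS : IsSmallSimple S) (P : Sylow p S) {s x : S}
    (hs : s ∈ involutions S) (hx : x ∈ (P : Subgroup S)) (hx1 : x ≠ 1)
    (hsx : s * x ∈ involutions S) : s ∈ normalizer ((P : Subgroup S) : Set S) := by
  refine hS.mem_normalizer_of_conj_mem P hx hx1 ?_
  have h1 := inv_eq_of_mem_involutions hsx
  rw [mul_inv_rev, inv_eq_of_mem_involutions hs, inv_mul_eq_iff_eq_mul] at h1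
  have : s * x * s⁻¹ = x⁻¹ := by
    rw [inv_eq_of_mem_involutions hs, eq_inv_iff_mul_eq_one]
    nth_rewrite 1 [h1]
    have := (mem_involutions.1 hsx).1
    rw [sq] at this
    rw [← h1, mul_assoc]
    exact this
  rw [this]
  exact inv_mem hx

theorem involutionPairs_eq_zero (hS : IsSmallSimple S) (h2 : p ≠ 2) (P : Sylow p S)
    (hw : Nat.card (normalizer ((P : Subgroup S) : Set S)) ≠ Nat.card P * 2)
    {x : S} (hx : x ∈ (P : Subgroup S)) (hx1 : x ≠ 1) : involutionPairs x = 0 := by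
  classical
  have hP : (P : Subgroup S) ≠ ⊥ := fun h => hx1 (mem_bot.1 (h ▸ hx))
  rw [involutionPairs, Finset.card_eq_zero, Finset.filter_eq_empty_iff]
  exact fun s hs hsx => hw (hS.card_normalizer_eq_two_mul h2 P hs
    (hS.mem_normalizer_of_mul_mem_involutions P hs hx hx1 hsx) hP)

theorem involutionPairs_eq_card (hS : IsSmallSimple S) (h2 : p ≠ 2) (P : Sylow p S)
    (hw : Nat.card (normalizer ((P : Subgroup S) : Set S)) = Nat.card P * 2)
    {x : S} (hx : x ∈ (P : Subgroup S)) (hx1 : x ≠ 1) : involutionPairs x = Nat.card P := by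
  classical
  obtain ⟨s, hs, hsN⟩ := exists_mem_involutions_normalizer P hw
  have hmul : ∀ y ∈ (P : Subgroup S), s * y ∈ involutions S := by
    intro y hy
    refine mem_involutions.2 ⟨?_, fun h => ?_⟩
    · have h1 := hS.conj_eq_inv_of_mem_involutions h2 P hs hsN hy
      rw [inv_eq_of_mem_involutions hs] at h1
      rw [sq, ← mul_assoc, h1, inv_mul_cancel]
    · rw [mul_eq_one_iff_eq_inv] at h
      exact not_mem_sylow_of_mem_involutions h2 P hs (h ▸ inv_mem hy)
  have := Fintype.ofFinite (P : Subgroup S)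
  rw [involutionPairs, Nat.card_eq_fintype_card, ← Finset.card_univ]
  symm
  refine Finset.card_bij (fun y _ => s * y) ?_ ?_ ?_
  · intro y _
    rw [Finset.mem_filter, mul_assoc]
    exact ⟨hmul y y.2, hmul _ (mul_mem y.2 hx)⟩
  · intro a _ b _ h
    exact Subtype.ext (mul_left_cancel h)
  · intro t ht
    rw [Finset.mem_filter] at ht
    have htN := hS.mem_normalizer_of_mul_mem_involutions P ht.1 hx hx1 ht.2
    have h1 := hS.conj_eq_inv_of_mem_involutions h2 P ht.1 htN hx
    have h3 := hS.conj_eq_inv_of_mem_involutions h2 P hs hsN (inv_mem hx)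
    refine ⟨⟨s⁻¹ * t, ?_⟩, Finset.mem_univ _, by simp⟩
    rw [← hS.centralizer_singleton_eq P hx hx1, mem_centralizer_singleton_iff,
      ← mul_inv_eq_iff_eq_mul, inv_eq_of_mem_involutions hs]
    rw [inv_inv] at h3
    calc s * t * x * (s * t)⁻¹ = s * (t * x * t⁻¹) * s⁻¹ := by group
      _ = x := by rw [h1, h3]

end OddSylow

end IsSmallSimple

theorem Nat.not_one_odd_prime_order {N q m n : ℕ} (hN : 2 ≤ N) (hq : q + 1 = 2 * N)
    (hp : (2 * m + 1).Prime) (hpN : (2 * m + 1).Coprime (2 * N))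
    (hn : n = 2 * N * (q + 2 * N * m)) (hqn : q ∣ n) (hpn : 2 * m + 1 ∣ n) :
    False := by
  obtain ⟨M, rfl⟩ := Nat.exists_eq_add_of_le hN
  have hm : 0 < m := by
    rcases m with _ | m
    · exact absurd hp (by norm_num)
    · omega
  obtain rfl : q = 2 * M + 3 := by omega
  have hc : (2 * M + 3).Coprime (2 * (2 + M)) := by
    rw [show 2 * (2 + M) = (2 * M + 3) + 1 by ring]
    simp
  rw [hn] at hqn hpn
  have h1 := (Nat.dvd_add_right (dvd_refl _)).1 (hc.dvd_of_dvd_mul_left hqn)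
  have h2 := Nat.le_of_dvd hm (hc.dvd_of_dvd_mul_left h1)
  have h3 := hpN.dvd_of_dvd_mul_left hpn
  rw [show 2 * M + 3 + 2 * (2 + M) * m = (2 + M) * (2 * m + 1) + (M + 1) by ring] at h3
  have h4 := Nat.le_of_dvd (by omega) ((Nat.dvd_add_right (dvd_mul_left _ _)).1 h3)
  omega

theorem Nat.eq_sixty_of_eq {N q m₁ m₂ n : ℕ} (hN : 2 ≤ N) (hpow : ∃ a, 2 * N = 2 ^ a)
    (hq : q + 1 = 2 * N) (h₁ : (2 * m₁ + 1).Prime) (h₂ : (2 * m₂ + 1).Prime) (hne : m₁ ≠ m₂)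
    (h₂N : (2 * m₂ + 1).Coprime (2 * N)) (hn : n = 2 * N * (q + 2 * N * (m₁ + m₂)))
    (hqd : q ∣ m₁ + m₂) (h₂n : 2 * m₂ + 1 ∣ n) (hq₁ : q = 2 * m₁ + 1) : N = 2 ∧ n = 60 := by
  have hm₂ : 0 < m₂ := by
    rcases m₂ with _ | m
    · exact absurd h₂ (by norm_num)
    · omega
  obtain ⟨c, hc⟩ := hqd
  subst hq₁
  obtain rfl : N = m₁ + 1 := by omega
  have hc0 : c ≠ 0 := by
    rintro rfl
    omega
  have hm : m₁ + 1 ≤ m₂ := by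
    rcases Nat.lt_or_ge c 2 with h | h
    · obtain rfl : c = 1 := by omega
      omega
    · have : (2 * m₁ + 1) * 2 ≤ (2 * m₁ + 1) * c := Nat.mul_le_mul_left _ h
      omega
  rw [hn] at h₂n
  have h3 := h₂N.dvd_of_dvd_mul_left h₂n
  have h4 : 2 * m₂ + 1 ∣ m₁ * (2 * m₁ + 3) := by
    have h5 : 2 * m₁ + 1 + 2 * (m₁ + 1) * (m₁ + m₂) =
        (m₁ + 1) * (2 * m₂ + 1) + m₁ * (2 * m₁ + 3) := by ring
    rw [h5] at h3
    exact (Nat.dvd_add_right (dvd_mul_left _ _)).1 h3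
  rcases h₂.dvd_mul.1 h4 with h5 | h5
  · have := Nat.le_of_dvd (by omega) h5
    omega
  · have h6 := Nat.le_of_dvd (by omega) h5
    obtain rfl : m₂ = m₁ + 1 := by omega
    obtain ⟨a, ha⟩ := hpow
    have h7 : (2 * (m₁ + 1)) % 3 ≠ 0 := by
      rw [ha]
      intro h8
      have := Nat.prime_three.dvd_of_dvd_pow (Nat.dvd_of_mod_eq_zero h8)
      omega
    have h8 : 3 ∣ 2 * m₁ + 1 ∨ 3 ∣ 2 * (m₁ + 1) + 1 := by
      rcases (by omega : m₁ % 3 = 0 ∨ m₁ % 3 = 1 ∨ m₁ % 3 = 2) with h | h | h <;> omega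
    have h9 : m₁ = 1 := by
      rcases h8 with h8 | h8
      · have := (Nat.prime_dvd_prime_iff_eq Nat.prime_three h₁).1 h8
        omega
      · have := (Nat.prime_dvd_prime_iff_eq Nat.prime_three h₂).1 h8
        omega
    subst h9
    exact ⟨rfl, hn⟩

theorem Nat.eq_sixty_of_two_odd_primes {N q m₁ m₂ n : ℕ} (hN : 2 ≤ N) (hpow : ∃ a, 2 * N = 2 ^ a)
    (hq : q + 1 = 2 * N) (hqp : q.Prime)
    (h₁ : (2 * m₁ + 1).Prime) (h₂ : (2 * m₂ + 1).Prime) (hne : m₁ ≠ m₂)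
    (h₁N : (2 * m₁ + 1).Coprime (2 * N)) (h₂N : (2 * m₂ + 1).Coprime (2 * N))
    (hn : n = 2 * N * (q + 2 * N * (m₁ + m₂)))
    (hqn : q ∣ n) (h₁n : 2 * m₁ + 1 ∣ n) (h₂n : 2 * m₂ + 1 ∣ n) : N = 2 ∧ n = 60 := by
  have hm₁ : 0 < m₁ := by
    rcases m₁ with _ | m
    · exact absurd h₁ (by norm_num)
    · omega
  have hm₂ : 0 < m₂ := by
    rcases m₂ with _ | m
    · exact absurd h₂ (by norm_num)
    · omega
  have hqN : q.Coprime (2 * N) := by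
    rw [← hq]
    simp
  have hqL : q ∣ q + 2 * N * (m₁ + m₂) := hqN.dvd_of_dvd_mul_left (hn ▸ hqn)
  have hqd : q ∣ m₁ + m₂ := hqN.dvd_of_dvd_mul_left ((Nat.dvd_add_right (dvd_refl q)).1 hqL)
  have hcop : (2 * m₁ + 1).Coprime (2 * m₂ + 1) :=
    (Nat.coprime_primes h₁ h₂).2 (by omega)
  obtain ⟨m, hm⟩ := hcop.mul_dvd_of_dvd_of_dvd (h₁N.dvd_of_dvd_mul_left (hn ▸ h₁n))
    (h₂N.dvd_of_dvd_mul_left (hn ▸ h₂n))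
  rw [hm, hqp.dvd_mul, hqp.dvd_mul, Nat.prime_dvd_prime_iff_eq hqp h₁,
    Nat.prime_dvd_prime_iff_eq hqp h₂] at hqL
  rcases hqL with (h | h) | h
  · exact Nat.eq_sixty_of_eq hN hpow hq h₁ h₂ hne h₂N hn hqd h₂n h
  · exact Nat.eq_sixty_of_eq hN hpow hq h₂ h₁ hne.symm h₁N (by rw [hn, add_comm m₁])
      (by rwa [add_comm]) h₁n h
  · exfalso
    have hm0 : 0 < m := by
      rcases m with _ | m
      · have := hqp.pos
        omega
      · omega
    have hqm := Nat.le_of_dvd hm0 h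
    have h1 : (2 * m₁ + 1) * (2 * m₂ + 1) * q ≤ q + 2 * N * (m₁ + m₂) :=
      hm ▸ Nat.mul_le_mul_left _ hqm
    have hq3 : 3 ≤ q := by omega
    obtain ⟨a, rfl⟩ := Nat.exists_eq_add_of_le hm₁
    obtain ⟨b, rfl⟩ := Nat.exists_eq_add_of_le hm₂
    rw [← hq] at h1
    nlinarith [Nat.zero_le (a * b), Nat.zero_le (a * b * q), Nat.zero_le (a * q),
      Nat.zero_le (b * q), Nat.zero_le a, Nat.zero_le b]

namespace IsSmallSimple

variable {S : Type*} [Group S]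

open scoped Classical in
/-- The prime divisors whose Sylow subgroup has index two in its normalizer. -/
noncomputable def _root_.PrimeIndex.inverted (S : Type*) [Group S] : Finset (PrimeIndex S) :=
  Finset.univ.filter fun k => k.weight = 2

theorem _root_.PrimeIndex.mem_inverted {k : PrimeIndex S} :
    k ∈ PrimeIndex.inverted S ↔ k.weight = 2 := by
  simp [PrimeIndex.inverted]

variable [Fintype S]

theorem ne_two_of_mem_inverted (hS : IsSmallSimple S) {k : PrimeIndex S}
    (hk : k ∈ PrimeIndex.inverted S) : (k : ℕ) ≠ 2 := by
  intro h2
  have h := hS.weight_add_one_of_eq_two h2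
  have h3 := k.dvd_card_sylow
  rw [PrimeIndex.mem_inverted] at hk
  rw [← h, hk, h2] at h3
  omega

theorem card_sylow_of_mem_inverted (hS : IsSmallSimple S) {k : PrimeIndex S}
    (hk : k ∈ PrimeIndex.inverted S) : Nat.card k.sylow = k := by
  have hc := k.card_normalizer
  rw [PrimeIndex.mem_inverted.1 hk] at hc
  obtain ⟨s, hs, hsN⟩ := exists_mem_involutions_normalizer k.sylow hc
  exact hS.card_sylow_eq_of_mem_involutions (hS.ne_two_of_mem_inverted hk) k.sylow hs hsN
    k.sylow_ne_bot

theorem cast_card_sharp (P : Subgroup S) : (P.sharp.card : ℚ) = Nat.card P - 1 := by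
  rw [← P.card_sharp]
  simp

theorem card_eq_of_even (hS : IsSmallSimple S) {t : PrimeIndex S} (ht : (t : ℕ) = 2) :
    (Nat.card S : ℚ) = Nat.card t.sylow * (Nat.card t.sylow - 1) +
      (Nat.card t.sylow) ^ 2 * ∑ k ∈ PrimeIndex.inverted S, ((k : ℕ) - 1 : ℚ) / 2 := by
  classical
  have hsum := hS.sum_eq (fun x => (involutionPairs x : ℚ)) (fun g x => by
    rw [involutionPairs_conj])
  rw [← Nat.cast_sum, sum_involutionPairs, involutionPairs_one] at hsum
  have hP0 : (Nat.card t.sylow : ℚ) ≠ 0 := Nat.cast_ne_zero.2 Nat.card_pos.ne'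
  have hn0 : (Nat.card S : ℚ) ≠ 0 := Nat.cast_ne_zero.2 Nat.card_pos.ne'
  have hT : ((involutions S).card : ℚ) = Nat.card S / Nat.card t.sylow := by
    obtain ⟨_, h2⟩ := t
    subst ht
    set t : PrimeIndex S := ⟨2, h2⟩
    rw [eq_div_iff hP0, mul_comm]
    exact_mod_cast hS.card_mul_card_involutions t.sylow t.sylow_ne_bot
  have htK : t ∉ PrimeIndex.inverted S := fun h => hS.ne_two_of_mem_inverted h ht
  have hw : (t.weight : ℚ) = Nat.card t.sylow - 1 := by
    rw [← hS.weight_add_one_of_eq_two ht]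
    simp
  have hw0 : (t.weight : ℚ) ≠ 0 := Nat.cast_ne_zero.2 (hS.weight_prime t).ne_zero
  rw [← Finset.sum_subset (Finset.subset_univ (insert t (PrimeIndex.inverted S))),
    Finset.sum_insert htK] at hsum
  · have e1 : ∑ x ∈ (t.sylow : Subgroup S).sharp, (involutionPairs x : ℚ) =
        (Nat.card t.sylow - 1) * (Nat.card t.sylow - 2) := by
      rw [← cast_card_sharp, ← nsmul_eq_mul, ← Finset.sum_const]
      refine Finset.sum_congr rfl fun x hx => ?_
      rw [mem_sharp] at hx
      have : involutionPairs x + 2 = Nat.card t.sylow := by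
        obtain ⟨_, h2⟩ := t
        subst ht
        exact hS.involutionPairs_of_mem_sylow_two _ hx.1 hx.2
      rw [← this]
      simp
    have e2 : ∑ k ∈ PrimeIndex.inverted S, (Nat.card S / (Nat.card k.sylow * k.weight) : ℚ) *
        ∑ x ∈ (k.sylow : Subgroup S).sharp, (involutionPairs x : ℚ) =
        Nat.card S * ∑ k ∈ PrimeIndex.inverted S, ((k : ℕ) - 1 : ℚ) / 2 := by
      rw [Finset.mul_sum]
      refine Finset.sum_congr rfl fun k hk => ?_
      have hkw := PrimeIndex.mem_inverted.1 hk
      have hkc := hS.card_sylow_of_mem_inverted hk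
      have hk0 : ((k : ℕ) : ℚ) ≠ 0 := Nat.cast_ne_zero.2 (Fact.out : (k : ℕ).Prime).ne_zero
      have hN := k.card_normalizer
      rw [hkw] at hN
      have e3 : ∑ x ∈ (k.sylow : Subgroup S).sharp, (involutionPairs x : ℚ) =
          ((k : ℕ) - 1 : ℚ) * (k : ℕ) := by
        have e4 : ((k : ℕ) - 1 : ℚ) = (k.sylow : Subgroup S).sharp.card := by
          rw [cast_card_sharp, hkc]
        rw [e4, ← nsmul_eq_mul, ← Finset.sum_const]
        refine Finset.sum_congr rfl fun x hx => ?_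
        rw [mem_sharp] at hx
        rw [hS.involutionPairs_eq_card (hS.ne_two_of_mem_inverted hk) _ hN hx.1 hx.2, hkc]
      rw [e3, hkw, hkc]
      push_cast
      field_simp
    rw [e1, e2, hw, Nat.cast_pow, hT] at hsum
    rw [hw] at hw0
    field_simp at hsum
    linear_combination hsum
  · intro k _ hk
    rw [Finset.mem_insert, not_or, PrimeIndex.mem_inverted] at hk
    rw [Finset.sum_eq_zero, mul_zero]
    intro x hx
    rw [mem_sharp] at hx
    rw [hS.involutionPairs_eq_zero (fun h => hk.1 (Subtype.ext (h.trans ht.symm))) k.sylow _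
      hx.1 hx.2, Nat.cast_zero]
    rw [k.card_normalizer]
    exact fun h => hk.2 (Nat.eq_of_mul_eq_mul_left Nat.card_pos h)

theorem card_inverted_le_two (hS : IsSmallSimple S) {t : PrimeIndex S} (ht : (t : ℕ) = 2) :
    (PrimeIndex.inverted S).card ≤ 2 := by
  classical
  have htK : t ∉ PrimeIndex.inverted S := fun h => hS.ne_two_of_mem_inverted h ht
  have hc := hS.class_equation
  have hle : ∑ k ∈ PrimeIndex.inverted S,
      ((Nat.card k.sylow : ℚ) - 1) / (Nat.card k.sylow * k.weight) ≤
      ∑ k : PrimeIndex S, ((Nat.card k.sylow : ℚ) - 1) / (Nat.card k.sylow * k.weight) := by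
    refine Finset.sum_le_sum_of_subset_of_nonneg (Finset.subset_univ _) fun k _ _ => ?_
    have : (1 : ℚ) ≤ Nat.card k.sylow := by exact_mod_cast k.one_lt_card_sylow.le
    exact div_nonneg (by linarith) (by positivity)
  have hge : (PrimeIndex.inverted S).card • (1 / 3 : ℚ) ≤ ∑ k ∈ PrimeIndex.inverted S,
      ((Nat.card k.sylow : ℚ) - 1) / (Nat.card k.sylow * k.weight) := by
    refine Finset.card_nsmul_le_sum _ _ _ fun k hk => ?_
    have h3 : 3 ≤ (k : ℕ) := by
      have h1 := (Fact.out : (k : ℕ).Prime).two_le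
      have h2 := hS.ne_two_of_mem_inverted hk
      omega
    have h3' : (3 : ℚ) ≤ ((k : ℕ) : ℚ) := by exact_mod_cast h3
    rw [hS.card_sylow_of_mem_inverted hk, PrimeIndex.mem_inverted.1 hk,
      div_le_div_iff₀ (by norm_num) (by positivity)]
    push_cast
    linarith
  have hn0 : (0 : ℚ) < 1 / Nat.card S :=
    one_div_pos.2 (by exact_mod_cast Nat.card_pos)
  rw [nsmul_eq_mul] at hge
  have : ((PrimeIndex.inverted S).card : ℚ) < 3 := by linarith
  have : (PrimeIndex.inverted S).card < 3 := by exact_mod_cast this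
  omega

end IsSmallSimple

namespace IsSmallSimple

variable {S : Type*} [Group S] [Fintype S]

theorem ne_top_of_sylow (hS : IsSmallSimple S) {p : ℕ} [Fact p.Prime] (P : Sylow p S)
    (hP : (P : Subgroup S) ≠ ⊥) : normalizer ((P : Subgroup S) : Set S) ≠ ⊤ :=
  hS.normalizer_ne_top hP (hS.ne_top_of_isPGroup P.2)

theorem nonempty_mulEquiv_of_even (hS : IsSmallSimple S) (h2 : 2 ∣ Nat.card S) :
    Nonempty (S ≃* alternatingGroup (Fin 5)) := by
  classical
  let t : PrimeIndex S := ⟨2, Nat.mem_primeFactors.2 ⟨Nat.prime_two, h2, Nat.card_pos.ne'⟩⟩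
  have ht : (t : ℕ) = 2 := rfl
  obtain ⟨e, he0, he⟩ := t.exists_card_sylow
  replace he : Nat.card t.sylow = 2 ^ e := he
  have hq := hS.weight_add_one_of_eq_two ht
  have hqp := hS.weight_prime t
  obtain ⟨a, rfl⟩ : ∃ a, e = a + 2 := by
    rcases e with _ | _ | a
    · exact absurd rfl he0
    · have := hqp.two_le
      omega
    · exact ⟨a, rfl⟩
  obtain ⟨N, hN⟩ : ∃ N, N = 2 ^ (a + 1) := ⟨_, rfl⟩
  have hP : Nat.card t.sylow = 2 * N := by rw [he, hN]; ring
  have hN2 : 2 ≤ N := by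
    rw [hN, pow_succ]
    have := Nat.one_le_two_pow (n := a)
    omega
  have hqn : t.weight ∣ Nat.card S := by
    refine dvd_trans ?_ (card_subgroup_dvd_card (normalizer ((t.sylow : Subgroup S) : Set S)))
    rw [t.card_normalizer]
    exact dvd_mul_left _ _
  have hcard := hS.card_eq_of_even ht
  have hqc : (t.weight : ℚ) = Nat.card t.sylow - 1 := by
    rw [← hq]
    simp
  rw [← hqc, hP] at hcard
  rw [hP] at hq
  have hodd : ∀ k ∈ PrimeIndex.inverted S, ∃ m, (k : ℕ) = 2 * m + 1 ∧ (2 * m + 1).Prime ∧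
      (2 * m + 1).Coprime (2 * N) ∧ 2 * m + 1 ∣ Nat.card S := by
    intro k hk
    have hkp : (k : ℕ).Prime := Fact.out
    have hk2 := hS.ne_two_of_mem_inverted hk
    obtain ⟨m, hm⟩ := hkp.odd_of_ne_two hk2
    refine ⟨m, hm, hm ▸ hkp, ?_, hm ▸ k.dvd⟩
    rw [← hm, ← hP, he]
    exact Nat.Coprime.pow_right _ ((Nat.coprime_primes hkp Nat.prime_two).2 hk2)
  have h3 := hS.card_inverted_le_two ht
  obtain h0 | h1 | h2 : (PrimeIndex.inverted S).card = 0 ∨ (PrimeIndex.inverted S).card = 1 ∨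
      (PrimeIndex.inverted S).card = 2 := by omega
  · exfalso
    rw [Finset.card_eq_zero.1 h0, Finset.sum_empty, mul_zero, add_zero] at hcard
    refine hS.ne_top_of_sylow t.sylow t.sylow_ne_bot (Subgroup.card_eq_iff_eq_top _ |>.1 ?_)
    rw [t.card_normalizer, hP]
    exact_mod_cast hcard.symm
  · exfalso
    obtain ⟨k, hk⟩ := Finset.card_eq_one.1 h1
    obtain ⟨m, hm, hmp, hmN, hmd⟩ := hodd k (by simp [hk])
    refine Nat.not_one_odd_prime_order hN2 hq hmp hmN ?_ hqn hmd
    rw [hk, Finset.sum_singleton, hm] at hcard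
    have : (Nat.card S : ℚ) = ((2 * N * (t.weight + 2 * N * m) : ℕ) : ℚ) := by
      rw [hcard]
      push_cast
      ring
    exact_mod_cast this
  · obtain ⟨k, l, hkl, hk⟩ := Finset.card_eq_two.1 h2
    obtain ⟨m, hm, hmp, hmN, hmd⟩ := hodd k (by simp [hk])
    obtain ⟨r, hr, hrp, hrN, hrd⟩ := hodd l (by simp [hk])
    have hne : m ≠ r := by
      rintro rfl
      exact hkl (Subtype.ext (hm.trans hr.symm))
    obtain ⟨hN', h60⟩ := Nat.eq_sixty_of_two_odd_primes (n := Nat.card S) hN2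
      ⟨a + 2, hP.symm.trans he⟩ hq hqp hmp hrp hne
      hmN hrN (by
        rw [hk, Finset.sum_pair hkl, hm, hr] at hcard
        have : (Nat.card S : ℚ) = ((2 * N * (t.weight + 2 * N * (m + r)) : ℕ) : ℚ) := by
          rw [hcard]
          push_cast
          ring
        exact_mod_cast this) hqn hmd hrd
    have := hS.simple
    refine IsSimpleGroup.nonempty_mulEquiv_alternatingGroup h60
      (H := normalizer ((t.sylow : Subgroup S) : Set S)) ?_
    have h := (normalizer ((t.sylow : Subgroup S) : Set S)).card_mul_index.trans h60
    rw [t.card_normalizer, hP] at h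
    subst hN'
    obtain hw : t.weight = 3 := by omega
    rw [hw] at h
    omega

end IsSmallSimple

end

section

open scoped MonoidAlgebra

theorem Matrix.exists_trace_eq_of_isIdempotentElem {n : Type*} [Fintype n] [DecidableEq n]
    {A : Matrix n n ℂ} (hA : IsIdempotentElem A) : ∃ m : ℕ, A.trace = m := by
  have h : IsIdempotentElem A.toLin' := by
    rw [IsIdempotentElem, Module.End.mul_eq_comp, ← Matrix.toLin'_mul, hA.eq]
  refine ⟨Module.finrank ℂ (LinearMap.range A.toLin'), ?_⟩
  rw [← (LinearMap.IsIdempotentElem.isProj_range _ h).trace]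
  simp

theorem Matrix.trace_mul_mul_pi {ι : Type*} [Fintype ι] [DecidableEq ι] {m : ι → Type*}
    [∀ i, Fintype (m i)] [∀ i, DecidableEq (m i)] {F : Type*} [Field F]
    (A B : ∀ i, Matrix (m i) (m i) F) :
    LinearMap.trace F _ (LinearMap.mulLeft F A ∘ₗ LinearMap.mulRight F B) =
      ∑ i, (A i).trace * (B i).trace := by
  classical
  let b := Pi.basis fun i => Matrix.stdBasis F (m i) (m i)
  rw [LinearMap.trace_eq_matrix_trace F b, Matrix.trace, Fintype.sum_sigma]
  refine Finset.sum_congr rfl fun i _ => ?_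
  rw [Fintype.sum_prod_type]
  have h : ∀ j l, (A i * (Matrix.single j l 1 * B i) : Matrix (m i) (m i) F) j l = A i j j * B i l l := by
    intro j l
    simp [Matrix.mul_apply, Matrix.single_apply, ite_and]
  simp only [Matrix.diag_apply, LinearMap.toMatrix_apply, b, Pi.basis_repr, Pi.basis_apply,
    Matrix.stdBasis_eq_single, LinearMap.comp_apply, LinearMap.mulLeft_apply,
    LinearMap.mulRight_apply, Pi.mul_apply, Pi.single_eq_same]
  rw [Matrix.trace, Matrix.trace, Finset.sum_mul_sum]
  refine Finset.sum_congr rfl fun j _ => Finset.sum_congr rfl fun l _ => ?_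
  simpa [Matrix.stdBasis] using h j l

theorem LinearMap.trace_mulLeft_comp_mulRight_equiv {F A B : Type*} [Field F] [Ring A] [Algebra F A]
    [Ring B] [Algebra F B] (e : A ≃ₐ[F] B) (a b : A) :
    LinearMap.trace F B (LinearMap.mulLeft F (e a) ∘ₗ LinearMap.mulRight F (e b)) =
      LinearMap.trace F A (LinearMap.mulLeft F a ∘ₗ LinearMap.mulRight F b) := by
  rw [← LinearMap.trace_conj' _ e.toLinearEquiv]
  congr 1
  ext x
  simp [LinearEquiv.conj_apply]

namespace MonoidAlgebra

variable {S : Type*} [Group S] [Fintype S]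

theorem trace_mul_mul [DecidableEq S] {F : Type*} [Field F] (x y : S) :
    LinearMap.trace F F[S] (LinearMap.mulLeft F (single x (1 : F)) ∘ₗ
      LinearMap.mulRight F (single y (1 : F))) =
      (Finset.univ.filter fun g => x * g * y = g).card := by
  rw [LinearMap.trace_eq_matrix_trace F (MonoidAlgebra.basis S F), Matrix.trace,
    Finset.card_filter, Nat.cast_sum]
  refine Finset.sum_congr rfl fun g _ => ?_
  rw [Matrix.diag_apply, LinearMap.toMatrix_apply, MonoidAlgebra.basis_apply,
    LinearMap.comp_apply, LinearMap.mulLeft_apply, LinearMap.mulRight_apply,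
    MonoidAlgebra.single_mul_single, MonoidAlgebra.single_mul_single, one_mul, one_mul,
    ← MonoidAlgebra.basis_apply, Module.Basis.repr_self, Finsupp.single_apply, ← mul_assoc]
  push_cast
  rfl

theorem eq_sum_single {F : Type*} [Field F] (a : F[S]) :
    a = ∑ g, a.coeff g • single g (1 : F) := by
  conv_lhs => rw [← (MonoidAlgebra.basis S F).sum_repr a]
  rfl

/-- The traces on the simple factors of the complex group algebra. -/
theorem exists_irreducible_traces (S : Type*) [Group S] [Fintype S] [DecidableEq S] :
    ∃ (n : ℕ) (χ : Fin n → ℂ[S] →ₗ[ℂ] ℂ),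
      (∀ x y : S, ∑ i, χ i (single x 1) * χ i (single y⁻¹ 1) =
        (Finset.univ.filter fun g => x * g = g * y).card) ∧
      (∀ i, ∀ e : ℂ[S], IsIdempotentElem e → ∃ m : ℕ, χ i e = m) ∧
      (∀ i, ∑ g, χ i (single g 1) * χ i (single g⁻¹ 1) = Fintype.card S) ∧
      (∀ i, χ i 1 ≠ 0) ∧ (∀ i a b, χ i (a * b) = χ i (b * a)) ∧
      ∃ i₀, ∀ g, χ i₀ (single g 1) = 1 := by
  have : NeZero (Nat.card S : ℂ) := ⟨Nat.cast_ne_zero.2 Nat.card_pos.ne'⟩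
  have hfd : FiniteDimensional ℂ ℂ[S] := .of_basis (MonoidAlgebra.basis S ℂ)
  obtain ⟨n, d, hd, ⟨e⟩⟩ := IsSemisimpleRing.exists_algEquiv_pi_matrix_of_isAlgClosed ℂ ℂ[S]
  have hS0 : (Fintype.card S : ℂ) ≠ 0 := Nat.cast_ne_zero.2 Fintype.card_ne_zero
  let χ : Fin n → ℂ[S] →ₗ[ℂ] ℂ := fun i =>
    Matrix.traceLinearMap (Fin (d i)) ℂ ℂ ∘ₗ LinearMap.proj i ∘ₗ e.toLinearMap
  have hχ : ∀ i a, χ i a = (e a i).trace := fun i a => rfl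
  have hχ1 : ∀ i, χ i 1 = d i := fun i => by simp [hχ]
  have hcol : ∀ a b, ∑ i, χ i a * χ i b =
      LinearMap.trace ℂ ℂ[S] (LinearMap.mulLeft ℂ a ∘ₗ LinearMap.mulRight ℂ b) := by
    intro a b
    rw [← LinearMap.trace_mulLeft_comp_mulRight_equiv e, Matrix.trace_mul_mul_pi]
    rfl
  have hnat : ∀ i, ∀ c : ℂ[S], IsIdempotentElem c → ∃ m : ℕ, χ i c = m := by
    intro i c hc
    refine Matrix.exists_trace_eq_of_isIdempotentElem (A := e c i) ?_
    rw [IsIdempotentElem, ← Pi.mul_apply, ← map_mul, hc.eq]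
  have hreg : ∀ a : ℂ[S], ∑ i, χ i a * d i = Fintype.card S * a.coeff 1 := by
    intro a
    conv_lhs => rw [eq_sum_single a]
    simp only [map_sum, map_smul, smul_eq_mul, Finset.sum_mul]
    rw [Finset.sum_comm]
    have h : ∀ g : S, ∑ i, a.coeff g * χ i (single g 1) * d i =
        if g = 1 then Fintype.card S * a.coeff 1 else 0 := by
      intro g
      simp only [mul_assoc]
      rw [← Finset.mul_sum]
      simp only [← hχ1]
      rw [hcol, MonoidAlgebra.one_def, trace_mul_mul]
      split_ifs with h
      · subst h
        simp [mul_comm]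
      · simp [h]
    rw [Finset.sum_congr rfl fun g _ => h g]
    simp
  refine ⟨n, χ, fun x y => ?_, hnat, fun i => ?_, fun i => ?_, fun i a b => ?_, ?_⟩
  · rw [hcol, trace_mul_mul]
    simp only [mul_inv_eq_iff_eq_mul]
  · obtain ⟨E, hE⟩ : ∃ E, e E = Pi.single i 1 := e.surjective _
    have h1 : ∀ g, d i * χ i (single g⁻¹ 1) = Fintype.card S * E.coeff g := by
      intro g
      have h := hreg (E * single g⁻¹ 1)
      rw [Finset.sum_eq_single i] at h
      · rw [hχ, map_mul, Pi.mul_apply, hE, Pi.single_eq_same, one_mul, ← hχ] at h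
        rw [mul_comm, h]
        congr 1
        simp
      · intro j _ hj
        rw [hχ, map_mul, Pi.mul_apply, hE, Pi.single_eq_of_ne hj]
        simp
      · simp
    have h2 : χ i E = d i := by
      rw [hχ, hE]
      simp
    rw [eq_sum_single E, map_sum] at h2
    simp only [map_smul, smul_eq_mul] at h2
    have hd0 : (d i : ℂ) ≠ 0 := Nat.cast_ne_zero.2 (hd i).out
    apply mul_left_cancel₀ hd0
    have h3 : (d i : ℂ) * Fintype.card S =
        ∑ g, Fintype.card S * (E.coeff g * χ i (single g 1)) := by
      rw [← Finset.mul_sum, h2, mul_comm]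
    rw [Finset.mul_sum, h3]
    refine Finset.sum_congr rfl fun g _ => ?_
    rw [← mul_assoc, ← mul_assoc, ← h1]
    ring
  · rw [hχ1]
    exact Nat.cast_ne_zero.2 (hd i).out
  · rw [hχ, hχ, map_mul, map_mul, Pi.mul_apply, Pi.mul_apply, Matrix.trace_mul_comm]
  · let c : ℂ[S] := (Fintype.card S : ℂ)⁻¹ • ∑ g, single g (1 : ℂ)
    have hgc : ∀ g, single g 1 * c = c := by
      intro g
      simp only [c, mul_smul_comm, Finset.mul_sum, MonoidAlgebra.single_mul_single, one_mul]
      congr 1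
      exact Fintype.sum_equiv (Equiv.mulLeft g) _ _ fun _ => rfl
    have hcc : IsIdempotentElem c := by
      have : c * c = (Fintype.card S : ℂ)⁻¹ • ∑ g, single g (1 : ℂ) * c := by
        conv_lhs => rw [show c * c = ((Fintype.card S : ℂ)⁻¹ • ∑ g, single g (1 : ℂ)) * c from rfl]
        rw [smul_mul_assoc, Finset.sum_mul]
      rw [IsIdempotentElem, this, Finset.sum_congr rfl fun g _ => hgc g, Finset.sum_const,
        Finset.card_univ, ← Nat.cast_smul_eq_nsmul ℂ, smul_smul, inv_mul_cancel₀ hS0, one_smul]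
    choose m hm using fun i => hnat i c hcc
    have h1 : ∑ i, m i * d i = 1 := by
      have h := hreg c
      simp only [hm] at h
      have h2 : c.coeff 1 = (Fintype.card S : ℂ)⁻¹ := by
        simp [c, Finsupp.single_apply]
      rw [h2, mul_inv_cancel₀ hS0] at h
      exact_mod_cast h
    obtain ⟨i, hi⟩ : ∃ i, m i * d i ≠ 0 := by
      by_contra! h
      simp [h] at h1
    have h2 : m i * d i = 1 := by
      have := Finset.single_le_sum (f := fun i => m i * d i) (fun _ _ => Nat.zero_le _)
        (Finset.mem_univ i)
      omega
    obtain ⟨hm1, hd1⟩ := mul_eq_one.1 h2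
    refine ⟨i, fun g => ?_⟩
    have htr : ∀ A B : Matrix (Fin (d i)) (Fin (d i)) ℂ, (A * B).trace = A.trace * B.trace := by
      rw [hd1]
      intro A B
      simp [Matrix.trace, Matrix.mul_apply]
    have h3 : χ i (single g 1 * c) = χ i (single g 1) * χ i c := by
      rw [hχ, map_mul, Pi.mul_apply, htr, hχ, hχ]
    rw [hgc, hm, hm1, Nat.cast_one, mul_one] at h3
    exact h3.symm

end MonoidAlgebra

end

section

open scoped Matrix

section IntegerVectors

variable {I : Type*} [Fintype I] [DecidableEq I]

theorem exists_eq_single_sub_single {d x : I → ℤ} (hd : ∀ i, 0 < d i) (h2 : x ⬝ᵥ x = 2)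
    (h0 : x ⬝ᵥ d = 0) : ∃ a b, a ≠ b ∧ x = Pi.single a 1 - Pi.single b 1 := by
  have hne : ∃ i, x i ≠ 0 := by
    by_contra! h
    simp [dotProduct, h] at h2
  have hpos : ∃ a, 0 < x a := by
    by_contra! h
    obtain ⟨i, hi⟩ := hne
    have : x ⬝ᵥ d < 0 := Finset.sum_neg' (fun j _ => mul_nonpos_of_nonpos_of_nonneg (h j) (hd j).le)
      ⟨i, Finset.mem_univ _, mul_neg_of_neg_of_pos (lt_of_le_of_ne (h i) hi) (hd i)⟩
    omega
  have hneg : ∃ b, x b < 0 := by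
    by_contra! h
    obtain ⟨i, hi⟩ := hne
    have : 0 < x ⬝ᵥ d := Finset.sum_pos' (fun j _ => mul_nonneg (h j) (hd j).le)
      ⟨i, Finset.mem_univ _, mul_pos (lt_of_le_of_ne (h i) hi.symm) (hd i)⟩
    omega
  obtain ⟨a, ha⟩ := hpos
  obtain ⟨b, hb⟩ := hneg
  have hab : a ≠ b := by
    rintro rfl
    omega
  have hle : ∀ s : Finset I, ∑ i ∈ s, x i * x i ≤ 2 := fun s =>
    (Finset.sum_le_univ_sum_of_nonneg fun i => mul_self_nonneg _).trans h2.le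
  have h3 := hle {a, b}
  rw [Finset.sum_pair hab] at h3
  have ha1 : x a = 1 := by nlinarith
  have hb1 : x b = -1 := by nlinarith
  refine ⟨a, b, hab, funext fun i => ?_⟩
  by_cases hia : i = a
  · subst hia
    simp [ha1, hab]
  by_cases hib : i = b
  · subst hib
    simp [hb1, hia]
  · have h4 := hle {i, a, b}
    rw [Finset.sum_insert (by simp [hia, hib]), Finset.sum_pair hab, ha1, hb1] at h4
    have : x i = 0 := mul_self_eq_zero.1 (by nlinarith [mul_self_nonneg (x i)])
    simp [this, hia, hib]

theorem exists_eq_image_add_single {U : Finset (I → ℤ)} (hU : 2 ≤ U.card)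
    (h : ∀ u ∈ U, ∀ u' ∈ U, u ≠ u' → ∃ a b, a ≠ b ∧ u - u' = Pi.single a 1 - Pi.single b 1) :
    ∃ (z : I → ℤ) (ε : ℤ) (F : Finset I), ε * ε = 1 ∧
      U = F.image fun i => z + ε • Pi.single i 1 := by
  have key : ∀ (z : I → ℤ) (ε : ℤ), (∀ u ∈ U, ∃ i, u = z + ε • Pi.single i 1) →
      U = (Finset.univ.filter fun i => z + ε • Pi.single i 1 ∈ U).image
        fun i => z + ε • Pi.single i 1 := by
    intro z ε hz
    ext u
    simp only [Finset.mem_image, Finset.mem_filter_univ]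
    constructor
    · intro hu
      obtain ⟨i, rfl⟩ := hz u hu
      exact ⟨i, hu, rfl⟩
    · rintro ⟨i, hi, rfl⟩
      exact hi
  obtain ⟨u₁, hu₁, u₂, hu₂, hne⟩ := Finset.one_lt_card.1 hU
  obtain ⟨a, b, hab, h12⟩ := h u₁ hu₁ u₂ hu₂ hne
  have hu₁' : u₁ = u₂ + Pi.single a 1 - Pi.single b 1 := by rw [← sub_add_cancel u₁ u₂, h12]; abel
  have hcases : ∀ u ∈ U, u ≠ u₁ → u ≠ u₂ →
      (∃ e, e ≠ a ∧ e ≠ b ∧ u = u₂ + Pi.single a 1 - Pi.single e 1) ∨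
      (∃ c, c ≠ a ∧ c ≠ b ∧ u = u₂ - Pi.single b 1 + Pi.single c 1) := by
    intro u hu h1 h2
    obtain ⟨c, e, hce, huc⟩ := h u hu u₂ hu₂ h2
    obtain ⟨p, r, hpr, hup⟩ := h u hu u₁ hu₁ h1
    have hu' : u = u₂ + Pi.single c 1 - Pi.single e 1 := by rw [← sub_add_cancel u u₂, huc]; abel
    have h3 : (Pi.single c 1 - Pi.single e 1 - Pi.single a 1 + Pi.single b 1 : I → ℤ) =
        Pi.single p 1 - Pi.single r 1 := by
      rw [← hup, hu', hu₁']
      abel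
    have h4 := congrArg (fun x => x ⬝ᵥ x) h3
    simp only [dotProduct_sub, dotProduct_add, sub_dotProduct, add_dotProduct,
      single_dotProduct, one_mul, Pi.single_apply] at h4
    by_cases hca : c = a
    · subst hca
      by_cases heb : e = b
      · subst heb
        exact absurd (hu'.trans hu₁'.symm) h1
      · exact Or.inl ⟨e, hce.symm, heb, hu'⟩
    · by_cases heb : e = b
      · subst heb
        exact Or.inr ⟨c, hca, hce, by rw [hu']; abel⟩
      · simp only [hca, heb, hab, hce, hpr, Ne.symm hca, Ne.symm heb, hab.symm, hce.symm,
          hpr.symm, if_true, if_false] at h4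
        exfalso
        split_ifs at h4 <;> omega
  by_cases hA : ∀ u ∈ U, ∃ i, u = (u₂ + Pi.single a 1) + (-1 : ℤ) • Pi.single i 1
  · exact ⟨_, -1, _, by norm_num, key _ _ hA⟩
  · refine ⟨u₂ - Pi.single b 1, 1, _, by norm_num, key _ _ fun u' hu' => ?_⟩
    push Not at hA
    obtain ⟨u, hu, hui⟩ := hA
    by_cases h1 : u' = u₁
    · exact ⟨a, by rw [h1, hu₁']; simp; abel⟩
    by_cases h2 : u' = u₂
    · exact ⟨b, by rw [h2]; simp⟩
    rcases hcases u' hu' h1 h2 with ⟨e, hea, heb, he⟩ | ⟨c, -, -, hc⟩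
    · exfalso
      have hu1 : u ≠ u₁ := fun hh => hui b (by rw [hh, hu₁']; simp; abel)
      have hu2 : u ≠ u₂ := fun hh => hui a (by rw [hh]; simp)
      rcases hcases u hu hu1 hu2 with ⟨f, -, -, hf⟩ | ⟨c, hca, hcb, hc⟩
      · exact hui f (by rw [hf]; simp; abel)
      · have huu : u ≠ u' := by
          intro hh
          have h5 := congrFun (hc.symm.trans (hh.trans he)) a
          simp [hab, hca.symm, hea.symm] at h5
        obtain ⟨p, r, hpr, hup⟩ := h u hu u' hu' huu
        have h3 : (Pi.single c 1 + Pi.single e 1 - Pi.single a 1 - Pi.single b 1 : I → ℤ) =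
            Pi.single p 1 - Pi.single r 1 := by
          rw [← hup, he, hc]
          abel
        have h4 := congrArg (fun x => x ⬝ᵥ x) h3
        simp only [dotProduct_sub, dotProduct_add, sub_dotProduct, add_dotProduct,
          single_dotProduct, one_mul, Pi.single_apply] at h4
        simp only [hca, hcb, hea, heb, hab, hpr, hca.symm, hcb.symm, hea.symm, heb.symm, hab.symm,
          hpr.symm, if_true, if_false] at h4
        split_ifs at h4 <;> omega
    · exact ⟨c, by rw [hc]; simp⟩

theorem sub_smul_single_dotProduct (x y : I → ℤ) (ε δ : ℤ) (i j : I) :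
    (x - ε • Pi.single i 1) ⬝ᵥ (y - δ • Pi.single j 1) =
      x ⬝ᵥ y - δ * x j - ε * y i + ε * δ * if i = j then 1 else 0 := by
  simp only [dotProduct_sub, sub_dotProduct, smul_dotProduct, dotProduct_smul, smul_eq_mul,
    single_dotProduct, dotProduct_single, one_mul, mul_one, Pi.sub_apply, Pi.smul_apply,
    Pi.single_apply, eq_comm (a := j)]
  split_ifs <;> ring

end IntegerVectors

theorem exceptional_row_identity {z c ε w q : ℚ} (hε : ε * ε = 1) (hq : 0 < q) (hw : 0 ≤ w) :
    ((w * q + 1) * ((z + c) ^ 2 + q * (w * z ^ 2 + 2 * z * ε + 1)) -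
      (z + c + q * (w * z + ε)) ^ 2) / ((w * q + 1) * q) =
    (w * c ^ 2 - 2 * ε * c - q) / (w * q + 1) + 1 := by
  have : 0 < w * q + 1 := by positivity
  field_simp
  linear_combination (-q ^ 2) * hε

theorem constant_row_identity {z c w q : ℚ} (hq : 0 < q) (hw : 0 ≤ w) :
    ((w * q + 1) * ((z + c) ^ 2 + q * (w * z ^ 2)) - (z + c + q * (w * z)) ^ 2) /
      ((w * q + 1) * q) = w * c ^ 2 / (w * q + 1) := by
  have : 0 < w * q + 1 := by positivity
  field_simp
  ring

/-- The numerical constraints satisfied by the values of the irreducible characters of a group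
with trivially intersecting abelian Sylow subgroups are inconsistent. -/
theorem false_of_exceptional_characters {I K : Type*} [Fintype I] [DecidableEq I] [Fintype K]
    [DecidableEq K] [Nonempty K] (i₀ : I) (d : I → ℤ) (n : ℚ) (v : K → I → ℤ)
    (U : K → Finset (I → ℤ)) (q w : K → ℕ) (hn : 0 < n) (hd : ∀ i, 0 < d i) (hq : ∀ k, 2 ≤ q k)
    (hw : ∀ k, 2 ≤ w k) (hweven : ∀ k, Even (w k))
    (hinj : Function.Injective fun k => w k * q k + 1)
    (hI : Fintype.card I = 1 + ∑ k, w k) (hU : ∀ k, (U k).card = w k)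
    (hsame : ∀ k, ∀ u ∈ U k, ∀ u' ∈ U k,
      (v k - u) ⬝ᵥ (v k - u') = q k + if u = u' then 1 else 0)
    (hne : ∀ k l, k ≠ l → ∀ u ∈ U k, ∀ u' ∈ U l, (v k - u) ⬝ᵥ (v l - u') = 0)
    (hv₀ : ∀ k, v k i₀ = 1) (hu₀ : ∀ k, ∀ u ∈ U k, u i₀ = 0)
    (hvd : ∀ k, ∀ u ∈ U k, (v k - u) ⬝ᵥ d = 0)
    (hdv : ∀ k i, d i = v k i + q k * ∑ u ∈ U k, u i)
    (hrow : ∀ i, (1 : ℚ) = d i ^ 2 / n + ∑ k, ((w k * q k + 1) *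
      ((v k i : ℚ) ^ 2 + q k * ∑ u ∈ U k, (u i : ℚ) ^ 2) - d i ^ 2) / ((w k * q k + 1) * q k))
    (hclass : (1 : ℚ) = 1 / n + ∑ k, (w k : ℚ) / (w k * q k + 1)) : False := by
  have hstar : ∀ k, ∃ (z : I → ℤ) (ε : ℤ) (F : Finset I), ε * ε = 1 ∧
      U k = F.image fun i => z + ε • Pi.single i 1 := by
    intro k
    refine exists_eq_image_add_single (by rw [hU]; exact hw k) fun u hu u' hu' huu => ?_
    have h1 := hsame k u hu u hu
    have h2 := hsame k u hu u' hu'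
    have h3 := hsame k u' hu' u hu
    have h4 := hsame k u' hu' u' hu'
    rw [if_pos rfl] at h1 h4
    rw [if_neg huu] at h2
    rw [if_neg huu.symm] at h3
    have e : u - u' = (v k - u') - (v k - u) := by abel
    refine exists_eq_single_sub_single hd ?_ ?_
    · have hexp : ∀ x y : I → ℤ, (x - y) ⬝ᵥ (x - y) = x ⬝ᵥ x - x ⬝ᵥ y - y ⬝ᵥ x + y ⬝ᵥ y := by
        intro x y
        simp only [sub_dotProduct, dotProduct_sub]
        ring
      rw [e, hexp]
      omega
    · rw [e, sub_dotProduct, hvd k u hu, hvd k u' hu', sub_zero]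
  choose z ε F hε hUF using hstar
  have hε0 : ∀ k, ε k ≠ 0 := fun k h => by simpa [h] using hε k
  have hFinj : ∀ k, Function.Injective fun i => z k + ε k • (Pi.single i 1 : I → ℤ) := by
    intro k i j hij
    have h := congrFun hij i
    by_contra hne'
    simp [hne', hε0 k] at h
  have hFcard : ∀ k, (F k).card = w k := by
    intro k
    rw [← hU k, hUF k, Finset.card_image_of_injective _ (hFinj k)]
  have hmem : ∀ k, ∀ i ∈ F k, z k + ε k • Pi.single i 1 ∈ U k := by
    intro k i hi
    rw [hUF k]
    exact Finset.mem_image_of_mem _ hi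
  obtain ⟨c, hc⟩ : ∃ c : K → I → ℤ, ∀ k, c k = v k - z k := ⟨_, fun _ => rfl⟩
  have hcs : ∀ k i, v k - (z k + ε k • Pi.single i 1) = c k - ε k • Pi.single i 1 := by
    intro k i
    rw [hc, sub_sub]
  have D1 : ∀ k, ∀ i ∈ F k, ∀ j ∈ F k,
      c k ⬝ᵥ c k - ε k * c k j - ε k * c k i = q k := by
    intro k i hi j hj
    have h := hsame k _ (hmem k i hi) _ (hmem k j hj)
    rw [hcs, hcs, sub_smul_single_dotProduct, hε] at h
    by_cases hij : i = j
    · subst hij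
      simp only [if_true] at h
      linarith
    · rw [if_neg hij, if_neg fun h' => hij (hFinj k h')] at h
      linarith
  have D2 : ∀ k l, k ≠ l → ∀ i ∈ F k, ∀ j ∈ F l,
      c k ⬝ᵥ c l - ε l * c k j - ε k * c l i + ε k * ε l * (if i = j then 1 else 0) = 0 := by
    intro k l hkl i hi j hj
    have h := hne k l hkl _ (hmem k i hi) _ (hmem l j hj)
    rwa [hcs, hcs, sub_smul_single_dotProduct] at h
  have hother : ∀ k, ∀ i ∈ F k, ∃ j ∈ F k, j ≠ i := by
    intro k i _
    exact Finset.exists_mem_ne (by rw [hFcard]; exact hw k) i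
  have hdisj : ∀ k l, k ≠ l → Disjoint (F k) (F l) := by
    intro k l hkl
    rw [Finset.disjoint_left]
    intro i hik hil
    obtain ⟨j, hj, hji⟩ := hother k i hik
    obtain ⟨m, hm, hmi⟩ := hother l i hil
    have h1 := D2 k l hkl i hik i hil
    have h2 := D2 k l hkl j hj i hil
    have h3 := D2 k l hkl i hik m hm
    have h4 := D2 k l hkl j hj m hm
    rw [if_pos rfl] at h1
    rw [if_neg hji] at h2
    rw [if_neg hmi.symm] at h3
    have h5 : ε k * ε l * (1 + if j = m then 1 else 0) = 0 := by linarith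
    have h6 := mul_ne_zero (hε0 k) (hε0 l)
    rcases mul_eq_zero.1 h5 with h | h
    · exact h6 h
    · split_ifs at h <;> omega
  have hi₀F : ∀ k, i₀ ∉ F k := by
    intro k hi
    obtain ⟨j, hj, hji⟩ := hother k i₀ hi
    have h1 := hu₀ k _ (hmem k i₀ hi)
    have h2 := hu₀ k _ (hmem k j hj)
    simp only [Pi.add_apply, Pi.smul_apply, Pi.single_eq_same, Pi.single_eq_of_ne hji.symm,
      smul_eq_mul, mul_one, mul_zero, add_zero] at h1 h2
    exact hε0 k (by omega)
  have hsum : ∀ f : I → ℤ, ∑ i, f i = f i₀ + ∑ k, ∑ i ∈ F k, f i := by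
    intro f
    rw [← Finset.sum_biUnion fun k _ l _ hkl => hdisj k l hkl, ← Finset.sum_insert (by
      simpa using hi₀F)]
    congr 1
    symm
    rw [← Finset.card_eq_iff_eq_univ, Finset.card_insert_of_notMem (by simpa using hi₀F),
      Finset.card_biUnion fun k _ l _ hkl => hdisj k l hkl, hI, add_comm]
    simp only [hFcard]
  have hpick : ∀ k, ∃ i, i ∈ F k := by
    intro k
    refine Finset.card_pos.1 ?_
    rw [hFcard]
    have := hw k
    omega
  choose e he using hpick
  have hconst : ∀ k l, ∀ i ∈ F l, c k i = c k (e l) := by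
    intro k l i hi
    apply mul_left_cancel₀ (hε0 l)
    by_cases hkl : k = l
    · subst hkl
      have h1 := D1 k i hi i hi
      have h2 := D1 k i hi (e k) (he k)
      linarith
    · have h1 := D2 k l hkl (e k) (he k) i hi
      have h2 := D2 k l hkl (e k) (he k) (e l) (he l)
      rw [if_neg fun h => Finset.disjoint_left.1 (hdisj k l hkl) (he k) (by rwa [h])] at h1
      rw [if_neg fun h => Finset.disjoint_left.1 (hdisj k l hkl) (he k) (by rw [h]; exact he l)] at h2
      linarith
  obtain ⟨C, hC⟩ : ∃ C : K → K → ℤ, ∀ k l, C k l = c k (e l) := ⟨_, fun _ _ => rfl⟩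
  have hc₀ : ∀ k, c k i₀ = 1 := by
    intro k
    have h1 := hu₀ k _ (hmem k _ (he k))
    have h2 : i₀ ≠ e k := fun h => hi₀F k (h ▸ he k)
    simp only [Pi.add_apply, Pi.smul_apply, Pi.single_eq_of_ne h2, smul_zero, add_zero] at h1
    rw [hc, Pi.sub_apply, hv₀, h1, sub_zero]
  have hdot : ∀ k l, c k ⬝ᵥ c l = 1 + ∑ j, w j * (C k j * C l j) := by
    intro k l
    rw [dotProduct, hsum, hc₀, hc₀, one_mul]
    congr 1
    refine Finset.sum_congr rfl fun j _ => ?_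
    rw [← hFcard j, ← nsmul_eq_mul, ← Finset.sum_const]
    refine Finset.sum_congr rfl fun i hi => ?_
    rw [hconst k j i hi, hconst l j i hi, hC, hC]
  have hnorm : ∀ k, 1 + ∑ j, w j * (C k j * C k j) - 2 * ε k * C k k = q k := by
    intro k
    rw [← hdot, hC, ← D1 k _ (he k) _ (he k)]
    ring
  have hpar : ∀ k l, k ≠ l → C k l ≠ 0 ∨ C l k ≠ 0 := by
    intro k l hkl
    by_contra! h
    have h1 := D2 k l hkl _ (he k) _ (he l)
    rw [hdot, ← hC, ← hC, h.1, h.2,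
      if_neg fun h => Finset.disjoint_left.1 (hdisj k l hkl) (he k) (by rw [h]; exact he l)] at h1
    have h2 : Even (∑ j, w j * (C k j * C l j)) :=
      Finset.even_sum _ fun j _ => ((Int.even_coe_nat _).2 (hweven j)).mul_right _
    obtain ⟨m, hm⟩ := h2
    rw [hm] at h1
    omega
  obtain ⟨k, -, hmin⟩ := Finset.exists_min_image (Finset.univ : Finset K)
    (fun k => w k * q k + 1) Finset.univ_nonempty
  have hqpos : ∀ l, (0 : ℚ) < q l := fun l => by
    have := hq l
    positivity
  have hwpos : ∀ l, (0 : ℚ) < w l := fun l => by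
    have := hw l
    positivity
  have hvz : ∀ l i, (v l i : ℚ) = z l i + c l i := by
    intro l i
    rw [hc, Pi.sub_apply]
    push_cast
    ring
  have hsumU : ∀ l (f : ℤ → ℚ), ∑ u ∈ U l, f (u (e k)) =
      ∑ i ∈ F l, f (z l (e k) + ε l * if e k = i then 1 else 0) := by
    intro l f
    rw [hUF l, Finset.sum_image fun i _ j _ hij => hFinj l hij]
    simp only [Pi.add_apply, Pi.smul_apply, Pi.single_apply, smul_eq_mul]
  have hdv' : ∀ l, (d (e k) : ℚ) = v l (e k) + q l * ∑ u ∈ U l, (u (e k) : ℚ) := by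
    intro l
    rw [hdv l]
    push_cast
    rfl
  have hterm : ∀ l, l ≠ k → ((w l * q l + 1) * ((v l (e k) : ℚ) ^ 2 + q l *
      ∑ u ∈ U l, (u (e k) : ℚ) ^ 2) - d (e k) ^ 2) / ((w l * q l + 1) * q l) =
      w l * (C l k : ℚ) ^ 2 / (w l * q l + 1) := by
    intro l hl
    have h0 : ∀ i ∈ F l, e k ≠ i := fun i hi h =>
      Finset.disjoint_left.1 (hdisj l k hl) hi (h ▸ he k)
    have hsum' : ∀ f : ℤ → ℚ, ∑ u ∈ U l, f (u (e k)) = w l * f (z l (e k)) := by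
      intro f
      rw [hsumU l f, ← hFcard l, ← nsmul_eq_mul, ← Finset.sum_const]
      refine Finset.sum_congr rfl fun i hi => ?_
      rw [if_neg (h0 i hi), mul_zero, add_zero]
    rw [hdv' l, hsum' fun x => (x : ℚ), hsum' fun x => (x : ℚ) ^ 2, hvz, hC, constant_row_identity (hqpos l) (hwpos l).le]
  have htermk : ((w k * q k + 1) * ((v k (e k) : ℚ) ^ 2 + q k *
      ∑ u ∈ U k, (u (e k) : ℚ) ^ 2) - d (e k) ^ 2) / ((w k * q k + 1) * q k) =
      (w k * (C k k : ℚ) ^ 2 - 2 * ε k * C k k - q k) / (w k * q k + 1) + 1 := by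
    have h1 : ∑ u ∈ U k, (u (e k) : ℚ) = w k * z k (e k) + ε k := by
      rw [hsumU k fun x => (x : ℚ)]
      push_cast
      simp [Finset.sum_add_distrib, hFcard, he k]
    have h2 : ∑ u ∈ U k, (u (e k) : ℚ) ^ 2 =
        w k * (z k (e k) : ℚ) ^ 2 + 2 * z k (e k) * ε k + 1 := by
      rw [hsumU k fun x => (x : ℚ) ^ 2]
      have h3 : ∀ i, (((z k (e k) + ε k * if e k = i then 1 else 0 : ℤ) : ℚ)) ^ 2 =
          (z k (e k) : ℚ) ^ 2 + if e k = i then 2 * (z k (e k) : ℚ) * ε k + 1 else 0 := by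
        intro i
        have h4 : (ε k : ℚ) * ε k = 1 := by exact_mod_cast hε k
        split_ifs
        · push_cast
          linear_combination h4
        · simp
      simp only [h3]
      simp [Finset.sum_add_distrib, hFcard, he k]
      ring
    rw [hdv' k, h1, h2, hvz, hC,
      exceptional_row_identity (by exact_mod_cast hε k) (hqpos k) (hwpos k).le]
  have hr := hrow (e k)
  rw [← Finset.add_sum_erase _ _ (Finset.mem_univ k), htermk,
    Finset.sum_congr rfl fun l hl => hterm l (Finset.ne_of_mem_erase hl)] at hr
  rw [← Finset.add_sum_erase _ _ (Finset.mem_univ k)] at hclass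
  have hbr : 0 ≤ (w k : ℤ) * (C k k * C k k) - 2 * ε k * C k k := by
    have h1 : (2 : ℤ) ≤ w k := by exact_mod_cast hw k
    have h2 : 2 * (C k k * C k k) ≤ (w k : ℤ) * (C k k * C k k) :=
      mul_le_mul_of_nonneg_right h1 (mul_self_nonneg _)
    have h3 : ε k * C k k ≤ C k k * C k k := by
      have h4 : (ε k * C k k) * (ε k * C k k) = C k k * C k k := by
        linear_combination (C k k * C k k) * hε k
      rw [← h4]
      rcases le_or_gt (ε k * C k k) 0 with h | h
      · exact h.trans (mul_self_nonneg _)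
      · nlinarith
    linarith
  have hN := hnorm k
  rw [← Finset.add_sum_erase _ _ (Finset.mem_univ k)] at hN
  have hN' : ∑ l ∈ Finset.univ.erase k, (w l : ℤ) * (C k l * C k l) ≤ q k - 1 := by linarith
  have hNQ : ∑ l ∈ Finset.univ.erase k, (w l : ℚ) * (C k l * C k l) ≤ q k - 1 := by
    exact_mod_cast hN'
  have hbrQ : (0 : ℚ) ≤ w k * (C k k : ℚ) ^ 2 - 2 * ε k * C k k := by
    rw [sq]
    exact_mod_cast hbr
  have hPpos : ∀ l, (0 : ℚ) < w l * q l + 1 := fun l => by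
    have := hqpos l
    have := hwpos l
    positivity
  have hle : ∑ l ∈ Finset.univ.erase k, (w l : ℚ) / (w l * q l + 1) ≤
      ∑ l ∈ Finset.univ.erase k, w l * (C l k : ℚ) ^ 2 / (w l * q l + 1) +
      (q k - 1) / (w k * q k + 2) := by
    have h1 : ∑ l ∈ Finset.univ.erase k, (w l : ℚ) * (C k l * C k l) / (w k * q k + 2) ≤
        (q k - 1) / (w k * q k + 2) := by
      rw [← Finset.sum_div]
      exact div_le_div_of_nonneg_right hNQ (by linarith [hPpos k])
    refine le_trans ?_ (add_le_add_right h1 _)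
    rw [← Finset.sum_add_distrib]
    refine Finset.sum_le_sum fun l hl => ?_
    have hlk := Finset.ne_of_mem_erase hl
    have h2 : (w k * q k + 2 : ℚ) ≤ w l * q l + 1 := by
      have h3 := hmin l (Finset.mem_univ _)
      have h4 : w k * q k + 1 ≠ w l * q l + 1 := fun h => hlk (hinj h.symm)
      have h5 : w k * q k + 2 ≤ w l * q l + 1 := by omega
      exact_mod_cast h5
    have h6 : (w l : ℚ) * (C k l * C k l) / (w l * q l + 1) ≤
        (w l : ℚ) * (C k l * C k l) / (w k * q k + 2) :=
      div_le_div_of_nonneg_left (mul_nonneg (hwpos l).le (mul_self_nonneg _))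
        (by linarith [hPpos k]) h2
    refine le_trans ?_ (add_le_add_right h6 _)
    rw [← add_div]
    refine div_le_div_of_nonneg_right ?_ (hPpos l).le
    have h7 : (1 : ℤ) ≤ C l k * C l k + C k l * C k l := by
      rcases hpar l k hlk with h | h
      · have := mul_self_pos.2 h
        have := mul_self_nonneg (C k l)
        omega
      · have := mul_self_pos.2 h
        have := mul_self_nonneg (C l k)
        omega
    have h8 : (1 : ℚ) ≤ C l k * C l k + C k l * C k l := by exact_mod_cast h7
    nlinarith [hwpos l]
  have hlt : ((q k : ℚ) - 1) / (w k * q k + 2) < (q k - 1) / (w k * q k + 1) := by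
    have : (2 : ℚ) ≤ q k := by exact_mod_cast hq k
    exact div_lt_div_of_pos_left (by linarith) (hPpos k) (by linarith)
  have hdn : 1 / n ≤ (d (e k) : ℚ) ^ 2 / n := by
    refine div_le_div_of_nonneg_right ?_ hn.le
    have : (1 : ℚ) ≤ d (e k) := by exact_mod_cast hd (e k)
    nlinarith
  have hdivs : (w k * (C k k : ℚ) ^ 2 - 2 * ε k * C k k - q k) / (w k * q k + 1) =
      (w k * (C k k : ℚ) ^ 2 - 2 * ε k * C k k) / (w k * q k + 1) - q k / (w k * q k + 1) :=
    sub_div _ _ _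
  have hbr' := div_nonneg hbrQ (hPpos k).le
  have hfin : (1 : ℚ) < w k / (w k * q k + 1) + q k / (w k * q k + 1) +
      (q k - 1) / (w k * q k + 1) := by linarith
  rw [← add_div, ← add_div, lt_div_iff₀ (hPpos k)] at hfin
  have h1 : (2 : ℚ) ≤ w k := by exact_mod_cast hw k
  have h2 : (2 : ℚ) ≤ q k := by exact_mod_cast hq k
  nlinarith [mul_nonneg (sub_nonneg.2 h1) (sub_nonneg.2 h2)]

end

section

open Subgroup
open scoped MonoidAlgebra

theorem MonoidAlgebra.isIdempotentElem_sum_single {S : Type*} [Group S] (A : Subgroup S) [Fintype A]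
    (φ : A →* ℂˣ) : IsIdempotentElem ((Fintype.card A : ℂ)⁻¹ •
      ∑ a : A, MonoidAlgebra.single (a : S) ((φ a⁻¹ : ℂˣ) : ℂ)) := by
  have hA : (Fintype.card A : ℂ) ≠ 0 := Nat.cast_ne_zero.2 Fintype.card_ne_zero
  obtain ⟨c, hc⟩ : ∃ c : ℂ[S], c = ∑ a : A, MonoidAlgebra.single (a : S) ((φ a⁻¹ : ℂˣ) : ℂ) :=
    ⟨_, rfl⟩
  have h : ∀ a : A, MonoidAlgebra.single (a : S) ((φ a⁻¹ : ℂˣ) : ℂ) * c = c := by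
    intro a
    rw [hc, Finset.mul_sum]
    refine Fintype.sum_equiv (Equiv.mulLeft a) _ _ fun b => ?_
    rw [MonoidAlgebra.single_mul_single, Equiv.coe_mulLeft, mul_inv_rev, mul_comm, map_mul]
    rfl
  have hcc : c * c = (Fintype.card A : ℂ) • c := by
    conv_lhs => rw [show c * c = (∑ a : A, MonoidAlgebra.single (a : S) ((φ a⁻¹ : ℂˣ) : ℂ)) * c by
      rw [← hc]]
    rw [Finset.sum_mul, Finset.sum_congr rfl fun a _ => h a, Finset.sum_const, Finset.card_univ,
      Nat.cast_smul_eq_nsmul]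
  rw [← hc, IsIdempotentElem, smul_mul_smul_comm, hcc, smul_smul, mul_assoc, inv_mul_cancel₀ hA,
    mul_one]

/-- The values of the irreducible complex characters of a finite group. -/
structure CharacterTable (S : Type*) [Group S] [Fintype S] [DecidableEq S] where
  /-- The number of irreducible characters. -/
  size : ℕ
  /-- The value of an irreducible character. -/
  val : Fin size → S → ℂ
  val_conj : ∀ i g x, val i (g * x * g⁻¹) = val i x
  sum_mul_inv : ∀ x y, ∑ i, val i x * val i y⁻¹ =
    (Finset.univ.filter fun g => x * g = g * y).card
  exists_multiplicity : ∀ i (A : Subgroup S) [Fintype A] (φ : A →* ℂˣ), ∃ m : ℕ,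
    ∑ a : A, ((φ a⁻¹ : ℂˣ) : ℂ) * val i a = Fintype.card A * m
  sum_val_mul_inv : ∀ i, ∑ g, val i g * val i g⁻¹ = Fintype.card S
  exists_degree : ∀ i, ∃ d : ℕ, 0 < d ∧ val i 1 = d
  /-- The index of the trivial character. -/
  triv : Fin size
  val_triv : ∀ g, val triv g = 1

theorem nonempty_characterTable (S : Type*) [Group S] [Fintype S] [DecidableEq S] :
    Nonempty (CharacterTable S) := by
  obtain ⟨n, χ, h1, h2, h3, h4, h5, i₀, h6⟩ := MonoidAlgebra.exists_irreducible_traces S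
  have hd : ∀ i, ∃ d : ℕ, 0 < d ∧ χ i (MonoidAlgebra.single 1 1) = d := by
    intro i
    obtain ⟨m, hm⟩ := h2 i 1 IsIdempotentElem.one
    refine ⟨m, Nat.pos_of_ne_zero ?_, hm⟩
    rintro rfl
    exact h4 i (by rw [hm, Nat.cast_zero])
  refine ⟨⟨n, fun i g => χ i (MonoidAlgebra.single g 1), fun i g x => ?_, h1, fun i A _ φ => ?_, h3,
    hd, i₀, h6⟩⟩
  · have := h5 i (MonoidAlgebra.single (g * x) 1) (MonoidAlgebra.single g⁻¹ 1)
    rw [MonoidAlgebra.single_mul_single, MonoidAlgebra.single_mul_single, mul_one] at this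
    rw [this, ← mul_assoc, inv_mul_cancel, one_mul]
  · obtain ⟨m, hm⟩ := h2 i _ (MonoidAlgebra.isIdempotentElem_sum_single A φ)
    have hA : (Fintype.card A : ℂ) ≠ 0 := Nat.cast_ne_zero.2 Fintype.card_ne_zero
    refine ⟨m, ?_⟩
    rw [← hm, map_smul, smul_eq_mul, mul_inv_cancel_left₀ hA, map_sum]
    refine Finset.sum_congr rfl fun a _ => ?_
    rw [← smul_eq_mul, ← map_smul, MonoidAlgebra.smul_single, smul_eq_mul, mul_one]

end

section

open Subgroup
open scoped Matrix

theorem Complex.finite_monoidHom_units (A : Type*) [Group A] [Finite A] : Finite (A →* ℂˣ) := by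
  have : NeZero (Monoid.exponent A) := ⟨Monoid.exponent_ne_zero_of_finite⟩
  infer_instance

theorem Complex.sum_monoidHom_units_apply {A : Type*} [Group A] [Finite A] [IsMulCommutative A]
    [DecidableEq A] [Fintype (A →* ℂˣ)] (a : A) :
    ∑ φ : A →* ℂˣ, (φ a : ℂ) = if a = 1 then (Nat.card A : ℂ) else 0 := by
  let : CommGroup A := { ‹Group A› with mul_comm := mul_comm' }
  have : NeZero (Monoid.exponent A) := ⟨Monoid.exponent_ne_zero_of_finite⟩
  split_ifs with h
  · subst h
    have := CommGroup.card_monoidHom_of_hasEnoughRootsOfUnity A ℂ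
    rw [Nat.card_eq_fintype_card] at this
    simp only [map_one, Units.val_one, Finset.sum_const, Finset.card_univ, nsmul_one]
    exact_mod_cast this
  · obtain ⟨ψ, hψ⟩ := CommGroup.exists_apply_ne_one_of_hasEnoughRootsOfUnity A ℂ h
    have h1 : (ψ a : ℂ) * ∑ φ : A →* ℂˣ, (φ a : ℂ) = ∑ φ : A →* ℂˣ, (φ a : ℂ) := by
      rw [Finset.mul_sum]
      exact Fintype.sum_equiv (Equiv.mulLeft ψ) _ _ fun φ => by simp
    have h2 : ((ψ a : ℂ) - 1) * ∑ φ : A →* ℂˣ, (φ a : ℂ) = 0 := by rw [sub_mul, h1, one_mul, sub_self]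
    refine (mul_eq_zero.1 h2).resolve_left fun h3 => hψ ?_
    exact Units.ext (sub_eq_zero.1 h3)

theorem Complex.sum_monoidHom_units {A : Type*} [Group A] [Fintype A] (φ : A →* ℂˣ)
    [Decidable (φ = 1)] : ∑ a, (φ a : ℂ) = if φ = 1 then (Fintype.card A : ℂ) else 0 := by
  have h := sum_hom_units ((Units.coeHom ℂ).comp φ)
  have hiff : (Units.coeHom ℂ).comp φ = 1 ↔ φ = 1 := by
    refine ⟨fun h => ?_, fun h => ?_⟩
    · ext a
      exact DFunLike.congr_fun h a
    · ext a
      simp [h]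
  classical
  simp only [hiff] at h
  simpa using h

theorem Subgroup.sum_sum_ite_eq_one {S : Type*} [Group S] [DecidableEq S] (A B : Subgroup S)
    [Fintype A] [Fintype B] {g : S} (φ : A →* ℂˣ) (ψ : B →* ℂˣ)
    (h : ∀ a ∈ A, ∀ b ∈ B, a * g = g * b → a = 1) :
    (∑ a : A, ∑ b : B, if (a : S) * g = g * b then ((φ a⁻¹ : ℂˣ) : ℂ) * (ψ b : ℂ) else 0) = 1 := by
  rw [Finset.sum_eq_single 1, Finset.sum_eq_single 1]
  · simp
  · intro b _ hb
    rw [if_neg]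
    intro h'
    rw [OneMemClass.coe_one, one_mul, eq_comm, mul_eq_left] at h'
    exact hb (Subtype.ext h')
  · simp
  · intro a _ ha
    refine Finset.sum_eq_zero fun b _ => if_neg fun h' => ha (Subtype.ext ?_)
    exact h a a.2 b b.2 h'
  · simp

namespace CharacterTable

variable {S : Type*} [Group S] [Fintype S] [DecidableEq S] (T : CharacterTable S)
  (A B : Subgroup S) [Fintype A] [Fintype B]

/-- The multiplicity of a linear character of a subgroup in an irreducible character. -/
noncomputable def mult (φ : A →* ℂˣ) (i : Fin T.size) : ℤ := (T.exists_multiplicity i A φ).choose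

theorem card_mul_mult (φ : A →* ℂˣ) (i : Fin T.size) :
    (Fintype.card A : ℂ) * T.mult A φ i = ∑ a : A, ((φ a⁻¹ : ℂˣ) : ℂ) * T.val i a := by
  rw [(T.exists_multiplicity i A φ).choose_spec, mult, Int.cast_natCast]

theorem card_mul_mult' (φ : A →* ℂˣ) (i : Fin T.size) :
    (Fintype.card A : ℂ) * T.mult A φ i = ∑ a : A, (φ a : ℂ) * T.val i (a : S)⁻¹ := by
  rw [card_mul_mult]
  exact Fintype.sum_equiv (Equiv.inv A) _ _ fun a => by simp

theorem card_mul_card_mul_dotProduct (φ : A →* ℂˣ) (ψ : B →* ℂˣ) :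
    (Fintype.card A * Fintype.card B * (T.mult A φ ⬝ᵥ T.mult B ψ : ℤ) : ℂ) =
      ∑ g : S, ∑ a : A, ∑ b : B,
        if (a : S) * g = g * b then ((φ a⁻¹ : ℂˣ) : ℂ) * (ψ b : ℂ) else 0 := by
  have h1 : (Fintype.card A * Fintype.card B * (T.mult A φ ⬝ᵥ T.mult B ψ : ℤ) : ℂ) =
      ∑ i, (∑ a : A, ((φ a⁻¹ : ℂˣ) : ℂ) * T.val i a) * ∑ b : B, (ψ b : ℂ) * T.val i (b : S)⁻¹ := by
    rw [dotProduct, Int.cast_sum, Finset.mul_sum]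
    refine Finset.sum_congr rfl fun i _ => ?_
    rw [← card_mul_mult, ← card_mul_mult']
    push_cast
    ring
  have h2 : ∀ i, (∑ a : A, ((φ a⁻¹ : ℂˣ) : ℂ) * T.val i a) *
      (∑ b : B, (ψ b : ℂ) * T.val i (b : S)⁻¹) = ∑ a : A, ∑ b : B,
        ((φ a⁻¹ : ℂˣ) : ℂ) * (ψ b : ℂ) * (T.val i a * T.val i (b : S)⁻¹) := by
    intro i
    rw [Finset.sum_mul_sum]
    refine Finset.sum_congr rfl fun a _ => Finset.sum_congr rfl fun b _ => ?_
    ring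
  rw [h1, Finset.sum_congr rfl fun i _ => h2 i, Finset.sum_comm, Finset.sum_comm (γ := S)]
  refine Finset.sum_congr rfl fun a _ => ?_
  rw [Finset.sum_comm, Finset.sum_comm (γ := S)]
  refine Finset.sum_congr rfl fun b _ => ?_
  rw [← Finset.mul_sum, T.sum_mul_inv, Finset.card_filter, Nat.cast_sum, Finset.mul_sum]
  refine Finset.sum_congr rfl fun g _ => ?_
  split_ifs <;> simp

theorem card_mul_card_mul_dotProduct_of_disjoint (φ : A →* ℂˣ) (ψ : B →* ℂˣ)
    (h : ∀ g : S, ∀ a ∈ A, ∀ b ∈ B, a * g = g * b → a = 1) :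
    (Fintype.card A * Fintype.card B * (T.mult A φ ⬝ᵥ T.mult B ψ) : ℤ) = Fintype.card S := by
  have := T.card_mul_card_mul_dotProduct A B φ ψ
  rw [Finset.sum_congr rfl fun g _ => sum_sum_ite_eq_one A B φ ψ (h g), Finset.sum_const,
    Finset.card_univ, nsmul_one] at this
  exact_mod_cast this

/-- The degree of an irreducible character. -/
noncomputable def degree : Fin T.size → ℤ := T.mult ⊥ 1

theorem val_one (i : Fin T.size) : T.val i 1 = T.degree i := by
  have := T.card_mul_mult ⊥ 1 i
  rw [degree]
  rw [Fintype.sum_subsingleton _ (1 : (⊥ : Subgroup S))] at this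
  simpa using this.symm

theorem degree_pos (i : Fin T.size) : 0 < T.degree i := by
  obtain ⟨d, hd, h⟩ := T.exists_degree i
  rw [T.val_one] at h
  have : T.degree i = d := by exact_mod_cast h
  omega

theorem card_mul_mult_dotProduct_degree (φ : A →* ℂˣ) :
    (Fintype.card A * (T.mult A φ ⬝ᵥ T.degree) : ℤ) = Fintype.card S := by
  have := T.card_mul_card_mul_dotProduct_of_disjoint A ⊥ φ 1 (by
    intro g a _ b hb hab
    rw [mem_bot.1 hb, mul_one, mul_eq_right] at hab
    exact hab)
  rw [degree]
  simpa using this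

theorem mult_triv [DecidableEq (A →* ℂˣ)] (φ : A →* ℂˣ) :
    T.mult A φ T.triv = if φ = 1 then 1 else 0 := by
  have h := T.card_mul_mult' A φ T.triv
  simp only [T.val_triv, mul_one] at h
  rw [Complex.sum_monoidHom_units] at h
  have hA : (Fintype.card A : ℂ) ≠ 0 := Nat.cast_ne_zero.2 Fintype.card_ne_zero
  split_ifs at h ⊢ with h1
  · have := mul_left_cancel₀ hA (h.trans (mul_one _).symm)
    exact_mod_cast this
  · have := (mul_eq_zero.1 h).resolve_left hA
    exact_mod_cast this

section Commutative

variable [IsMulCommutative A] [Fintype (A →* ℂˣ)]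

theorem val_eq_sum (a : A) (i : Fin T.size) :
    T.val i a = ∑ φ : A →* ℂˣ, (T.mult A φ i : ℂ) * (φ a : ℂ) := by
  have hA : (Fintype.card A : ℂ) ≠ 0 := Nat.cast_ne_zero.2 Fintype.card_ne_zero
  apply mul_left_cancel₀ hA
  rw [Finset.mul_sum]
  have h : ∀ φ : A →* ℂˣ, (Fintype.card A : ℂ) * ((T.mult A φ i : ℂ) * (φ a : ℂ)) =
      ∑ b : A, T.val i b * (φ (b⁻¹ * a) : ℂ) := by
    intro φ
    rw [← mul_assoc, T.card_mul_mult, Finset.sum_mul]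
    refine Finset.sum_congr rfl fun b _ => ?_
    rw [map_mul, Units.val_mul]
    ring
  rw [Finset.sum_congr rfl fun φ _ => h φ, Finset.sum_comm]
  simp only [← Finset.mul_sum]
  rw [Finset.sum_eq_single a]
  · rw [Complex.sum_monoidHom_units_apply, inv_mul_cancel, if_pos rfl, Nat.card_eq_fintype_card,
      mul_comm]
  · intro b _ hb
    rw [Complex.sum_monoidHom_units_apply, if_neg, mul_zero]
    rwa [inv_mul_eq_one]
  · simp

theorem degree_eq_sum (i : Fin T.size) : T.degree i = ∑ φ : A →* ℂˣ, T.mult A φ i := by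
  have h := T.val_eq_sum A 1 i
  simp only [map_one, Units.val_one, mul_one] at h
  rw [OneMemClass.coe_one, val_one] at h
  exact_mod_cast h

theorem sum_val_mul_val_inv (i : Fin T.size) :
    ∑ a : A, T.val i a * T.val i (a : S)⁻¹ =
      Fintype.card A * ∑ φ : A →* ℂˣ, (T.mult A φ i : ℂ) ^ 2 := by
  have h : ∀ a : A, T.val i a * T.val i (a : S)⁻¹ =
      ∑ φ : A →* ℂˣ, (T.mult A φ i : ℂ) * ((φ a : ℂ) * T.val i (a : S)⁻¹) := by
    intro a
    rw [T.val_eq_sum A a i, Finset.sum_mul]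
    exact Finset.sum_congr rfl fun φ _ => mul_assoc _ _ _
  rw [Finset.sum_congr rfl fun a _ => h a, Finset.sum_comm, Finset.mul_sum]
  refine Finset.sum_congr rfl fun φ _ => ?_
  rw [← Finset.mul_sum, ← card_mul_mult']
  ring

end Commutative

end CharacterTable

namespace Subgroup

variable {S : Type*} [Group S] (P : Subgroup S)

/-- The conjugate of a linear character under an element of the normalizer. -/
def conjHom (φ : P →* ℂˣ) (g : normalizer (P : Set S)) : P →* ℂˣ :=
  φ.comp (P.normalizerMonoidHom g : P →* P)

variable {P}

theorem conjHom_mul (φ : P →* ℂˣ) (g h : normalizer (P : Set S)) :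
    P.conjHom φ (g * h) = P.conjHom (P.conjHom φ g) h := by
  rw [conjHom, map_mul]
  rfl

theorem conjHom_one (φ : P →* ℂˣ) : P.conjHom φ 1 = φ := by
  rw [conjHom, map_one]
  rfl

theorem one_conjHom (g : normalizer (P : Set S)) : P.conjHom 1 g = 1 := rfl

theorem conjHom_apply (φ : P →* ℂˣ) (g : normalizer (P : Set S)) (x : P) :
    P.conjHom φ g x = φ ⟨g * x * (g : S)⁻¹, (mem_normalizer_iff.1 g.2 x).1 x.2⟩ := rfl

theorem conjHom_eq_iff {φ ψ : P →* ℂˣ} {g : normalizer (P : Set S)} :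
    P.conjHom φ g = ψ ↔ φ = P.conjHom ψ g⁻¹ := by
  constructor
  · rintro rfl
    rw [← conjHom_mul, mul_inv_cancel, conjHom_one]
  · rintro rfl
    rw [← conjHom_mul, inv_mul_cancel, conjHom_one]

variable (P) in
/-- The inertia subgroup of a linear character. -/
def inertia (φ : P →* ℂˣ) : Subgroup (normalizer (P : Set S)) where
  carrier := {g | P.conjHom φ g = φ}
  one_mem' := conjHom_one φ
  mul_mem' {g h} hg hh := by
    rw [Set.mem_ofPred_eq, conjHom_mul, hg, hh]
  inv_mem' {g} hg := (conjHom_eq_iff.1 hg).symm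

theorem mem_inertia {φ : P →* ℂˣ} {g : normalizer (P : Set S)} :
    g ∈ P.inertia φ ↔ P.conjHom φ g = φ := Iff.rfl

theorem conjHom_eq_conjHom_iff {φ : P →* ℂˣ} {g h : normalizer (P : Set S)} :
    P.conjHom φ g = P.conjHom φ h ↔ g * h⁻¹ ∈ P.inertia φ := by
  rw [mem_inertia, conjHom_mul, conjHom_eq_iff (g := h⁻¹), inv_inv]

theorem subgroupOf_le_inertia (φ : P →* ℂˣ) : P.subgroupOf (normalizer (P : Set S)) ≤ P.inertia φ := by
  intro g hg
  rw [mem_inertia]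
  ext x
  have : (⟨g * x * (g : S)⁻¹, (mem_normalizer_iff.1 g.2 x).1 x.2⟩ : P) =
    ⟨g, hg⟩ * x * ⟨g, hg⟩⁻¹ := rfl
  rw [conjHom_apply, this, map_mul, map_mul, mul_right_comm, map_inv, mul_inv_cancel, one_mul]

theorem card_filter_conjHom_eq [Finite S] [Fintype (normalizer (P : Set S))]
    [DecidableEq (P →* ℂˣ)] (φ : P →* ℂˣ) (h : normalizer (P : Set S)) :
    (Finset.univ.filter fun g => P.conjHom φ g = P.conjHom φ h).card = Nat.card (P.inertia φ) := by
  classical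
  have := Fintype.ofFinite (P.inertia φ)
  rw [Nat.card_eq_fintype_card, ← Finset.card_univ]
  refine Finset.card_bij' (fun g hg => ⟨g * h⁻¹, conjHom_eq_conjHom_iff.1 (Finset.mem_filter.1 hg).2⟩)
    (fun k _ => k * h) (fun _ _ => Finset.mem_univ _) (fun k _ => ?_) (fun g _ => ?_) fun k _ => ?_
  · rw [Finset.mem_filter]
    refine ⟨Finset.mem_univ _, conjHom_eq_conjHom_iff.2 ?_⟩
    rw [mul_inv_cancel_right]
    exact k.2
  · exact inv_mul_cancel_right _ _
  · exact Subtype.ext (mul_inv_cancel_right _ _)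

theorem sum_sum_ite_eq_conjHom [DecidableEq S] [Fintype P] [DecidableEq (P →* ℂˣ)] (φ ψ : P →* ℂˣ)
    (g : normalizer (P : Set S)) :
    (∑ a : P, ∑ b : P, if (a : S) * g = g * b then ((φ a⁻¹ : ℂˣ) : ℂ) * (ψ b : ℂ) else 0) =
      if P.conjHom φ g = ψ then (Fintype.card P : ℂ) else 0 := by
  rw [Finset.sum_comm]
  have h1 : ∀ b : P, (∑ a : P, if (a : S) * g = g * b then ((φ a⁻¹ : ℂˣ) : ℂ) * (ψ b : ℂ) else 0) =
      (((P.conjHom φ g)⁻¹ * ψ) b : ℂˣ) := by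
    intro b
    rw [Finset.sum_eq_single ⟨g * b * (g : S)⁻¹, (mem_normalizer_iff.1 g.2 b).1 b.2⟩]
    · rw [if_pos (inv_mul_cancel_right _ _), map_inv, ← conjHom_apply]
      rfl
    · intro a _ ha
      refine if_neg fun h => ha (Subtype.ext ?_)
      rw [eq_mul_inv_iff_mul_eq]
      exact h
    · simp
  rw [Finset.sum_congr rfl fun b _ => h1 b, Complex.sum_monoidHom_units]
  refine if_congr ?_ rfl rfl
  rw [DFunLike.ext_iff, DFunLike.ext_iff]
  exact forall_congr' fun x => inv_mul_eq_one

end Subgroup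

namespace CharacterTable

variable {S : Type*} [Group S] [Fintype S] [DecidableEq S] (T : CharacterTable S) (P : Subgroup S)
  [Fintype P]

theorem card_sq_mul_dotProduct [DecidableEq (P →* ℂˣ)] [Fintype (normalizer (P : Set S))]
    (hTI : ∀ g : S, ∀ a ∈ P, ∀ b ∈ P, a * g = g * b → a ≠ 1 → g ∈ normalizer (P : Set S))
    (φ ψ : P →* ℂˣ) :
    (Fintype.card P * Fintype.card P * (T.mult P φ ⬝ᵥ T.mult P ψ) : ℤ) =
      Fintype.card S - Fintype.card (normalizer (P : Set S)) +
        Fintype.card P * (Finset.univ.filter fun g => P.conjHom φ g = ψ).card := by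
  have h := T.card_mul_card_mul_dotProduct P P φ ψ
  classical
  rw [← Fintype.sum_subtype_add_sum_subtype (fun g => g ∈ normalizer (P : Set S))] at h
  have h1 : ∀ g : {g : S // g ∉ normalizer (P : Set S)}, (∑ a : P, ∑ b : P,
      if (a : S) * g = g * b then ((φ a⁻¹ : ℂˣ) : ℂ) * (ψ b : ℂ) else 0) = 1 := fun g =>
    sum_sum_ite_eq_one P P φ ψ fun a ha b hb hab => by
      by_contra ha1
      exact g.2 (hTI g a ha b hb hab ha1)
  have h3 : ∀ g : {g : S // g ∈ normalizer (P : Set S)}, (∑ a : P, ∑ b : P,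
      if (a : S) * g = g * b then ((φ a⁻¹ : ℂˣ) : ℂ) * (ψ b : ℂ) else 0) =
      if P.conjHom φ g = ψ then (Fintype.card P : ℂ) else 0 := sum_sum_ite_eq_conjHom φ ψ
  rw [Finset.sum_congr rfl fun g _ => h1 g, Finset.sum_const, Finset.card_univ, nsmul_one,
    Finset.sum_congr rfl fun g _ => h3 g, ← Finset.sum_filter, Finset.sum_const,
    nsmul_eq_mul, Fintype.card_subtype_compl, Nat.cast_sub (Fintype.card_subtype_le _)] at h
  have h2 : (Fintype.card P * Fintype.card P * (T.mult P φ ⬝ᵥ T.mult P ψ : ℤ) : ℂ) =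
      Fintype.card S - Fintype.card (normalizer (P : Set S)) +
        Fintype.card P * (Finset.univ.filter fun g => P.conjHom φ g = ψ).card := by
    rw [h, add_comm, mul_comm (Fintype.card P : ℂ)]
    congr!
  exact_mod_cast h2

end CharacterTable

theorem Complex.card_monoidHom_units (A : Type*) [Group A] [Finite A] [IsMulCommutative A]
    [Fintype (A →* ℂˣ)] : Fintype.card (A →* ℂˣ) = Nat.card A := by
  classical
  have h := Complex.sum_monoidHom_units_apply (1 : A)
  simp only [map_one, Units.val_one, Finset.sum_const, Finset.card_univ, nsmul_one, if_true] at h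
  exact_mod_cast h

namespace IsSmallSimple

variable {S : Type*} [Group S] [Fintype S]

theorem card_inertia (hS : IsSmallSimple S) {p q : ℕ} [Fact p.Prime] (P : Sylow p S)
    (hq : q.Prime) (hN : Nat.card (normalizer ((P : Subgroup S) : Set S)) = Nat.card P * q)
    {φ : (P : Subgroup S) →* ℂˣ} (hφ : φ ≠ 1) :
    Nat.card ((P : Subgroup S).inertia φ) = Nat.card P := by
  have h1 : Nat.card P ∣ Nat.card ((P : Subgroup S).inertia φ) := by
    have h := card_dvd_of_le (subgroupOf_le_inertia φ)
    rwa [Nat.card_congr (subgroupOfEquivOfLe (H := (P : Subgroup S)) le_normalizer).toEquiv] at h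
  have h2 := card_subgroup_dvd_card ((P : Subgroup S).inertia φ)
  rw [hN] at h2
  obtain ⟨m, hm⟩ := h1
  rw [hm] at h2 ⊢
  rcases (Nat.dvd_prime hq).1 (Nat.dvd_of_mul_dvd_mul_left Nat.card_pos h2) with rfl | rfl
  · rw [mul_one]
  · rw [← hN] at hm
    have htop : ∀ g, (P : Subgroup S).conjHom φ g = φ := fun g => by
      rw [← mem_inertia, (card_eq_iff_eq_top _).1 hm]
      exact mem_top g
    have hker : φ.ker.map (P : Subgroup S).subtype = ⊥ := by
      refine hS.eq_bot_of_normal P (map_subtype_le _) (fun h => hφ ?_) fun g hg => ?_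
      · ext x
        have hx : (x : S) ∈ φ.ker.map (P : Subgroup S).subtype := by
          rw [h]
          exact x.2
        obtain ⟨y, hy, hyx⟩ := mem_map.1 hx
        rw [← Subtype.ext (a1 := y) (a2 := x) hyx, MonoidHom.mem_ker.1 hy]
        rfl
      · refine mem_normalizer_fintype ?_
        rintro _ ⟨x, hx, rfl⟩
        refine ⟨⟨g * x * g⁻¹, (mem_normalizer_iff.1 hg x).1 x.2⟩, ?_, rfl⟩
        have h := DFunLike.congr_fun (htop ⟨g, hg⟩) x
        rw [conjHom_apply] at h
        exact h.trans hx
    have hinj : Function.Injective φ := by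
      rw [← MonoidHom.ker_eq_bot_iff]
      exact (map_eq_bot_iff_of_injective _ (subtype_injective _)).1 hker
    have hP : (P : Subgroup S) = ⊥ := by
      rw [← hS.inf_centralizer_normalizer_eq_bot P, eq_comm, inf_eq_left]
      intro x hx
      refine mem_centralizer_iff.2 fun g hg => ?_
      have h := DFunLike.congr_fun (htop ⟨g, hg⟩) ⟨x, hx⟩
      rw [conjHom_apply] at h
      exact mul_inv_eq_iff_eq_mul.1 (congrArg Subtype.val (hinj h))
    refine absurd ?_ hφ
    ext x
    have : x = 1 := Subtype.ext (mem_bot.1 (hP ▸ x.2))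
    rw [this, map_one]
    rfl

theorem card_filter_conjHom (hS : IsSmallSimple S) {p q : ℕ} [Fact p.Prime] (P : Sylow p S)
    (hq : q.Prime) (hN : Nat.card (normalizer ((P : Subgroup S) : Set S)) = Nat.card P * q)
    [Fintype (normalizer ((P : Subgroup S) : Set S))] [DecidableEq ((P : Subgroup S) →* ℂˣ)]
    {φ : (P : Subgroup S) →* ℂˣ} (hφ : φ ≠ 1) (h : normalizer ((P : Subgroup S) : Set S)) :
    (Finset.univ.filter fun g => (P : Subgroup S).conjHom φ g = (P : Subgroup S).conjHom φ h).card =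
      Nat.card P := by
  rw [card_filter_conjHom_eq, hS.card_inertia P hq hN hφ]

variable [DecidableEq S] (T : CharacterTable S)

theorem card_sq_mul_dotProduct (hS : IsSmallSimple S) {p q : ℕ} [Fact p.Prime] (P : Sylow p S)
    (hN : Nat.card (normalizer ((P : Subgroup S) : Set S)) = Nat.card P * q)
    [Fintype (normalizer ((P : Subgroup S) : Set S))] [Fintype (P : Subgroup S)]
    [DecidableEq ((P : Subgroup S) →* ℂˣ)]
    (φ ψ : (P : Subgroup S) →* ℂˣ) :
    (Nat.card P * Nat.card P * (T.mult P φ ⬝ᵥ T.mult P ψ) : ℤ) = Nat.card S - Nat.card P * q +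
      Nat.card P * (Finset.univ.filter fun g => (P : Subgroup S).conjHom φ g = ψ).card := by
  have h := T.card_sq_mul_dotProduct P (fun g a ha b hb hab ha1 => by
    have h1 : g⁻¹ ∈ normalizer ((P : Subgroup S) : Set S) := by
      refine hS.mem_normalizer_of_conj_mem P ha ha1 ?_
      rw [inv_inv, mul_assoc, hab, inv_mul_cancel_left]
      exact hb
    exact inv_mem_iff.1 h1) φ ψ
  rw [← Nat.card_eq_fintype_card, ← Nat.card_eq_fintype_card, ← Nat.card_eq_fintype_card, hN] at h
  exact_mod_cast h

theorem dotProduct_one_one (hS : IsSmallSimple S) {p q : ℕ} [Fact p.Prime] (P : Sylow p S)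
    (hN : Nat.card (normalizer ((P : Subgroup S) : Set S)) = Nat.card P * q)
    [Fintype (P : Subgroup S)] :
    (Nat.card P * Nat.card P * (T.mult P 1 ⬝ᵥ T.mult P 1) : ℤ) = Nat.card S - Nat.card P * q +
      Nat.card P * Nat.card P * q := by
  classical
  have := Fintype.ofFinite (normalizer ((P : Subgroup S) : Set S))
  rw [hS.card_sq_mul_dotProduct T P hN, Finset.filter_true_of_mem fun g _ => one_conjHom g,
    Finset.card_univ, ← Nat.card_eq_fintype_card, hN]
  push_cast
  ring

theorem dotProduct_one (hS : IsSmallSimple S) {p q : ℕ} [Fact p.Prime] (P : Sylow p S)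
    (hN : Nat.card (normalizer ((P : Subgroup S) : Set S)) = Nat.card P * q)
    [Fintype (P : Subgroup S)] {φ : (P : Subgroup S) →* ℂˣ} (hφ : φ ≠ 1) :
    (Nat.card P * Nat.card P * (T.mult P 1 ⬝ᵥ T.mult P φ) : ℤ) = Nat.card S - Nat.card P * q := by
  classical
  have := Fintype.ofFinite (normalizer ((P : Subgroup S) : Set S))
  rw [hS.card_sq_mul_dotProduct T P hN, Finset.filter_false_of_mem fun g _ h => hφ (by
    rw [← h, one_conjHom])]
  simp

theorem dotProduct_of_ne_one (hS : IsSmallSimple S) {p q : ℕ} [Fact p.Prime] (P : Sylow p S)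
    (hq : q.Prime) (hN : Nat.card (normalizer ((P : Subgroup S) : Set S)) = Nat.card P * q)
    [Fintype (P : Subgroup S)] {φ : (P : Subgroup S) →* ℂˣ} (hφ : φ ≠ 1)
    (ψ : (P : Subgroup S) →* ℂˣ) :
    (Nat.card P * Nat.card P * (T.mult P φ ⬝ᵥ T.mult P ψ) : ℤ) = Nat.card S - Nat.card P * q +
      if T.mult P φ = T.mult P ψ then (Nat.card P * Nat.card P : ℤ) else 0 := by
  classical
  have := Fintype.ofFinite (normalizer ((P : Subgroup S) : Set S))
  have hself : ∀ {χ : (P : Subgroup S) →* ℂˣ}, χ ≠ 1 →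
      (Nat.card P * Nat.card P * (T.mult P χ ⬝ᵥ T.mult P χ) : ℤ) =
        Nat.card S - Nat.card P * q + Nat.card P * Nat.card P := by
    intro χ hχ
    have h := hS.card_filter_conjHom P hq hN hχ 1
    rw [conjHom_one] at h
    rw [hS.card_sq_mul_dotProduct T P hN, h]
  have h := hS.card_sq_mul_dotProduct T P hN φ ψ
  by_cases hg : ∃ g, (P : Subgroup S).conjHom φ g = ψ
  · obtain ⟨g, rfl⟩ := hg
    rw [hS.card_filter_conjHom P hq hN hφ] at h
    rw [h, if_pos]
    have hψ : (P : Subgroup S).conjHom φ g ≠ 1 := by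
      intro h1
      rw [conjHom_eq_iff, one_conjHom] at h1
      exact hφ h1
    have hP : (Nat.card P * Nat.card P : ℤ) ≠ 0 := by
      have : (Nat.card P : ℤ) ≠ 0 := Nat.cast_ne_zero.2 Nat.card_pos.ne'
      exact mul_ne_zero this this
    have h1 := mul_left_cancel₀ hP ((hself hφ).trans h.symm)
    have h2 := mul_left_cancel₀ hP ((hself hψ).trans h.symm)
    rw [← sub_eq_zero, ← dotProduct_self_eq_zero (R := ℤ), sub_dotProduct, dotProduct_sub,
      dotProduct_sub, h1, h2, dotProduct_comm (T.mult P ((P : Subgroup S).conjHom φ g))]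
    ring
  · rw [Finset.filter_false_of_mem fun g _ h1 => hg ⟨g, h1⟩] at h
    rw [h, if_neg]
    · simp
    · intro h1
      have h2 := hself hφ
      nth_rewrite 2 [h1] at h2
      rw [h] at h2
      have : (0 : ℤ) < Nat.card P := Nat.cast_pos.2 Nat.card_pos
      simp at h2

theorem card_filter_mult_eq (hS : IsSmallSimple S) {p q : ℕ} [Fact p.Prime] (P : Sylow p S)
    (hq : q.Prime) (hN : Nat.card (normalizer ((P : Subgroup S) : Set S)) = Nat.card P * q)
    [Fintype (P : Subgroup S)] [Fintype ((P : Subgroup S) →* ℂˣ)]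
    [DecidableEq ((P : Subgroup S) →* ℂˣ)] {φ : (P : Subgroup S) →* ℂˣ} (hφ : φ ≠ 1) :
    ((Finset.univ.erase 1).filter fun ψ => T.mult P ψ = T.mult P φ).card = q := by
  have := Fintype.ofFinite (normalizer ((P : Subgroup S) : Set S))
  have hP0 : (Nat.card P : ℤ) ≠ 0 := Nat.cast_ne_zero.2 Nat.card_pos.ne'
  have hiff : ∀ ψ, T.mult P ψ = T.mult P φ ↔ ∃ g, (P : Subgroup S).conjHom φ g = ψ := by
    intro ψ
    have h1 := hS.dotProduct_of_ne_one T P hq hN hφ ψ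
    rw [hS.card_sq_mul_dotProduct T P hN, add_right_inj] at h1
    constructor
    · intro h
      rw [if_pos h.symm] at h1
      by_contra! hg
      rw [Finset.filter_false_of_mem fun g _ => hg g] at h1
      simp at h1
    · rintro ⟨g, rfl⟩
      by_contra h
      rw [if_neg (Ne.symm h), hS.card_filter_conjHom P hq hN hφ] at h1
      exact mul_ne_zero hP0 hP0 h1
  have h := Finset.card_eq_sum_card_fiberwise (s := Finset.univ)
    (f := fun g => (P : Subgroup S).conjHom φ g)
    (t := (Finset.univ.erase 1).filter fun ψ => T.mult P ψ = T.mult P φ) (fun g _ => by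
      refine Finset.mem_coe.2 (Finset.mem_filter.2 ⟨Finset.mem_erase.2 ⟨fun h1 => ?_, Finset.mem_univ _⟩,
        (hiff _).2 ⟨g, rfl⟩⟩)
      have h1 : (P : Subgroup S).conjHom φ g = 1 := h1
      rw [conjHom_eq_iff, one_conjHom] at h1
      exact hφ h1)
  rw [Finset.card_univ, ← Nat.card_eq_fintype_card, hN, Finset.sum_const_nat fun ψ hψ => by
    obtain ⟨g, rfl⟩ := (hiff ψ).1 (Finset.mem_filter.1 hψ).2
    exact hS.card_filter_conjHom P hq hN hφ g, mul_comm] at h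
  exact (Nat.eq_of_mul_eq_mul_right Nat.card_pos h).symm

end IsSmallSimple

namespace IsSmallSimple

variable {S : Type*} [Group S] [Fintype S]

theorem isMulCommutative_sylow (hS : IsSmallSimple S) {p : ℕ} [Fact p.Prime] (P : Sylow p S) :
    IsMulCommutative (P : Subgroup S) :=
  ⟨⟨fun x y => Subtype.ext (mem_centralizer_iff.1 (hS.le_centralizer_sylow P y.2) x x.2)⟩⟩

variable [DecidableEq S] (T : CharacterTable S)

open scoped Classical in
/-- The restrictions of irreducible characters to a Sylow subgroup have well-behaved nontrivial
constituents. -/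
theorem exists_mult_image (hS : IsSmallSimple S) {p q : ℕ} [Fact p.Prime] (P : Sylow p S)
    (hq : q.Prime) (hN : Nat.card (normalizer ((P : Subgroup S) : Set S)) = Nat.card P * q)
    [Fintype (P : Subgroup S)] [Fintype ((P : Subgroup S) →* ℂˣ)] :
    ∃ U : Finset (Fin T.size → ℤ), (∀ u ∈ U, ∃ φ : (P : Subgroup S) →* ℂˣ, φ ≠ 1 ∧ T.mult P φ = u) ∧
      ∀ {A : Type} [CommRing A] (f : (Fin T.size → ℤ) → A),
        ∑ φ : (P : Subgroup S) →* ℂˣ, f (T.mult P φ) = f (T.mult P 1) + q * ∑ u ∈ U, f u := by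
  refine ⟨(Finset.univ.erase 1).image (T.mult P), fun u hu => ?_, fun f => ?_⟩
  · obtain ⟨φ, hφ, rfl⟩ := Finset.mem_image.1 hu
    exact ⟨φ, Finset.ne_of_mem_erase hφ, rfl⟩
  · rw [← Finset.add_sum_erase _ _ (Finset.mem_univ 1), Finset.sum_comp f (T.mult P),
      Finset.mul_sum]
    congr 1
    refine Finset.sum_congr rfl fun u hu => ?_
    obtain ⟨φ, hφ, rfl⟩ := Finset.mem_image.1 hu
    rw [hS.card_filter_mult_eq T P hq hN (Finset.ne_of_mem_erase hφ), nsmul_eq_mul]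

theorem size_eq (hS : IsSmallSimple S) :
    (T.size : ℚ) = 1 + ∑ k : PrimeIndex S, ((Nat.card k.sylow : ℚ) - 1) / k.weight := by
  classical
  have h := hS.sum_eq (fun g => ∑ i, T.val i g * T.val i g⁻¹) (fun g x => by
    refine Finset.sum_congr rfl fun i _ => ?_
    rw [T.val_conj, show (g * x * g⁻¹)⁻¹ = g * x⁻¹ * g⁻¹ by group, T.val_conj])
  have hn : (Nat.card S : ℂ) ≠ 0 := Nat.cast_ne_zero.2 Nat.card_pos.ne'
  have h1 : ∑ x : S, ∑ i, T.val i x * T.val i x⁻¹ = Nat.card S * T.size := by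
    rw [Finset.sum_comm, Finset.sum_congr rfl fun i _ => T.sum_val_mul_inv i, Finset.sum_const,
      Finset.card_univ, Fintype.card_fin, nsmul_eq_mul, Nat.card_eq_fintype_card, mul_comm]
  have h2 : ∑ i, T.val i (1 : S) * T.val i (1 : S)⁻¹ = Nat.card S := by
    rw [T.sum_mul_inv, Finset.filter_true_of_mem fun g _ => by rw [one_mul, mul_one],
      Finset.card_univ, Nat.card_eq_fintype_card]
  have h3 : ∀ k : PrimeIndex S, ∀ x ∈ (k.sylow : Subgroup S).sharp,
      ∑ i, T.val i x * T.val i x⁻¹ = Nat.card k.sylow := by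
    intro k x hx
    rw [mem_sharp] at hx
    rw [T.sum_mul_inv, ← Nat.card_congr (MulEquiv.subgroupCongr
      (hS.centralizer_singleton_eq k.sylow hx.1 hx.2)).toEquiv, Nat.card_eq_fintype_card,
      Fintype.card_subtype]
    congr! 2
    ext g
    rw [Finset.mem_filter, Finset.mem_filter, mem_centralizer_singleton_iff, eq_comm (a := x * g)]
  rw [h1, h2, Finset.sum_congr rfl fun k _ => by
    rw [Finset.sum_congr rfl (h3 k), Finset.sum_const, nsmul_eq_mul]] at h
  have h4 : ∀ k : PrimeIndex S, (Nat.card S / (Nat.card k.sylow * k.weight) : ℂ) *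
      ((k.sylow : Subgroup S).sharp.card * Nat.card k.sylow) =
      Nat.card S * ((Nat.card k.sylow - 1) / k.weight) := by
    intro k
    have hw : (k.weight : ℂ) ≠ 0 := Nat.cast_ne_zero.2 (hS.weight_prime k).ne_zero
    have hP : (Nat.card k.sylow : ℂ) ≠ 0 := Nat.cast_ne_zero.2 Nat.card_pos.ne'
    have hc : ((k.sylow : Subgroup S).sharp.card : ℂ) = Nat.card k.sylow - 1 := by
      rw [eq_sub_iff_add_eq]
      exact_mod_cast (k.sylow : Subgroup S).card_sharp
    rw [hc]
    field_simp
  rw [Finset.sum_congr rfl fun k _ => h4 k, ← Finset.mul_sum, ← mul_one_add] at h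
  have h5 := mul_left_cancel₀ hn h
  exact_mod_cast h5

theorem one_eq_degree_sq_div_add_sum (hS : IsSmallSimple S)
    [∀ k : PrimeIndex S, Fintype (k.sylow : Subgroup S)]
    [∀ k : PrimeIndex S, Fintype ((k.sylow : Subgroup S) →* ℂˣ)] (i : Fin T.size) :
    (1 : ℚ) = (T.degree i : ℚ) ^ 2 / Nat.card S + ∑ k : PrimeIndex S,
      (Nat.card k.sylow * (∑ φ : (k.sylow : Subgroup S) →* ℂˣ, (T.mult k.sylow φ i : ℚ) ^ 2) -
        (T.degree i : ℚ) ^ 2) / (Nat.card k.sylow * k.weight) := by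
  have h := hS.sum_eq (fun g => T.val i g * T.val i g⁻¹) (fun g x => by
    rw [T.val_conj, show (g * x * g⁻¹)⁻¹ = g * x⁻¹ * g⁻¹ by group, T.val_conj])
  have hn : (Nat.card S : ℂ) ≠ 0 := Nat.cast_ne_zero.2 Nat.card_pos.ne'
  have h2 : T.val i 1 * T.val i (1 : S)⁻¹ = (T.degree i : ℂ) ^ 2 := by
    rw [inv_one, T.val_one, sq]
  have h3 : ∀ k : PrimeIndex S, ∑ x ∈ (k.sylow : Subgroup S).sharp, T.val i x * T.val i x⁻¹ =
      Nat.card k.sylow * (∑ φ : (k.sylow : Subgroup S) →* ℂˣ, (T.mult k.sylow φ i : ℂ) ^ 2) -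
        (T.degree i : ℂ) ^ 2 := by
    intro k
    have := hS.isMulCommutative_sylow k.sylow
    have h4 := T.sum_val_mul_val_inv (k.sylow : Subgroup S) i
    rw [← Nat.card_eq_fintype_card] at h4
    rw [← h4, ← h2, eq_sub_iff_add_eq, add_comm]
    exact (k.sylow : Subgroup S).sum_sharp_add fun x => T.val i x * T.val i x⁻¹
  rw [T.sum_val_mul_inv, h2, Finset.sum_congr rfl fun k _ => by rw [h3 k],
    ← Nat.card_eq_fintype_card] at h
  have h5 : (1 : ℂ) = (T.degree i : ℂ) ^ 2 / Nat.card S + ∑ k : PrimeIndex S,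
      (Nat.card k.sylow * (∑ φ : (k.sylow : Subgroup S) →* ℂˣ, (T.mult k.sylow φ i : ℂ) ^ 2) -
        (T.degree i : ℂ) ^ 2) / (Nat.card k.sylow * k.weight) := by
    have h6 := congrArg (· / (Nat.card S : ℂ)) h
    simp only [div_self hn, add_div, Finset.sum_div] at h6
    refine h6.trans ?_
    congr 1
    refine Finset.sum_congr rfl fun k _ => ?_
    field_simp
  exact_mod_cast h5

/-- A nonabelian simple group whose proper subgroups are nilpotent or minimal non-nilpotent has
even order. -/
theorem two_dvd_card (hS : IsSmallSimple S) : 2 ∣ Nat.card S := by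
  classical
  by_contra h2
  obtain ⟨T⟩ := nonempty_characterTable S
  have hP : ∀ k : PrimeIndex S, Fintype (k.sylow : Subgroup S) := fun k => Fintype.ofFinite _
  have hfin : ∀ k : PrimeIndex S, Fintype ((k.sylow : Subgroup S) →* ℂˣ) := fun k =>
    have := Complex.finite_monoidHom_units (k.sylow : Subgroup S)
    Fintype.ofFinite _
  have hcomm := fun k : PrimeIndex S => hS.isMulCommutative_sylow k.sylow
  choose U hU hsum using fun k : PrimeIndex S =>
    hS.exists_mult_image T k.sylow (hS.weight_prime k) k.card_normalizer
  have hcard : ∀ k : PrimeIndex S, (U k).card * k.weight + 1 = Nat.card k.sylow := by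
    intro k
    have h := hsum k (fun _ => (1 : ℤ))
    rw [Finset.sum_const, Finset.sum_const, Finset.card_univ, Complex.card_monoidHom_units,
      nsmul_one, nsmul_one] at h
    have h' : Nat.card k.sylow = 1 + k.weight * (U k).card := by exact_mod_cast h
    rw [h']
    ring
  have hoddP : ∀ k : PrimeIndex S, Odd (Nat.card k.sylow) := fun k => by
    rw [← Nat.not_even_iff_odd, even_iff_two_dvd]
    exact fun h => h2 (h.trans (card_subgroup_dvd_card _))
  have hoddw : ∀ k : PrimeIndex S, Odd k.weight := fun k => by
    rw [← Nat.not_even_iff_odd, even_iff_two_dvd]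
    refine fun h => h2 (h.trans (Dvd.dvd.trans ?_ (card_subgroup_dvd_card
      (normalizer ((k.sylow : Subgroup S) : Set S)))))
    rw [k.card_normalizer]
    exact dvd_mul_left _ _
  have hweven : ∀ k : PrimeIndex S, Even (U k).card := fun k => by
    have h1 := hoddP k
    rw [← hcard k, Nat.odd_add_one, Nat.not_odd_iff_even, Nat.even_mul] at h1
    exact h1.resolve_right (Nat.not_even_iff_odd.2 (hoddw k))
  have hcardZ : ∀ k : PrimeIndex S, ((U k).card * k.weight + 1 : ℚ) = Nat.card k.sylow := fun k => by
    exact_mod_cast hcard k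
  have hP0 : ∀ k : PrimeIndex S, (Nat.card k.sylow : ℤ) ≠ 0 := fun k =>
    Nat.cast_ne_zero.2 Nat.card_pos.ne'
  have hPQ : ∀ k : PrimeIndex S, (Nat.card k.sylow : ℚ) ≠ 0 := fun k =>
    Nat.cast_ne_zero.2 Nat.card_pos.ne'
  have hwQ : ∀ k : PrimeIndex S, (k.weight : ℚ) ≠ 0 := fun k =>
    Nat.cast_ne_zero.2 (hS.weight_prime k).ne_zero
  have hne : Nonempty (PrimeIndex S) := by
    have := hS.simple
    obtain ⟨x, hx⟩ := exists_ne (1 : S)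
    obtain ⟨k, -⟩ := hS.exists_conj_mem_sylow hx
    exact ⟨k⟩
  refine false_of_exceptional_characters T.triv T.degree (Nat.card S)
    (fun k : PrimeIndex S => T.mult k.sylow 1) U PrimeIndex.weight (fun k => (U k).card)
    (Nat.cast_pos.2 Nat.card_pos) T.degree_pos (fun k => (hS.weight_prime k).two_le) ?_ hweven ?_ ?_
    (fun _ => rfl) ?_ ?_ ?_ ?_ ?_ ?_ ?_ ?_
  · intro k
    obtain ⟨m, hm⟩ := hweven k
    have h1 := k.one_lt_card_sylow
    have h3 := hcard k
    rcases m with _ | m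
    · rw [hm] at h3
      omega
    · omega
  · simp only [hcard]
    exact PrimeIndex.card_sylow_injective
  · have h := hS.size_eq T
    rw [Finset.sum_congr rfl fun k _ => by
      rw [← hcardZ k, add_sub_cancel_right, mul_div_cancel_right₀ _ (hwQ k)]] at h
    rw [Fintype.card_fin]
    exact_mod_cast h
  · intro k u hu u' hu'
    obtain ⟨φ, hφ, rfl⟩ := hU k u hu
    obtain ⟨ψ, hψ, rfl⟩ := hU k u' hu'
    apply mul_left_cancel₀ (mul_ne_zero (hP0 k) (hP0 k))
    have e1 := hS.dotProduct_one_one T k.sylow k.card_normalizer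
    have e2 := hS.dotProduct_one T k.sylow k.card_normalizer hφ
    have e3 := hS.dotProduct_one T k.sylow k.card_normalizer hψ
    have e4 := hS.dotProduct_of_ne_one T k.sylow (hS.weight_prime k) k.card_normalizer hφ ψ
    rw [dotProduct_comm] at e2
    simp only [sub_dotProduct, dotProduct_sub, mul_sub, mul_add, e1, e2, e3, e4]
    split_ifs <;> ring
  · intro k l hkl u hu u' hu'
    obtain ⟨φ, hφ, rfl⟩ := hU k u hu
    obtain ⟨ψ, hψ, rfl⟩ := hU l u' hu'
    apply mul_left_cancel₀ (mul_ne_zero (hP0 k) (hP0 l))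
    have e : ∀ φ ψ, (Nat.card k.sylow * Nat.card l.sylow *
        (T.mult k.sylow φ ⬝ᵥ T.mult l.sylow ψ) : ℤ) = Nat.card S := by
      intro φ ψ
      have h0 := T.card_mul_card_mul_dotProduct_of_disjoint _ _ φ ψ fun g a ha b hb hab => ?_
      · simpa only [← Nat.card_eq_fintype_card] using h0
      have h1 : a ^ Nat.card k.sylow = 1 := pow_card_eq_one_of_mem ha
      have h3 : a ^ Nat.card l.sylow = 1 := by
        rw [eq_mul_inv_iff_mul_eq.2 hab, conj_pow, pow_card_eq_one_of_mem hb, mul_one,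
          mul_inv_cancel]
      have h4 := orderOf_dvd_iff_pow_eq_one.2 h1
      have h5 := orderOf_dvd_iff_pow_eq_one.2 h3
      have h6 := Nat.dvd_gcd h4 h5
      rw [PrimeIndex.coprime_card_sylow hkl, Nat.dvd_one, orderOf_eq_one_iff] at h6
      exact h6
    simp only [sub_dotProduct, dotProduct_sub, mul_sub, e]
    ring
  · intro k
    rw [T.mult_triv, if_pos rfl]
  · intro k u hu
    obtain ⟨φ, hφ, rfl⟩ := hU k u hu
    rw [T.mult_triv, if_neg hφ]
  · intro k u hu
    obtain ⟨φ, hφ, rfl⟩ := hU k u hu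
    apply mul_left_cancel₀ (hP0 k)
    have e : ∀ φ, (Nat.card k.sylow * (T.mult k.sylow φ ⬝ᵥ T.degree) : ℤ) = Nat.card S := by
      intro φ
      have h0 := T.card_mul_mult_dotProduct_degree _ φ
      simpa only [← Nat.card_eq_fintype_card] using h0
    rw [sub_dotProduct, mul_sub, e, e, sub_self, mul_zero]
  · intro k i
    rw [T.degree_eq_sum (k.sylow : Subgroup S)]
    exact hsum k fun u => u i
  · intro i
    refine (hS.one_eq_degree_sq_div_add_sum T i).trans (congrArg _ ?_)
    refine Finset.sum_congr rfl fun k _ => ?_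
    rw [hcardZ k, ← hsum k fun u => (u i : ℚ) ^ 2]
  · refine hS.class_equation.trans (congrArg _ ?_)
    refine Finset.sum_congr rfl fun k _ => ?_
    rw [← hcardZ k, add_sub_cancel_right, hcardZ k, mul_div_mul_right _ _ (hwQ k)]

end IsSmallSimple

end

section

open Subgroup

theorem isNilpotent_or_minimalNonNilpotent_of_surjective {M N : Type*} [Group M] [Group N]
    {f : M →* N} (hf : Function.Surjective f)
    (h : Group.IsNilpotent M ∨ MinimalNonNilpotent M) :
    Group.IsNilpotent N ∨ MinimalNonNilpotent N := by
  by_cases hN : Group.IsNilpotent N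
  · exact .inl hN
  refine .inr ⟨hN, fun L hL => ?_⟩
  have hM : ¬ Group.IsNilpotent M := fun hM => hN (Group.nilpotent_of_surjective f hf)
  have h1 : L.comap f ≠ ⊤ := fun h => hL (by
    rw [← map_comap_eq_self_of_surjective hf L, h, ← MonoidHom.range_eq_map,
      MonoidHom.range_eq_top.2 hf])
  have := (h.resolve_left hM).2 _ h1
  exact Group.nilpotent_of_surjective (f.subgroupComap L)
    (f.subgroupComap_surjective_of_surjective L hf)

/-- An insoluble group with soluble proper subgroups which is para-Nil-Hamiltonian maps onto a
simple group of the same kind. -/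
theorem ParaNilHamiltonian.exists_isSmallSimple_quotient {G : Type*} [Group G] [Finite G]
    (hG : ParaNilHamiltonian G) (hinsol : ¬ Group.IsSolvable G)
    (hmin : ∀ H : Subgroup G, H ≠ ⊤ → Group.IsSolvable H) :
    ∃ (F : Subgroup G) (_ : F.Normal), IsSmallSimple (G ⧸ F) := by
  have hnt : Nontrivial G := by
    by_contra h
    have := not_nontrivial_iff_subsingleton.1 h
    exact hinsol inferInstance
  obtain ⟨F, hF⟩ := (Set.toFinite {N : Subgroup G | N.Normal ∧ N ≠ ⊤}).exists_maximal
    ⟨⊥, inferInstance, bot_ne_top⟩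
  have hFn : F.Normal := hF.1.1
  have hFs : Group.IsSolvable F := hmin F hF.1.2
  have hmk := QuotientGroup.mk'_surjective F
  have hle : ∀ L : Subgroup (G ⧸ F), F ≤ L.comap (QuotientGroup.mk' F) := fun L => by
    have h := ker_le_comap (QuotientGroup.mk' F) L
    rwa [QuotientGroup.ker_mk'] at h
  have hnorm : ∀ L : Subgroup (G ⧸ F), (L.comap (QuotientGroup.mk' F)).Normal →
      L = ⊥ ∨ L = ⊤ := by
    intro L hL
    by_cases ht : L.comap (QuotientGroup.mk' F) = ⊤
    · right
      rw [← map_comap_eq_self_of_surjective hmk L, ht, ← MonoidHom.range_eq_map,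
        MonoidHom.range_eq_top.2 hmk]
    · left
      have h1 := hF.2 ⟨hL, ht⟩ (hle L)
      rw [← map_comap_eq_self_of_surjective hmk L, eq_bot_iff, map_le_iff_le_comap,
        MonoidHom.comap_bot, QuotientGroup.ker_mk']
      exact h1
  have hnt' : Nontrivial (G ⧸ F) := by
    by_contra h
    rw [not_nontrivial_iff_subsingleton, QuotientGroup.subsingleton_iff] at h
    exact hF.1.2 h
  have hcomap : ∀ L : Subgroup (G ⧸ F), L ≠ ⊤ → L.comap (QuotientGroup.mk' F) ≠ ⊤ :=
    fun L hL h => hL (by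
      rw [← map_comap_eq_self_of_surjective hmk L, h, ← MonoidHom.range_eq_map,
        MonoidHom.range_eq_top.2 hmk])
  refine ⟨F, hFn, ⟨⟨fun L hL => hnorm L inferInstance⟩, fun hs => hinsol ?_, fun L hL => ?_,
    fun L hL => ?_⟩⟩
  · exact Group.isSolvable_of_ker_le_range F.subtype (QuotientGroup.mk' F) (by simp)
  · have := hmin _ (hcomap L hL)
    exact Group.isSolvable_of_surjective ((QuotientGroup.mk' F).subgroupComap_surjective_of_surjective L hmk)
  · by_cases hb : L = ⊥
    · subst hb
      exact .inl inferInstance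
    refine isNilpotent_or_minimalNonNilpotent_of_surjective
      ((QuotientGroup.mk' F).subgroupComap_surjective_of_surjective L hmk) (hG.2 _ fun h => ?_)
    exact (hnorm L h).elim hb hL

theorem commutator_eq_top_of_not_isSolvable {G : Type*} [Group G] (hinsol : ¬ Group.IsSolvable G)
    (hmin : ∀ H : Subgroup G, H ≠ ⊤ → Group.IsSolvable H) : commutator G = ⊤ := by
  by_contra h
  have := hmin _ h
  refine hinsol (Group.isSolvable_of_ker_le_range (commutator G).subtype (Abelianization.of (G := G)) ?_)
  rw [Abelianization.ker_of, range_subtype]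

/-- The simple quotient is the alternating group of degree five. -/
theorem ParaNilHamiltonian.exists_surjective_alternatingGroup {G : Type*} [Group G] [Finite G]
    (hG : ParaNilHamiltonian G) (hinsol : ¬ Group.IsSolvable G)
    (hmin : ∀ H : Subgroup G, H ≠ ⊤ → Group.IsSolvable H) :
    ∃ φ : G →* alternatingGroup (Fin 5), Function.Surjective φ := by
  classical
  obtain ⟨F, hF, hS⟩ := hG.exists_isSmallSimple_quotient hinsol hmin
  have := Fintype.ofFinite (G ⧸ F)
  obtain ⟨e⟩ := hS.nonempty_mulEquiv_of_even hS.two_dvd_card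
  exact ⟨e.toMonoidHom.comp (QuotientGroup.mk' F),
    e.surjective.comp (QuotientGroup.mk'_surjective F)⟩

theorem pow_eq_one_of_coprime {M : Type*} [Monoid M] {x : M} {m n : ℕ} (h : m.Coprime n)
    (hm : x ^ m = 1) (hn : x ^ n = 1) : x = 1 := by
  rw [← orderOf_eq_one_iff]
  exact Nat.eq_one_of_dvd_coprimes h (orderOf_dvd_of_pow_eq_one hm) (orderOf_dvd_of_pow_eq_one hn)

theorem card_comap_of_surjective {G A : Type*} [Group G] [Group A] [Finite G] {φ : G →* A}
    (hφ : Function.Surjective φ) (K : Subgroup A) :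
    Nat.card (K.comap φ) = Nat.card K * Nat.card φ.ker := by
  have := Finite.of_surjective φ hφ
  have h1 := (K.comap φ).card_mul_index
  rw [index_comap_of_surjective K hφ, ← φ.ker.card_mul_index, index_ker,
    MonoidHom.range_eq_top.2 hφ, card_top, ← K.card_mul_index] at h1
  refine Nat.eq_of_mul_eq_mul_right (Nat.pos_of_ne_zero K.index_ne_zero_of_finite) (h1.trans ?_)
  ring

/-- A proper subgroup of order `2 * r` containing an element `c` of order dividing `r` and an
involution `s` inverting it. -/
structure IsDihedralPair {A : Type*} [Group A] (r : ℕ) (c s : A) (K : Subgroup A) : Prop where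
  prime : r.Prime
  ne_two : r ≠ 2
  pow_eq_one : c ^ r = 1
  ne_one : c ≠ 1
  sq_eq_one : s ^ 2 = 1
  conj_eq : s * c * s⁻¹ = c⁻¹
  invol_ne_one : s ≠ 1
  mem_left : c ∈ K
  mem_right : s ∈ K
  card_eq : Nat.card K = 2 * r
  ne_top : K ≠ ⊤

namespace IsDihedralPair

variable {A : Type*} [Group A] {r : ℕ} {c s : A} {K : Subgroup A}

theorem sq_ne_one (h : IsDihedralPair r c s K) {n : ℕ} : (c ^ 2) ^ 2 ^ n ≠ 1 := by
  intro hc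
  rw [← pow_mul, ← pow_succ'] at hc
  exact h.ne_one (pow_eq_one_of_coprime (((Nat.coprime_primes Nat.prime_two h.prime).2
    h.ne_two.symm).pow_left _) hc h.pow_eq_one)

theorem not_isNilpotent (h : IsDihedralPair r c s K) : ¬ Group.IsNilpotent K := by
  intro hK
  have : Finite K := Nat.finite_of_card_ne_zero (by
    rw [h.card_eq]
    exact mul_ne_zero two_ne_zero h.prime.ne_zero)
  have := Fact.mk h.prime
  have hc : orderOf (⟨c, h.mem_left⟩ : K) = r :=
    orderOf_eq_prime (Subtype.ext h.pow_eq_one) fun hc => h.ne_one (congrArg Subtype.val hc)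
  have hs : orderOf (⟨s, h.mem_right⟩ : K) = 2 :=
    orderOf_eq_prime (Subtype.ext h.sq_eq_one) fun hc => h.invol_ne_one (congrArg Subtype.val hc)
  have h1 := commute_of_isNilpotent_of_isPGroup h.ne_two
    (IsPGroup.of_card (n := 1) ((Nat.card_zpowers _).trans (hc.trans (pow_one r).symm)))
    (IsPGroup.of_card (n := 1) ((Nat.card_zpowers _).trans (hs.trans (pow_one 2).symm)))
    (mem_zpowers _) (mem_zpowers _)
  have h2 : c * s = s * c := congrArg Subtype.val h1
  have h3 := h.conj_eq
  rw [← h2, mul_inv_cancel_right, eq_inv_iff_mul_eq_one, ← sq] at h3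
  exact h.sq_ne_one (n := 0) (by rw [h3, one_pow])

variable {G : Type*} [Group G] [Finite G] {φ : G →* A}

theorem exists_schmidtPair [IsSimpleGroup A] (h : IsDihedralPair r c s K)
    (hφ : Function.Surjective φ) (hG : ParaNilHamiltonian G)
    (hmin : ∀ H : Subgroup G, H ≠ ⊤ → Group.IsSolvable H) :
    ∃ (p q : ℕ) (P Q : Subgroup G), SchmidtPair p q (K.comap φ) P Q := by
  have hmap := map_comap_eq_self_of_surjective hφ K
  have h1 : K.comap φ ≠ ⊤ := fun ht => h.ne_top (by
    rw [← hmap, ht, ← MonoidHom.range_eq_map, MonoidHom.range_eq_top.2 hφ])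
  have h2 : ¬ (K.comap φ).Normal := fun hn => by
    have h3 := hn.map φ hφ
    rw [hmap] at h3
    refine (h3.eq_bot_or_eq_top).elim (fun hb => ?_) h.ne_top
    exact h.ne_one (mem_bot.1 (hb ▸ h.mem_left))
  refine MinimalNonNilpotent.exists_schmidtPair (hmin _ h1) ((hG.2 _ h2).resolve_left fun hn => ?_)
  exact h.not_isNilpotent (Group.nilpotent_of_surjective (φ.subgroupComap K)
    (φ.subgroupComap_surjective_of_surjective K hφ))

theorem card_comap (h : IsDihedralPair r c s K) (hφ : Function.Surjective φ) :
    Nat.card (K.comap φ) = 2 * r * Nat.card φ.ker := by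
  rw [card_comap_of_surjective hφ, h.card_eq]

end IsDihedralPair

theorem SchmidtPair.eq_or_eq_of_dvd {G : Type*} [Group G] [Finite G] {p q : ℕ}
    {H P Q : Subgroup G} (h : SchmidtPair p q H P Q) {d : ℕ} (hd : d.Prime)
    (hdH : d ∣ Nat.card H) : d = p ∨ d = q := by
  have := Fact.mk h.p_prime
  have := Fact.mk h.q_prime
  obtain ⟨m, hm⟩ := IsPGroup.iff_card.1 h.isPGroup_left
  obtain ⟨n, hn⟩ := IsPGroup.iff_card.1 h.isPGroup_right
  rw [h.card_eq, hm, hn] at hdH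
  exact (hd.dvd_mul.1 hdH).imp
    (fun h' => (Nat.prime_dvd_prime_iff_eq hd h.p_prime).1 (hd.dvd_of_dvd_pow h'))
    (fun h' => (Nat.prime_dvd_prime_iff_eq hd h.q_prime).1 (hd.dvd_of_dvd_pow h'))

namespace IsDihedralPair

variable {A G : Type*} [Group A] [Group G] [Finite G] {r : ℕ} {c s : A} {K : Subgroup A}
  {φ : G →* A} {p q : ℕ} {P Q : Subgroup G}

theorem eq_or_eq (h : IsDihedralPair r c s K) (hφ : Function.Surjective φ)
    (hH : SchmidtPair p q (K.comap φ) P Q) : p = 2 ∧ q = r ∨ p = r ∧ q = 2 := by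
  have h1 := hH.eq_or_eq_of_dvd Nat.prime_two (by
    rw [h.card_comap hφ, mul_assoc]
    exact dvd_mul_right _ _)
  have h2 := hH.eq_or_eq_of_dvd h.prime (by
    rw [h.card_comap hφ, mul_right_comm]
    exact dvd_mul_left _ _)
  have := h.ne_two
  omega

theorem eq_two_or_eq_of_dvd_card_ker [IsSimpleGroup A] (h : IsDihedralPair r c s K)
    (hφ : Function.Surjective φ) (hG : ParaNilHamiltonian G)
    (hmin : ∀ H : Subgroup G, H ≠ ⊤ → Group.IsSolvable H) {d : ℕ} (hd : d.Prime)
    (hdF : d ∣ Nat.card φ.ker) : d = 2 ∨ d = r := by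
  obtain ⟨p, q, P, Q, hH⟩ := h.exists_schmidtPair hφ hG hmin
  have h1 := hH.eq_or_eq_of_dvd hd (by
    rw [h.card_comap hφ]
    exact hdF.mul_left _)
  have := h.eq_or_eq hφ hH
  omega

theorem eq_two_right (h : IsDihedralPair r c s K) (hφ : Function.Surjective φ)
    (hF : IsPGroup 2 φ.ker) (hH : SchmidtPair p q (K.comap φ) P Q) : p = r ∧ q = 2 := by
  refine (h.eq_or_eq hφ hH).resolve_left ?_
  rintro ⟨rfl, rfl⟩
  obtain ⟨x, hx⟩ := hφ s
  obtain ⟨y, hy⟩ := hφ c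
  have hxF : x ^ 2 ∈ φ.ker := by rw [MonoidHom.mem_ker, map_pow, hx, h.sq_eq_one]
  obtain ⟨n, hn⟩ := hF ⟨x ^ 2, hxF⟩
  have hn' : x ^ 2 ^ (n + 1) = 1 := by
    rw [pow_succ', pow_mul]
    exact congrArg Subtype.val hn
  have hxP : zpowers x ≤ P := hH.le_left
    (by rw [zpowers_le, mem_comap, hx]; exact h.mem_right)
    (IsPGroup.iff_card.2 (by
      rw [Nat.card_zpowers]
      obtain ⟨k, -, hk⟩ := (Nat.dvd_prime_pow Nat.prime_two).1 (orderOf_dvd_of_pow_eq_one hn')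
      exact ⟨k, hk⟩))
  have hyH : y ∈ K.comap φ := by rw [mem_comap, hy]; exact h.mem_left
  have hw : y * x * y⁻¹ * x⁻¹ ∈ P :=
    P.mul_mem ((mem_normalizer_iff.1 (hH.normal_left hyH) x).1 (hxP (mem_zpowers x)))
      (P.inv_mem (hxP (mem_zpowers x)))
  obtain ⟨m, hm⟩ := hH.isPGroup_left ⟨_, hw⟩
  have h3 := congrArg (fun w : P => φ w) hm
  have h4 : c * s * c⁻¹ * s⁻¹ = c ^ 2 := by
    rw [show c * s * c⁻¹ * s⁻¹ = c * (s * c * s⁻¹)⁻¹ by group, h.conj_eq, inv_inv, sq]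
  simp only [SubmonoidClass.coe_pow, map_pow, map_mul, map_inv, hx, hy, h4, OneMemClass.coe_one,
    map_one] at h3
  exact h.sq_ne_one h3

/-- The kernel is centralized by the preimage of the dihedral subgroup, whose Sylow subgroups of
even order are cyclic. -/
theorem exists_orderOf_eq [IsSimpleGroup A] (h : IsDihedralPair r c s K)
    (hφ : Function.Surjective φ) (hG : ParaNilHamiltonian G)
    (hmin : ∀ H : Subgroup G, H ≠ ⊤ → Group.IsSolvable H) (hF : IsPGroup 2 φ.ker) :
    φ.ker ≤ centralizer (K.comap φ : Set G) ∧ ∃ x : G, orderOf x = 2 * Nat.card φ.ker := by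
  obtain ⟨p, q, P, Q, hH⟩ := h.exists_schmidtPair hφ hG hmin
  obtain ⟨rfl, rfl⟩ := h.eq_two_right hφ hF hH
  have hcard : Nat.card Q = 2 * Nat.card φ.ker := by
    have := Fact.mk h.prime
    obtain ⟨m, hm⟩ := IsPGroup.iff_card.1 hH.isPGroup_left
    obtain ⟨n, hn⟩ := IsPGroup.iff_card.1 hH.isPGroup_right
    obtain ⟨k, hk⟩ := IsPGroup.iff_card.1 hF
    have h2p : Nat.Coprime 2 p := (Nat.coprime_primes Nat.prime_two h.prime).2 h.ne_two.symm
    have h1 := hH.card_eq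
    rw [h.card_comap hφ, hm, hn, hk, mul_right_comm, ← pow_succ'] at h1
    rw [hn, hk, ← pow_succ']
    refine Nat.dvd_antisymm ?_ ?_
    · exact (h2p.pow_left n).dvd_of_dvd_mul_right (h1 ▸ dvd_mul_left _ _)
    · exact (h2p.pow _ m).dvd_of_dvd_mul_left (h1 ▸ dvd_mul_right _ _)
  have hFH : φ.ker ≤ K.comap φ := ker_le_comap φ K
  have hpos : 0 < Nat.card φ.ker := Nat.card_pos
  have hsup : φ.ker ⊔ Q = Q := by
    refine (Subgroup.eq_of_le_of_card_ge le_sup_right (Nat.le_of_dvd Nat.card_pos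
      (hH.card_dvd_right (sup_le hFH hH.right_le) ?_))).symm
    exact hF.to_sup_of_normal_left hH.isPGroup_right
  have hlt : φ.ker < Q := by
    refine lt_of_le_of_ne (hsup ▸ le_sup_left) fun he => ?_
    rw [← he] at hcard
    omega
  refine ⟨hH.central_of_lt _ hlt, ?_⟩
  have := hH.isCyclic_right
  obtain ⟨x, hx⟩ := IsCyclic.exists_ofOrder_eq_natCard (α := Q)
  exact ⟨x, by rw [orderOf_coe, hx, hcard]⟩

end IsDihedralPair

end

section

open Subgroup Equiv

/-- The elements fixing or inverting `c` under conjugation. -/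
def invertingSubgroup {A : Type*} [Group A] (c : A) : Subgroup A where
  carrier := {g | g * c * g⁻¹ = c ∨ g * c * g⁻¹ = c⁻¹}
  one_mem' := .inl (by rw [one_mul, inv_one, mul_one])
  mul_mem' := by
    rintro a b ha hb
    have h : a * b * c * (a * b)⁻¹ = a * (b * c * b⁻¹) * a⁻¹ := by group
    change _ ∨ _
    rw [h]
    rcases hb with hb | hb
    · rw [hb]
      exact ha
    · rw [hb, ← conj_inv, inv_inj, inv_eq_iff_eq_inv]
      exact ha.symm
  inv_mem' := by
    rintro a ha
    change _ ∨ _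
    rw [inv_inv, mul_assoc, inv_mul_eq_iff_eq_mul, inv_mul_eq_iff_eq_mul]
    rcases ha with ha | ha
    · exact .inl (by nth_rw 1 [← ha]; group)
    · refine .inr ?_
      rw [mul_inv_eq_iff_eq_mul] at ha
      rw [eq_mul_inv_iff_mul_eq, mul_assoc, ha, mul_inv_cancel_left]

namespace alternatingGroup

theorem card_five : Nat.card (alternatingGroup (Fin 5)) = 60 := by
  rw [nat_card_alternatingGroup, Nat.card_fin]
  rfl

theorem isDihedralPair_invertingSubgroup {r : ℕ} (hr : r.Prime) (h2 : r ≠ 2) (h30 : r < 30)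
    (c s : alternatingGroup (Fin 5)) (hc : c ^ r = 1) (hc1 : c ≠ 1) (hs : s ^ 2 = 1) (hs1 : s ≠ 1)
    (hcs : s * c * s⁻¹ = c⁻¹)
    (hcard : Fintype.card {g // g * c * g⁻¹ = c ∨ g * c * g⁻¹ = c⁻¹} = 2 * r) :
    IsDihedralPair r c s (invertingSubgroup c) := by
  have h : Nat.card (invertingSubgroup c) = 2 * r :=
    (Nat.card_eq_fintype_card (α := {g // g * c * g⁻¹ = c ∨ g * c * g⁻¹ = c⁻¹})).trans hcard
  have hmem : c ∈ invertingSubgroup c := Or.inl (mul_inv_cancel_right c c)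
  refine ⟨hr, h2, hc, hc1, hs, hcs, hs1, hmem, Or.inr hcs, h, fun ht => ?_⟩
  rw [ht, card_top, card_five] at h
  omega

set_option maxRecDepth 100000

theorem exists_isDihedralPair_three :
    ∃ (c s : alternatingGroup (Fin 5)) (K : Subgroup _), IsDihedralPair 3 c s K :=
  ⟨_, _, _, isDihedralPair_invertingSubgroup Nat.prime_three (by decide) (by decide)
    ⟨swap 0 1 * swap 1 2, by rw [Perm.mem_alternatingGroup]; decide⟩
    ⟨swap 0 1 * swap 3 4, by rw [Perm.mem_alternatingGroup]; decide⟩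
    (by decide) (by decide) (by decide) (by decide) (by decide) (by decide)⟩

theorem exists_isDihedralPair_five :
    ∃ (c s : alternatingGroup (Fin 5)) (K : Subgroup _), IsDihedralPair 5 c s K :=
  ⟨_, _, _, isDihedralPair_invertingSubgroup Nat.prime_five (by decide) (by decide)
    ⟨c[0, 1, 2, 3, 4], by rw [Perm.mem_alternatingGroup]; decide⟩
    ⟨swap 1 4 * swap 2 3, by rw [Perm.mem_alternatingGroup]; decide⟩
    (by decide) (by decide) (by decide) (by decide) (by decide) (by decide)⟩

theorem pow_thirty_eq_one (s : alternatingGroup (Fin 5)) : s ^ 30 = 1 := by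
  have : ∀ s : alternatingGroup (Fin 5), s ^ 2 = 1 ∨ s ^ 3 = 1 ∨ s ^ 5 = 1 := by decide
  rcases this s with h | h | h
  · rw [show 30 = 2 * 15 from rfl, pow_mul, h, one_pow]
  · rw [show 30 = 3 * 10 from rfl, pow_mul, h, one_pow]
  · rw [show 30 = 5 * 6 from rfl, pow_mul, h, one_pow]

/-- A four-group permuted transitively by conjugation. -/
theorem exists_conj_four_group : ∀ s : alternatingGroup (Fin 5), s ^ 2 = 1 → s ≠ 1 →
    ∃ t, s * (t * s * t⁻¹) = t * s * t⁻¹ * s ∧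
      t * (t * s * t⁻¹) * t⁻¹ = s * (t * s * t⁻¹) := by
  decide

theorem exists_conj_eq (s : alternatingGroup (Fin 5)) (hs : s ^ 2 = 1) (hs1 : s ≠ 1)
    (s' : alternatingGroup (Fin 5)) (hs' : s' ^ 2 = 1) (hs1' : s' ≠ 1) :
    ∃ t, t * s * t⁻¹ = s' := by
  have key : ∀ s : alternatingGroup (Fin 5), s ^ 2 = 1 → s ≠ 1 →
      ∃ t, t * ⟨swap 0 1 * swap 2 3, by rw [Perm.mem_alternatingGroup]; decide⟩ * t⁻¹ = s := by
    decide
  obtain ⟨t, ht⟩ := key s hs hs1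
  obtain ⟨t', ht'⟩ := key s' hs' hs1'
  refine ⟨t' * t⁻¹, ?_⟩
  rw [← ht, ← ht']
  group

theorem sq_eq_one_of_pow_two_pow {s : alternatingGroup (Fin 5)} {n : ℕ} (h : s ^ 2 ^ n = 1) :
    s ^ 2 = 1 := by
  have h1 : orderOf s ∣ 30 := orderOf_dvd_of_pow_eq_one (pow_thirty_eq_one s)
  obtain ⟨k, -, hk⟩ := (Nat.dvd_prime_pow Nat.prime_two).1 (orderOf_dvd_of_pow_eq_one h)
  apply orderOf_dvd_iff_pow_eq_one.1
  rw [hk] at h1 ⊢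
  rcases k with _ | _ | k
  · exact one_dvd _
  · exact dvd_rfl
  · have : 2 ^ 2 ∣ 30 := (Nat.pow_dvd_pow 2 (by omega)).trans h1
    omega

end alternatingGroup

end

section

open Subgroup

/-- If `x` and two of its conjugates lift a four-group permuted by conjugation modulo a central
subgroup, then `x ^ 4` is a fourth power in that subgroup. -/
theorem exists_pow_four_mul_pow_four_eq_one {G A : Type*} [Group G] [Group A] {φ : G →* A}
    (hz : φ.ker ≤ center G) {x t : G} (hx : φ x ^ 2 = 1)
    (h1 : φ x * (φ t * φ x * (φ t)⁻¹) = φ t * φ x * (φ t)⁻¹ * φ x)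
    (h2 : φ t * (φ t * φ x * (φ t)⁻¹) * (φ t)⁻¹ = φ x * (φ t * φ x * (φ t)⁻¹)) :
    ∃ f ∈ φ.ker, x ^ 4 * f ^ 4 = 1 := by
  have hcomm : ∀ a ∈ φ.ker, ∀ g, g * a = a * g := fun a ha g => mem_center_iff.1 (hz ha) g
  have hconj : ∀ a ∈ φ.ker, ∀ g, g * a * g⁻¹ = a := fun a ha g => by
    rw [hcomm a ha, mul_inv_cancel_right]
  have ha : x ^ 2 ∈ φ.ker := by rwa [MonoidHom.mem_ker, map_pow]
  obtain ⟨y, hy⟩ : ∃ y, y = t * x * t⁻¹ := ⟨_, rfl⟩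
  have hyφ : φ y = φ t * φ x * (φ t)⁻¹ := by simp [hy]
  rw [← hyφ] at h1 h2
  have hy2 : y ^ 2 = x ^ 2 := by rw [hy, conj_pow, hconj _ ha]
  have hc : x * y * x⁻¹ * y⁻¹ ∈ φ.ker := by
    rw [MonoidHom.mem_ker, map_mul, map_mul, map_mul, h1, map_inv, map_inv,
      mul_inv_cancel_right, mul_inv_cancel]
  have hf : (x * y)⁻¹ * (t * y * t⁻¹) ∈ φ.ker := by
    rw [MonoidHom.mem_ker, map_mul, map_inv, map_mul, map_mul, map_mul, map_inv, h2,
      inv_mul_cancel]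
  refine ⟨_, hf, ?_⟩
  obtain ⟨f, hfdef⟩ : ∃ f, f = (x * y)⁻¹ * (t * y * t⁻¹) := ⟨_, rfl⟩
  rw [← hfdef] at hf ⊢
  obtain ⟨c, hcdef⟩ : ∃ c, c = x * y * x⁻¹ * y⁻¹ := ⟨_, rfl⟩
  rw [← hcdef] at hc
  obtain ⟨a, hadef⟩ : ∃ a, a = x ^ 2 := ⟨_, rfl⟩
  rw [← hadef] at ha hy2
  have hxy : x * y = c * (y * x) := by rw [hcdef]; group
  have e1 : t * y * t⁻¹ = x * y * f := by rw [hfdef, mul_inv_cancel_left]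
  have e2 : (x * y * f) ^ 2 = a := by rw [← e1, conj_pow, hy2, hconj _ ha]
  have e3 : c ^ 2 = 1 := by
    have h3 : (x * y * x⁻¹) ^ 2 = a := by rw [conj_pow, hy2, hconj _ ha]
    have h4 : x * y * x⁻¹ = c * y := by rw [hcdef, inv_mul_cancel_right]
    have h5 : Commute c y := (hcomm c hc y).symm
    rwa [h4, h5.mul_pow, hy2, mul_eq_right] at h3
  have e4 : c * (x * y) ^ 2 = a * a := by
    have h5 : c * (x * y) ^ 2 = x * (c * (y * x)) * y := by
      rw [sq, ← mul_assoc x c, hcomm c hc x]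
      simp only [mul_assoc]
    rw [h5, ← hxy, ← mul_assoc x, mul_assoc, ← sq, ← sq, hy2, ← hadef]
  have e5 : (x * y) ^ 2 * f ^ 2 = a := by
    have h5 : Commute (x * y) f := hcomm f hf _
    rwa [h5.mul_pow] at e2
  have e6 : a * f ^ 2 = c := by
    have h6 := congrArg (c * ·) e5
    beta_reduce at h6
    rw [← mul_assoc, e4, hcomm a ha c, mul_assoc] at h6
    exact mul_left_cancel h6
  have h7 : Commute a (f ^ 2) := (hcomm a ha (f ^ 2)).symm
  rw [show 4 = 2 * 2 from rfl, pow_mul, pow_mul, ← hadef, ← h7.mul_pow, e6, e3]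

/-- The kernel of the map onto the alternating group is central of order at most two and lifts of
involutions have order four if it is nontrivial. -/
theorem ParaNilHamiltonian.ker_le_center {G : Type*} [Group G] [Finite G]
    (hG : ParaNilHamiltonian G) (hmin : ∀ H : Subgroup G, H ≠ ⊤ → Group.IsSolvable H)
    {φ : G →* alternatingGroup (Fin 5)} (hφ : Function.Surjective φ) :
    φ.ker ≤ center G ∧ (Nat.card φ.ker = 1 ∨ Nat.card φ.ker = 2 ∧
      ∀ x, φ x ≠ 1 → φ x ^ 2 = 1 → x ^ 2 ≠ 1) := by
  obtain ⟨c, s, K, h3⟩ := alternatingGroup.exists_isDihedralPair_three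
  obtain ⟨c', s', K', h5⟩ := alternatingGroup.exists_isDihedralPair_five
  have hpow := Nat.eq_prime_pow_of_unique_prime_dvd (n := Nat.card φ.ker) (p := 2)
    Nat.card_pos.ne' (fun {d} hd hdF => by
      have e3 := h3.eq_two_or_eq_of_dvd_card_ker hφ hG hmin hd hdF
      have e5 := h5.eq_two_or_eq_of_dvd_card_ker hφ hG hmin hd hdF
      omega)
  have hF : IsPGroup 2 φ.ker := IsPGroup.of_card hpow
  obtain ⟨hcent, x, hx⟩ := h3.exists_orderOf_eq hφ hG hmin hF
  have hz : φ.ker ≤ center G := by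
    have hn : (centralizer (φ.ker : Set G)).Normal := inferInstance
    have hle : K.comap φ ≤ centralizer (φ.ker : Set G) := le_centralizer_iff.1 hcent
    have hmap : map φ (centralizer (φ.ker : Set G)) = ⊤ := by
      refine (hn.map φ hφ).eq_bot_or_eq_top.resolve_left fun hb => ?_
      have h := map_mono (f := φ) hle
      rw [hb, map_comap_eq_self_of_surjective hφ, le_bot_iff] at h
      exact h3.ne_one (mem_bot.1 (h ▸ h3.mem_left))
    have htop : centralizer (φ.ker : Set G) = ⊤ := by
      have h := comap_map_eq φ (centralizer (φ.ker : Set G))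
      rw [hmap, comap_top, sup_eq_left.2 ((ker_le_comap φ K).trans hle)] at h
      exact h.symm
    rwa [centralizer_eq_top_iff_subset] at htop
  refine ⟨hz, ?_⟩
  have hx1 : φ x ≠ 1 := fun h => by
    have := Nat.le_of_dvd Nat.card_pos (orderOf_dvd_natCard (⟨x, h⟩ : φ.ker))
    rw [← orderOf_coe, hx] at this
    have : 0 < Nat.card φ.ker := Nat.card_pos
    omega
  have hx2 : φ x ^ 2 = 1 := by
    refine alternatingGroup.sq_eq_one_of_pow_two_pow
      (n := (Nat.card φ.ker).primeFactorsList.length + 1) ?_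
    rw [← map_pow, pow_succ', ← hpow, ← hx, pow_orderOf_eq_one, map_one]
  obtain ⟨t', ht1, ht2⟩ := alternatingGroup.exists_conj_four_group (φ x) hx2 hx1
  obtain ⟨t, rfl⟩ := hφ t'
  obtain ⟨f, hf, hxf⟩ := exists_pow_four_mul_pow_four_eq_one hz hx2 ht1 ht2
  have hx4 : ∀ m, Nat.card φ.ker = 4 * m → False := fun m hm => by
    have hfm : f ^ (4 * m) = 1 := by
      rw [← hm]
      exact pow_card_eq_one_of_mem hf
    have hcom : Commute (x ^ 4) (f ^ 4) := Commute.pow_pow (mem_center_iff.1 (hz hf) x) 4 4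
    have h := congrArg (· ^ m) hxf
    simp only [one_pow] at h
    rw [hcom.mul_pow, ← pow_mul, ← pow_mul, hfm, mul_one] at h
    have h' := Nat.le_of_dvd (by have : 0 < Nat.card φ.ker := Nat.card_pos; omega)
      (orderOf_dvd_of_pow_eq_one h)
    have : 0 < Nat.card φ.ker := Nat.card_pos
    omega
  generalize (Nat.card φ.ker).primeFactorsList.length = k at hpow
  rcases k with _ | _ | k
  · exact .inl hpow
  · refine .inr ⟨hpow, fun g hg1 hg2 hg => ?_⟩
    obtain ⟨u', hu'⟩ := alternatingGroup.exists_conj_eq (φ x) hx2 hx1 (φ g) hg2 hg1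
    obtain ⟨u, rfl⟩ := hφ u'
    have hw : (u * x * u⁻¹)⁻¹ * g ∈ φ.ker := by
      rw [MonoidHom.mem_ker, map_mul, map_inv, map_mul, map_mul, map_inv, hu', inv_mul_cancel]
    have hw2 : ((u * x * u⁻¹)⁻¹ * g) ^ 2 = 1 := by
      have := pow_card_eq_one_of_mem hw
      rwa [hpow] at this
    have hcom : Commute (u * x * u⁻¹) ((u * x * u⁻¹)⁻¹ * g) := mem_center_iff.1 (hz hw) _
    rw [← mul_inv_cancel_left (u * x * u⁻¹) g, hcom.mul_pow, hw2, mul_one, conj_pow,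
      mul_inv_eq_iff_eq_mul, one_mul, mul_eq_left] at hg
    have := Nat.le_of_dvd two_pos (orderOf_dvd_of_pow_eq_one hg)
    omega
  · refine (hx4 (2 ^ k) ?_).elim
    rw [hpow]
    ring

end

section

open Subgroup
open scoped commutatorElement

theorem commutator_le_of_sq_mem {M : Type*} [Group M] {D : Subgroup M} (hD : D ≤ center M)
    (h : ∀ a : M, a ^ 2 ∈ D) : commutator M ≤ D := by
  refine commutator_le.2 fun a _ b _ => ?_
  have e : ⁅a, b⁆ = (a * b) ^ 2 * (a ^ 2)⁻¹ * (b ^ 2)⁻¹ := by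
    have h1 := mem_center_iff.1 (hD (D.inv_mem (h a))) b⁻¹
    rw [sq b, mul_inv_rev, mul_assoc, ← mul_assoc _ b⁻¹, ← h1, commutatorElement_def]
    simp only [sq, mul_inv_rev, mul_assoc, mul_inv_cancel_left]
  rw [e]
  exact D.mul_mem (D.mul_mem (h _) (D.inv_mem (h a))) (D.inv_mem (h b))

/-- Central elements in the commutator subgroup of order two lie in the commutator subgroup of a
Sylow subgroup. -/
theorem mem_commutator_sylow_of_mem_center {M : Type*} [Group M] [Finite M] (P : Sylow 2 M)
    {z : M} (hz : z ∈ center M) (hz2 : z ^ 2 = 1) (hzc : z ∈ commutator M) :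
    ∃ y ∈ commutator (P : Subgroup M), (y : M) = z := by
  have hc : ∀ g, z * g = g * z := fun g => (mem_center_iff.1 hz g).symm
  have key : ∀ (k : ℕ) (g : M), g⁻¹ * z ^ k * g ∈ (P : Subgroup M) → g⁻¹ * z ^ k * g = z ^ k :=
    fun k g _ => by
      have : Commute (z ^ k) g := Commute.pow_left (hc g) k
      rw [mul_assoc, this.eq, inv_mul_cancel_left]
  have h1 := MonoidHom.transfer_eq_pow (Abelianization.of (G := (P : Subgroup M))) z key
  have h2 : z ∈ (MonoidHom.transfer (Abelianization.of (G := (P : Subgroup M)))).ker :=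
    Abelianization.commutator_subset_ker _ hzc
  rw [MonoidHom.mem_ker, h1, ← MonoidHom.mem_ker, Abelianization.ker_of] at h2
  refine ⟨_, h2, ?_⟩
  obtain ⟨m, hm⟩ : Odd (P : Subgroup M).index := by
    rw [← Nat.not_even_iff_odd, even_iff_two_dvd]
    exact P.not_dvd_index
  change z ^ (P : Subgroup M).index = z
  rw [hm, pow_succ, pow_mul, hz2, one_pow, one_mul]

theorem exists_mem_ker_of_card_ker_eq_two {G A : Type*} [Group G] [Group A] {φ : G →* A}
    (hc : Nat.card φ.ker = 2) : ∃ z ∈ φ.ker, z ≠ 1 ∧ ∀ x ∈ φ.ker, x ≠ 1 → x = z := by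
  obtain ⟨z, hz, hu⟩ := (Nat.card_eq_two_iff' (1 : φ.ker)).1 hc
  exact ⟨z, z.2, fun h => hz (Subtype.ext h), fun x hx h =>
    congrArg Subtype.val (hu ⟨x, hx⟩ fun h' => h (congrArg Subtype.val h'))⟩

theorem sq_eq_one_of_mem_ker_of_card_eq_two {G A : Type*} [Group G] [Group A] {φ : G →* A}
    (hc : Nat.card φ.ker = 2) {x : G} (hx : x ∈ φ.ker) : x ^ 2 = 1 := by
  have h := pow_card_eq_one' (x := (⟨x, hx⟩ : φ.ker))
  rw [hc] at h
  exact congrArg Subtype.val h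

/-- Perfect double covers in which all involutions lift to elements of order four are unique. -/
theorem nonempty_mulEquiv_of_double_covers {G₁ G₂ A : Type*} [Group G₁] [Group G₂] [Group A]
    [Finite G₁] [Finite G₂] {φ₁ : G₁ →* A} {φ₂ : G₂ →* A} (hφ₁ : Function.Surjective φ₁)
    (hφ₂ : Function.Surjective φ₂) (hz₁ : φ₁.ker ≤ center G₁) (hz₂ : φ₂.ker ≤ center G₂)
    (hc₁ : Nat.card φ₁.ker = 2) (hc₂ : Nat.card φ₂.ker = 2)
    (hi₁ : ∀ x, φ₁ x ≠ 1 → φ₁ x ^ 2 = 1 → x ^ 2 ≠ 1)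
    (hi₂ : ∀ x, φ₂ x ≠ 1 → φ₂ x ^ 2 = 1 → x ^ 2 ≠ 1)
    (hA : ∀ (s : A) (n : ℕ), s ^ 2 ^ n = 1 → s ^ 2 = 1) (hperf : commutator G₁ = ⊤) :
    Nonempty (G₁ ≃* G₂) := by
  obtain ⟨z₁, hz₁k, hz₁1, hz₁u⟩ := exists_mem_ker_of_card_ker_eq_two hc₁
  obtain ⟨z₂, hz₂k, hz₂1, hz₂u⟩ := exists_mem_ker_of_card_ker_eq_two hc₂
  obtain ⟨H, hH⟩ : ∃ H, H = (φ₁.comp (MonoidHom.fst G₁ G₂)).eqLocus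
    (φ₂.comp (MonoidHom.snd G₁ G₂)) := ⟨_, rfl⟩
  have hHm : ∀ p : G₁ × G₂, p ∈ H ↔ φ₁ p.1 = φ₂ p.2 := fun p => by rw [hH]; rfl
  have hd : ((z₁, z₂) : G₁ × G₂) ∈ H := (hHm _).2 (hz₁k.trans hz₂k.symm)
  obtain ⟨d, hdd⟩ : ∃ d : H, d = ⟨_, hd⟩ := ⟨_, rfl⟩
  have hd1 : (d : G₁ × G₂) = (z₁, z₂) := by rw [hdd]
  have hcen : ∀ x : H, φ₁ x.1.1 = 1 → x ∈ center H ∧ x ^ 2 = 1 := fun x hx => by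
    have hx2 : φ₂ x.1.2 = 1 := ((hHm _).1 x.2).symm.trans hx
    refine ⟨mem_center_iff.2 fun g => Subtype.ext (Prod.ext ?_ ?_), Subtype.ext (Prod.ext ?_ ?_)⟩
    · exact mem_center_iff.1 (hz₁ hx) _
    · exact mem_center_iff.1 (hz₂ hx2) _
    · exact sq_eq_one_of_mem_ker_of_card_eq_two hc₁ hx
    · exact sq_eq_one_of_mem_ker_of_card_eq_two hc₂ hx2
  have hdk : φ₁ d.1.1 = 1 := by rw [hd1]; exact hz₁k
  have hD : zpowers d ≤ center H := zpowers_le.2 (hcen d hdk).1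
  obtain ⟨P⟩ : Nonempty (Sylow 2 H) := inferInstance
  have hP : commutator (P : Subgroup H) ≤ (zpowers d).comap (P : Subgroup H).subtype := by
    refine commutator_le_of_sq_mem (fun x hx => mem_center_iff.2 fun g => Subtype.ext
      (mem_center_iff.1 (hD hx) g)) fun p => ?_
    obtain ⟨n, hn⟩ := P.2 p
    have hn' : (p : H) ^ 2 ^ n = 1 := congrArg Subtype.val hn
    obtain ⟨q, hq⟩ : ∃ q : H, q = p := ⟨_, rfl⟩
    rw [← hq] at hn'
    change (p : H) ^ 2 ∈ zpowers d
    rw [← hq]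
    have hs := hA (φ₁ q.1.1) n (by
      rw [← map_pow]
      have : q.1.1 ^ 2 ^ n = 1 := congrArg (fun x : H => x.1.1) hn'
      rw [this, map_one])
    by_cases h1 : φ₁ q.1.1 = 1
    · rw [(hcen q h1).2]
      exact one_mem _
    · have e := (hHm _).1 q.2
      have hs2 : φ₂ q.1.2 ^ 2 = 1 := by rw [← e]; exact hs
      have : q ^ 2 = d := Subtype.ext (by
        rw [hd1]
        exact Prod.ext (hz₁u _ ((map_pow φ₁ _ 2).trans hs) (hi₁ _ h1 hs))
          (hz₂u _ ((map_pow φ₂ _ 2).trans hs2)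
            (hi₂ _ (by rwa [← e]) hs2)))
      rw [this]
      exact mem_zpowers d
  have hmain : ∀ x ∈ commutator H, φ₁ x.1.1 = 1 → x.1.1 = 1 ∨ x.1.2 = 1 → x = 1 := by
    intro x hx hk h
    obtain ⟨y, hy, rfl⟩ := mem_commutator_sylow_of_mem_center P (hcen x hk).1 (hcen x hk).2 hx
    obtain ⟨m, hm⟩ := mem_zpowers_iff.1 (hP hy)
    have hd2 := (hcen d hdk).2
    obtain ⟨k, rfl | rfl⟩ := m.even_or_odd'
    · rw [zpow_mul, zpow_ofNat, hd2, one_zpow] at hm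
      exact hm.symm
    · rw [zpow_add, zpow_mul, zpow_ofNat, hd2, one_zpow, one_mul, zpow_one] at hm
      have hm' : d = (y : H) := hm
      rw [← hm', hd1] at h
      exact (h.elim hz₁1 hz₂1).elim
  obtain ⟨f, hf⟩ : ∃ f : H →* G₁, ∀ x, f x = x.1.1 :=
    ⟨(MonoidHom.fst G₁ G₂).comp H.subtype, fun _ => rfl⟩
  obtain ⟨g, hg⟩ : ∃ g : H →* G₂, ∀ x, g x = x.1.2 :=
    ⟨(MonoidHom.snd G₁ G₂).comp H.subtype, fun _ => rfl⟩
  have hfs : Function.Surjective f := fun x => by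
    obtain ⟨y, hy⟩ := hφ₂ (φ₁ x)
    exact ⟨⟨(x, y), (hHm _).2 hy.symm⟩, hf _⟩
  have hfi : Function.Injective (f.comp (commutator H).subtype) := by
    refine (injective_iff_map_eq_one _).2 fun x hx => Subtype.ext ?_
    have h1 : x.1.1.1 = 1 := (hf _).symm.trans hx
    exact hmain x x.2 (by rw [h1, map_one]) (Or.inl h1)
  have hgi : Function.Injective (g.comp (commutator H).subtype) := by
    refine (injective_iff_map_eq_one _).2 fun x hx => Subtype.ext ?_
    have h1 : x.1.1.2 = 1 := (hg _).symm.trans hx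
    exact hmain x x.2 (by rw [(hHm _).1 x.1.2, h1, map_one]) (Or.inr h1)
  have hfc : Function.Surjective (f.comp (commutator H).subtype) := by
    rw [← MonoidHom.range_eq_top, MonoidHom.range_comp, range_subtype, _root_.commutator_def,
      map_commutator, map_top_of_surjective f hfs, ← _root_.commutator_def, hperf]
  have hcard : Nat.card G₁ = Nat.card G₂ := by
    rw [← φ₁.ker.card_mul_index, ← φ₂.ker.card_mul_index, hc₁, hc₂, index_ker, index_ker,
      MonoidHom.range_eq_top.2 hφ₁, MonoidHom.range_eq_top.2 hφ₂]
  obtain ⟨e⟩ : Nonempty (commutator H ≃* G₁) := ⟨MulEquiv.ofBijective _ ⟨hfi, hfc⟩⟩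
  have hgb := (Nat.bijective_iff_injective_and_card _).2
    ⟨hgi, (Nat.card_congr e.toEquiv).trans hcard⟩
  exact ⟨e.symm.trans (MulEquiv.ofBijective _ hgb)⟩

end

section

open Subgroup
open scoped MatrixGroups

namespace Matrix.SpecialLinearGroup

theorem card_subtype_eq_of_fin_two {R : Type*} [CommRing R] (p : R → R → R → R → Prop) :
    Nat.card {g : SL(2, R) // p (g 0 0) (g 0 1) (g 1 0) (g 1 1)} =
      Nat.card {x : R × R × R × R // x.1 * x.2.2.2 - x.2.1 * x.2.2.1 = 1 ∧
        p x.1 x.2.1 x.2.2.1 x.2.2.2} :=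
  Nat.card_congr
    { toFun := fun g => ⟨(g.1 0 0, g.1 0 1, g.1 1 0, g.1 1 1),
        by rw [← det_fin_two]; exact g.1.2, g.2⟩
      invFun := fun x => ⟨⟨!![x.1.1, x.1.2.1; x.1.2.2.1, x.1.2.2.2],
        by rw [det_fin_two_of]; exact x.2.1⟩, x.2.2⟩
      left_inv := fun g => Subtype.ext (Subtype.ext (eta_fin_two _).symm)
      right_inv := fun _ => rfl }

theorem card_two_zmod_five : Nat.card SL(2, ZMod 5) = 120 := by
  have h := card_subtype_eq_of_fin_two (R := ZMod 5) fun _ _ _ _ => True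
  rw [Nat.card_congr (Equiv.subtypeUnivEquiv fun _ => trivial)] at h
  rw [h, Nat.card_eq_fintype_card]
  decide +kernel

/-- The condition on entries defining `monomialNormalizer` is preserved by products. -/
theorem monomialNormalizer_mul_aux {a b c d x y z w : ZMod 5} (hg : a * d - b * c = 1)
    (hg' : a * b = 0 ∧ c * d = 0 ∨ a * d + b * c = 0) (hh : x * w - y * z = 1)
    (hh' : x * y = 0 ∧ z * w = 0 ∨ x * w + y * z = 0) :
    (a * x + b * z) * (a * y + b * w) = 0 ∧ (c * x + d * z) * (c * y + d * w) = 0 ∨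
      (a * x + b * z) * (c * y + d * w) + (a * y + b * w) * (c * x + d * z) = 0 := by
  have hmono : ∀ a b c d : ZMod 5, a * d - b * c = 1 → a * b = 0 ∧ c * d = 0 →
      b = 0 ∧ c = 0 ∨ a = 0 ∧ d = 0 := by
    decide +kernel
  rcases hg' with hg' | hg'
  · rcases hmono a b c d hg hg' with ⟨rfl, rfl⟩ | ⟨rfl, rfl⟩
    · exact hh'.imp (fun h => ⟨by linear_combination a ^ 2 * h.1, by linear_combination d ^ 2 * h.2⟩)
        fun h => by linear_combination a * d * h
    · exact hh'.imp (fun h => ⟨by linear_combination b ^ 2 * h.2, by linear_combination c ^ 2 * h.1⟩)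
        fun h => by linear_combination b * c * h
  rcases hh' with hh' | hh'
  · rcases hmono x y z w hh hh' with ⟨rfl, rfl⟩ | ⟨rfl, rfl⟩
    · exact .inr (by linear_combination x * w * hg')
    · exact .inr (by linear_combination y * z * hg')
  have key : ∀ a d : ZMod 5, a * d = 3 → ∀ b c : ZMod 5, b * c = 2 →
      ∀ u v : ZMod 5, u * v = 1 →
        a * a * u + b * b * v = 0 ∧ c * c * u + d * d * v = 0 ∨ a * c * u + b * d * v = 0 := by
    decide +kernel
  have h5 : (5 : ZMod 5) = 0 := rfl
  have hyz : y * z = 2 := by linear_combination 3 * hh' - 3 * hh - (y * z + 1) * h5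
  have hxw : x * w = 3 := by linear_combination 3 * hh + 3 * hh' - x * w * h5
  refine (key a d ?_ b c ?_ (x * y) (z * w) ?_).imp (fun h => ⟨?_, ?_⟩) fun h => ?_
  · linear_combination 3 * hg + 3 * hg' - a * d * h5
  · linear_combination 3 * hg' - 3 * hg - (b * c + 1) * h5
  · linear_combination y * z * hxw + 3 * hyz + h5
  · linear_combination h.1 + a * b * hh'
  · linear_combination h.2 + c * d * hh'
  · linear_combination 2 * h + (a * d + b * c) * hh'

/-- The normalizer of the monomial subgroup of `SL(2, 5)`. -/
def monomialNormalizer : Subgroup SL(2, ZMod 5) where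
  carrier := {g | g 0 0 * g 0 1 = 0 ∧ g 1 0 * g 1 1 = 0 ∨ g 0 0 * g 1 1 + g 0 1 * g 1 0 = 0}
  one_mem' := by left; simp
  mul_mem' := by
    intro g h hg hh
    have := monomialNormalizer_mul_aux ((det_fin_two _).symm.trans g.2) hg
      ((det_fin_two _).symm.trans h.2) hh
    simpa [mul_apply, Fin.sum_univ_two] using this
  inv_mem' := by
    intro g hg
    have key : ∀ a b c d : ZMod 5, a * d - b * c = 1 →
      (a * b = 0 ∧ c * d = 0 ∨ a * d + b * c = 0) →
      (d * (-b) = 0 ∧ -c * a = 0 ∨ d * a + -b * -c = 0) := by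
      decide +kernel
    have := key _ _ _ _ ((det_fin_two _).symm.trans g.2) hg
    rw [SL2_inv_expl]
    exact this

theorem card_monomialNormalizer : Nat.card monomialNormalizer = 24 := by
  refine (card_subtype_eq_of_fin_two (R := ZMod 5) fun a b c d =>
    a * b = 0 ∧ c * d = 0 ∨ a * d + b * c = 0).trans ?_
  rw [Nat.card_eq_fintype_card]
  decide +kernel

theorem mem_center_two_zmod_five {g : SL(2, ZMod 5)} :
    g ∈ center SL(2, ZMod 5) ↔ g = 1 ∨ g = -1 := by
  rw [mem_center_iff]
  constructor
  · rintro ⟨r, hr, h⟩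
    rw [Fintype.card_fin] at hr
    have h' : ∀ r : ZMod 5, r ^ 2 = 1 → r = 1 ∨ r = -1 := by decide
    rcases h' r hr with rfl | rfl
    · exact .inl (Subtype.ext (by rw [← h, map_one]; rfl))
    · exact .inr (Subtype.ext (by rw [← h, map_neg, map_one]; rfl))
  · rintro (rfl | rfl)
    · exact ⟨1, one_pow _, by rw [map_one]; rfl⟩
    · exact ⟨-1, by decide, by rw [map_neg, map_one]; rfl⟩

theorem neg_one_ne_one_two_zmod_five : (-1 : SL(2, ZMod 5)) ≠ 1 := by
  intro h
  have := congrFun (congrFun (congrArg Subtype.val h) 0) 0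
  exact absurd this (by decide)

theorem card_center_two_zmod_five : Nat.card (center SL(2, ZMod 5)) = 2 :=
  (Nat.card_eq_two_iff' 1).2 ⟨⟨-1, mem_center_two_zmod_five.2 (.inr rfl)⟩,
    fun h => neg_one_ne_one_two_zmod_five (congrArg Subtype.val h),
    fun y hy => Subtype.ext ((mem_center_two_zmod_five.1 y.2).resolve_left
      fun h => hy (Subtype.ext h))⟩

theorem mem_center_of_sq_eq_one {g : SL(2, ZMod 5)} (h : g ^ 2 = 1) :
    g ∈ center SL(2, ZMod 5) := by
  have key : ∀ a b c d : ZMod 5, a * d - b * c = 1 → a * a + b * c = 1 → a * b + b * d = 0 →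
      c * a + d * c = 0 → c * b + d * d = 1 →
      (a = 1 ∧ b = 0 ∧ c = 0 ∧ d = 1) ∨ (a = -1 ∧ b = 0 ∧ c = 0 ∧ d = -1) := by
    decide +kernel
  have h2 : ∀ i j, (g * g) i j = (1 : SL(2, ZMod 5)) i j := fun i j => by rw [← sq, h]
  simp only [coe_mul, mul_apply, Fin.sum_univ_two] at h2
  have := key _ _ _ _ ((det_fin_two _).symm.trans g.2) (h2 0 0) (h2 0 1) (h2 1 0) (h2 1 1)
  rw [mem_center_two_zmod_five]
  refine this.imp (fun h => ?_) fun h => ?_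
  · ext i j
    fin_cases i <;> fin_cases j <;> simp [h]
  · ext i j
    fin_cases i <;> fin_cases j <;> simp [h]

/-- `SL(2, 5)` is a double cover of `A₅` by its centre. -/
theorem exists_surjective_alternatingGroup :
    ∃ ψ : SL(2, ZMod 5) →* alternatingGroup (Fin 5), Function.Surjective ψ ∧
      ψ.ker = center SL(2, ZMod 5) := by
  have : Fact (Nat.Prime 5) := ⟨by norm_num⟩
  have hs : IsSimpleGroup (SL(2, ZMod 5) ⧸ center SL(2, ZMod 5)) :=
    Matrix.ProjectiveSpecialLinearGroup.rank_two_simple (F := ZMod 5) (by rw [Nat.card_zmod]; simp)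
  have hle : center SL(2, ZMod 5) ≤ monomialNormalizer := by
    intro g hg
    left
    rcases mem_center_two_zmod_five.1 hg with rfl | rfl <;> simp
  have h60 : Nat.card (SL(2, ZMod 5) ⧸ center SL(2, ZMod 5)) = 60 := by
    have := (center SL(2, ZMod 5)).card_mul_index
    rw [card_center_two_zmod_five, card_two_zmod_five, index_eq_card] at this
    omega
  have h5 : (monomialNormalizer.map (QuotientGroup.mk' (center SL(2, ZMod 5)))).index = 5 := by
    rw [index_map_eq _ (QuotientGroup.mk'_surjective _) (by rwa [QuotientGroup.ker_mk'])]
    have := monomialNormalizer.card_mul_index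
    rw [card_monomialNormalizer, card_two_zmod_five] at this
    omega
  obtain ⟨e⟩ := IsSimpleGroup.nonempty_mulEquiv_alternatingGroup h60 h5
  refine ⟨(e : _ →* alternatingGroup (Fin 5)).comp (QuotientGroup.mk' (center SL(2, ZMod 5))),
    e.surjective.comp (QuotientGroup.mk'_surjective _), ?_⟩
  rw [MonoidHom.ker_mulEquiv_comp, QuotientGroup.ker_mk']

end Matrix.SpecialLinearGroup

end

/-- A finite minimal insoluble para-Nil-Hamiltonian group is isomorphic to $A_5$
or to $\mathrm{SL}(2,5)$. -/
theorem stmt_3 {G : Type*} [Group G] [Finite G]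
    (hinsol : ¬ IsSolvable G) (hminimal : ∀ H : Subgroup G, H ≠ ⊤ → IsSolvable H)
    (hpara : ParaNilHamiltonian G) :
    Nonempty (G ≃* ↥(alternatingGroup (Fin 5))) ∨
      Nonempty (G ≃* Matrix.SpecialLinearGroup (Fin 2) (ZMod 5)) := by
  obtain ⟨φ, hφ⟩ := hpara.exists_surjective_alternatingGroup hinsol hminimal
  obtain ⟨hle, h1 | ⟨h2, hi⟩⟩ := hpara.ker_le_center hminimal hφ
  · exact .inl ⟨MulEquiv.ofBijective φ
      ⟨φ.ker_eq_bot_iff.1 (Subgroup.card_eq_one.1 h1), hφ⟩⟩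
  · obtain ⟨ψ, hψ, hker⟩ := Matrix.SpecialLinearGroup.exists_surjective_alternatingGroup
    refine .inr (nonempty_mulEquiv_of_double_covers hφ hψ hle hker.le h2
      (hker ▸ Matrix.SpecialLinearGroup.card_center_two_zmod_five) hi (fun x hx _ h => hx ?_)
      (fun s n => alternatingGroup.sq_eq_one_of_pow_two_pow)
      (commutator_eq_top_of_not_isSolvable hinsol hminimal))
    rw [← MonoidHom.mem_ker, hker]
    exact Matrix.SpecialLinearGroup.mem_center_of_sq_eq_one h
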